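/- Let d ≥ 3 be an odd integer, and let k₁, k₂, k₃ be positive integers with k₁+k₂+k₃ = d and each kᵢ ∈ {⌊d/3⌋, ⌈d/3⌉}. Then for every finite set V ⊂ S^{d-1} with exactly d+3 elements one has vol(conv V) ≤ (1/d!) · ∏_{i=1}^{3} (kᵢ+1)^{(kᵢ+1)/2} · kᵢ^{−kᵢ/2}, and there exists a set V ⊂ S^{d-1} with exactly d+3 elements for which equality holds. (In the paper's notation, v_d(d+3) equals this quantity for odd d.) -/

import Mathlib

open MeasureTheory Real

namespace MV

/-- a three-cycle in a tournament, from the three bits `xy`, `yz`, `zx` -/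
def c3 (xy yz zx : Bool) : Bool := xy && yz && zx

/-- locally transitive on four points -/
def lt4 (ab ac ad bc bd cd : Bool) : Bool :=
  !((ab == ac && ac == ad) && (c3 bc cd !bd || c3 (!bc) (!cd) bd)) &&
  !(((!ab) == bc && bc == bd) && (c3 ac cd !ad || c3 (!ac) (!cd) ad)) &&
  !((ac == bc && (!bc) == cd) && (c3 ab bd !ad || c3 (!ab) (!bd) ad)) &&
  !((ad == bd && bd == cd) && (c3 ab bc !ac || c3 (!ab) (!bc) ac))

structure LT {ι : Type*} (s : ι → ι → Bool) : Prop where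
  irr : ∀ i, s i i = false
  asy : ∀ i j, i ≠ j → s j i = !s i j
  out : ∀ a x y z, s a x = true → s a y = true → s a z = true →
    ¬ (s x y = true ∧ s y z = true ∧ s z x = true)
  inn : ∀ a x y z, s x a = true → s y a = true → s z a = true →
    ¬ (s x y = true ∧ s y z = true ∧ s z x = true)

def cy {ι : Type*} (s : ι → ι → Bool) (i j l : ι) : Bool := s i j && s j l && s l i

/-- the pentagon condition -/
def pent {ι : Type*} (s : ι → ι → Bool) (v i j l u : ι) : Bool :=
  cy s v i j && cy s i j l && cy s j l u && cy s l u v && cy s u v i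

theorem cy_rot {ι : Type*} (s : ι → ι → Bool) (i j l : ι) : cy s i j l = cy s j l i := by
  unfold cy; cases s i j <;> cases s j l <;> cases s l i <;> rfl

theorem pent_rot {ι : Type*} (s : ι → ι → Bool) (v i j l u : ι) :
    pent s v i j l u = pent s i j l u v := by
  unfold pent
  cases cy s v i j <;> cases cy s i j l <;> cases cy s j l u <;> cases cy s l u v <;>
    cases cy s u v i <;> rfl

/-- the pulled back tournament -/
def pb {ι : Type*} [DecidableEq ι] (s : ι → ι → Bool) {m : ℕ} (f : Fin m → ι) (p q : Fin m) : Bool :=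
  if f p = f q then decide (p < q) else s (f p) (f q)

theorem cy_ne {ι : Type*} {s : ι → ι → Bool} (h : LT s) {i j l : ι} (hc : cy s i j l = true) :
    i ≠ j ∧ j ≠ l ∧ l ≠ i := by
  simp only [cy, Bool.and_eq_true] at hc
  refine ⟨?_, ?_, ?_⟩ <;> rintro rfl <;> simp [h.irr] at hc

theorem pb_cy {ι : Type*} [DecidableEq ι] {s : ι → ι → Bool} (h : LT s) {m : ℕ} (f : Fin m → ι)
    (p q r : Fin m) : cy (pb s f) p q r = cy s (f p) (f q) (f r) := by
  unfold cy pb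
  by_cases h1 : f p = f q
  · by_cases h2 : f q = f r
    · have h3 : f r = f p := by rw [h1, h2]
      have e1 : s (f p) (f q) = false := by rw [h1]; exact h.irr _
      rw [if_pos h1, if_pos h2, if_pos h3, e1]
      simp only [Bool.false_and]
      rw [Bool.eq_false_iff]
      simp only [ne_eq, Bool.and_eq_true, decide_eq_true_eq, not_and]
      intro a b
      have := a.1.trans a.2
      exact absurd (this.trans b) (lt_irrefl _)
    · have h3 : ¬ f r = f p := by rw [h1]; exact fun h => h2 h.symm
      rw [if_neg h2, if_neg h3, h1]
      rw [h.asy _ _ h2]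
      cases s (f q) (f r) <;> simp [h.irr]
  · by_cases h2 : f q = f r
    · have h3 : ¬ f r = f p := by rw [← h2]; exact fun h => h1 h.symm
      rw [if_neg h1, if_neg h3, ← h2]
      rw [h.asy _ _ h1]
      cases s (f p) (f q) <;> simp [h.irr]
    · rw [if_neg h1, if_neg h2]
      by_cases h3 : f r = f p
      · rw [if_pos h3, h3, h.asy _ _ h1]
        cases s (f p) (f q) <;> simp [h.irr]
      · rw [if_neg h3]

theorem pb_asy {ι : Type*} [DecidableEq ι] {s : ι → ι → Bool} (h : LT s) {m : ℕ} (f : Fin m → ι)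
    (p q : Fin m) (hpq : p < q) : pb s f q p = !pb s f p q := by
  unfold pb
  by_cases h1 : f p = f q
  · rw [if_pos h1, if_pos h1.symm]
    simp [hpq, hpq.le]
  · rw [if_neg h1, if_neg (fun h => h1 h.symm)]
    exact h.asy _ _ h1

theorem pb_LT {ι : Type*} [DecidableEq ι] {s : ι → ι → Bool} (h : LT s) {m : ℕ} (f : Fin m → ι) :
    LT (pb s f) where
  irr i := by simp [pb]
  asy i j hij := by
    rcases lt_or_gt_of_ne hij with h1 | h1
    · exact pb_asy h f _ _ h1
    · rw [pb_asy h f _ _ h1]; simp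
  out a x y z h1 h2 h3 h4 := by
    have hc : cy (pb s f) x y z = true := by simp [cy, h4]
    rw [pb_cy h] at hc
    obtain ⟨n1, n2, n3⟩ := cy_ne h hc
    have hc' := hc
    simp only [cy, Bool.and_eq_true] at hc'
    obtain ⟨⟨c1, c2⟩, c3⟩ := hc'
    unfold pb at h1 h2 h3
    by_cases e1 : f a = f x
    · rw [if_neg (by rw [e1]; exact n3.symm), e1, h.asy _ _ n3, c3] at h3
      simp at h3
    by_cases e2 : f a = f y
    · rw [if_neg (by rw [e2]; exact n1.symm), e2, h.asy _ _ n1, c1] at h1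
      simp at h1
    by_cases e3 : f a = f z
    · rw [if_neg (by rw [e3]; exact n2.symm), e3, h.asy _ _ n2, c2] at h2
      simp at h2
    rw [if_neg e1] at h1
    rw [if_neg e2] at h2
    rw [if_neg e3] at h3
    exact h.out _ _ _ _ h1 h2 h3 ⟨c1, c2, c3⟩
  inn a x y z h1 h2 h3 h4 := by
    have hc : cy (pb s f) x y z = true := by simp [cy, h4]
    rw [pb_cy h] at hc
    obtain ⟨n1, n2, n3⟩ := cy_ne h hc
    have hc' := hc
    simp only [cy, Bool.and_eq_true] at hc'
    obtain ⟨⟨c1, c2⟩, c3⟩ := hc'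
    unfold pb at h1 h2 h3
    by_cases e1 : f x = f a
    · rw [if_neg (by rw [← e1]; exact n1.symm), ← e1, h.asy _ _ n1, c1] at h2
      simp at h2
    by_cases e2 : f y = f a
    · rw [if_neg (by rw [← e2]; exact n2.symm), ← e2, h.asy _ _ n2, c2] at h3
      simp at h3
    by_cases e3 : f z = f a
    · rw [if_neg (by rw [← e3]; exact n3.symm), ← e3, h.asy _ _ n3, c3] at h1
      simp at h1
    rw [if_neg e1] at h1
    rw [if_neg e2] at h2
    rw [if_neg e3] at h3
    exact h.inn _ _ _ _ h1 h2 h3 ⟨c1, c2, c3⟩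

theorem LT.lt4 {ι : Type*} {t : ι → ι → Bool} (h : LT t) (a b c d : ι) (hab : a ≠ b) (hac : a ≠ c)
    (had : a ≠ d) (hbc : b ≠ c) (hbd : b ≠ d) (hcd : c ≠ d) :
    lt4 (t a b) (t a c) (t a d) (t b c) (t b d) (t c d) = true := by
  have e1 := h.asy _ _ hab
  have e2 := h.asy _ _ hac
  have e3 := h.asy _ _ had
  have e4 := h.asy _ _ hbc
  have e5 := h.asy _ _ hbd
  have e6 := h.asy _ _ hcd
  have o1 := h.out a b c d
  have o2 := h.out b a c d
  have o3 := h.out c a b d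
  have o4 := h.out d a b c
  have o1' := h.out a d c b
  have o2' := h.out b d c a
  have o3' := h.out c d b a
  have o4' := h.out d c b a
  have i1 := h.inn a b c d
  have i2 := h.inn b a c d
  have i3 := h.inn c a b d
  have i4 := h.inn d a b c
  have i1' := h.inn a d c b
  have i2' := h.inn b d c a
  have i3' := h.inn c d b a
  have i4' := h.inn d c b a
  rw [e1, e2, e3, e4, e5, e6] at *
  revert o1 o2 o3 o4 o1' o2' o3' o4' i1 i2 i3 i4 i1' i2' i3' i4'
  clear e1 e2 e3 e4 e5 e6
  generalize t a b = x1
  generalize t a c = x2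
  generalize t a d = x3
  generalize t b c = x4
  generalize t b d = x5
  generalize t c d = x6
  cases x1 <;> cases x2 <;> cases x3 <;> cases x4 <;> cases x5 <;> cases x6 <;>
    first | (intros; rfl) | simp

/-- six point tournament from bits, points 0,1,2 forming a cycle -/
def six (x0 x1 x2 y0 y1 y2 z0 z1 z2 xy xz yz : Bool) (p q : Fin 6) : Bool :=
  match p.val, q.val with
  | 0, 1 => true | 1, 0 => false | 1, 2 => true | 2, 1 => false | 2, 0 => true | 0, 2 => false
  | 0, 3 => !x0 | 3, 0 => x0 | 1, 3 => !x1 | 3, 1 => x1 | 2, 3 => !x2 | 3, 2 => x2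
  | 0, 4 => !y0 | 4, 0 => y0 | 1, 4 => !y1 | 4, 1 => y1 | 2, 4 => !y2 | 4, 2 => y2
  | 0, 5 => !z0 | 5, 0 => z0 | 1, 5 => !z1 | 5, 1 => z1 | 2, 5 => !z2 | 5, 2 => z2
  | 3, 4 => xy | 4, 3 => !xy | 3, 5 => xz | 5, 3 => !xz | 4, 5 => yz | 5, 4 => !yz
  | _, _ => false

def val1 (x0 x1 x2 : Bool) : Bool := !(x0 == x1 && x1 == x2)

def val2 (x0 x1 x2 y0 y1 y2 xy : Bool) : Bool :=
  lt4 true (!x0) (!y0) (!x1) (!y1) xy && lt4 false (!x0) (!y0) (!x2) (!y2) xy &&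
  lt4 true (!x1) (!y1) (!x2) (!y2) xy

def val3 (x0 x1 x2 y0 y1 y2 z0 z1 z2 xy xz yz : Bool) : Bool :=
  lt4 (!x0) (!y0) (!z0) xy xz yz && lt4 (!x1) (!y1) (!z1) xy xz yz &&
  lt4 (!x2) (!y2) (!z2) xy xz yz

/-- Principle: to prove a property of cycles among six points. -/
theorem six_principle (C : (Fin 6 → Fin 6 → Fin 6 → Bool) → Prop)
    (hC : ∀ x0 x1 x2 : Bool, val1 x0 x1 x2 = true → ∀ y0 y1 y2 : Bool, val1 y0 y1 y2 = true →
      ∀ xy, val2 x0 x1 x2 y0 y1 y2 xy = true →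
      ∀ z0 z1 z2, val1 z0 z1 z2 = true → ∀ xz, val2 x0 x1 x2 z0 z1 z2 xz = true →
      ∀ yz, val2 y0 y1 y2 z0 z1 z2 yz = true →
      val3 x0 x1 x2 y0 y1 y2 z0 z1 z2 xy xz yz = true →
      C (cy (six x0 x1 x2 y0 y1 y2 z0 z1 z2 xy xz yz)))
    {ι : Type*} [DecidableEq ι] {s : ι → ι → Bool} (h : LT s) (i j l x y z : ι)
    (hc : cy s i j l = true) :
    C (fun p q r => cy s (![i, j, l, x, y, z] p) (![i, j, l, x, y, z] q) (![i, j, l, x, y, z] r)) := by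
  set f := ![i, j, l, x, y, z] with hf
  have ht := pb_LT h f
  set t := pb s f with htd
  have hcy : (fun p q r => cy s (f p) (f q) (f r)) = cy t := by
    funext p q r; exact (pb_cy h f p q r).symm
  rw [hcy]
  have h012 : cy t 0 1 2 = true := by rw [pb_cy h]; exact hc
  simp only [cy, Bool.and_eq_true] at h012
  obtain ⟨⟨a01, a12⟩, a20⟩ := h012
  have a10 : t 1 0 = false := by rw [ht.asy 0 1 (by decide), a01]; rfl
  have a21 : t 2 1 = false := by rw [ht.asy 1 2 (by decide), a12]; rfl
  have a02 : t 0 2 = false := by rw [ht.asy 2 0 (by decide), a20]; rfl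
  have key := hC (t 3 0) (t 3 1) (t 3 2)
  have n30 : t 0 3 = !t 3 0 := ht.asy _ _ (by decide)
  have n31 : t 1 3 = !t 3 1 := ht.asy _ _ (by decide)
  have n32 : t 2 3 = !t 3 2 := ht.asy _ _ (by decide)
  have n40 : t 0 4 = !t 4 0 := ht.asy _ _ (by decide)
  have n41 : t 1 4 = !t 4 1 := ht.asy _ _ (by decide)
  have n42 : t 2 4 = !t 4 2 := ht.asy _ _ (by decide)
  have n50 : t 0 5 = !t 5 0 := ht.asy _ _ (by decide)
  have n51 : t 1 5 = !t 5 1 := ht.asy _ _ (by decide)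
  have n52 : t 2 5 = !t 5 2 := ht.asy _ _ (by decide)
  have n43 : t 4 3 = !t 3 4 := ht.asy _ _ (by decide)
  have n53 : t 5 3 = !t 3 5 := ht.asy _ _ (by decide)
  have n54 : t 5 4 = !t 4 5 := ht.asy _ _ (by decide)
  have v1 : ∀ p : Fin 6, val1 (t p 0) (t p 1) (t p 2) = true ∨ p < 3 := by
    intro p
    by_cases hp : p < 3
    · exact Or.inr hp
    left
    have n0 : p ≠ 0 := by rintro rfl; exact hp (by decide)
    have n1 : p ≠ 1 := by rintro rfl; exact hp (by decide)
    have n2 : p ≠ 2 := by rintro rfl; exact hp (by decide)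
    have o := ht.out p 0 1 2
    have i := ht.inn p 0 1 2
    rw [ht.asy _ _ n0, ht.asy _ _ n1, ht.asy _ _ n2] at i
    rw [a01, a12, a20] at o i
    revert o i
    generalize t p 0 = x1
    generalize t p 1 = x2
    generalize t p 2 = x3
    revert x1 x2 x3
    decide
  have v2 : ∀ p q : Fin 6, 3 ≤ p → p < q → val2 (t p 0) (t p 1) (t p 2) (t q 0) (t q 1) (t q 2) (t p q) = true := by
    intro p q hp hpq
    have n0 : p ≠ 0 := by rintro rfl; exact absurd hp (by decide)
    have n1 : p ≠ 1 := by rintro rfl; exact absurd hp (by decide)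
    have n2 : p ≠ 2 := by rintro rfl; exact absurd hp (by decide)
    have hq := hp.trans hpq.le
    have m0 : q ≠ 0 := by rintro rfl; exact absurd hq (by decide)
    have m1 : q ≠ 1 := by rintro rfl; exact absurd hq (by decide)
    have m2 : q ≠ 2 := by rintro rfl; exact absurd hq (by decide)
    unfold val2
    have k1 := ht.lt4 0 1 p q (by decide) n0.symm m0.symm n1.symm m1.symm hpq.ne
    have k2 := ht.lt4 0 2 p q (by decide) n0.symm m0.symm n2.symm m2.symm hpq.ne
    have k3 := ht.lt4 1 2 p q (by decide) n1.symm m1.symm n2.symm m2.symm hpq.ne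
    rw [← ht.asy _ _ n0, ← ht.asy _ _ n1, ← ht.asy _ _ n2, ← ht.asy _ _ m0, ← ht.asy _ _ m1,
      ← ht.asy _ _ m2]
    rw [a01] at k1
    rw [a02] at k2
    rw [a12] at k3
    rw [k1, k2, k3]; rfl
  have v3 : val3 (t 3 0) (t 3 1) (t 3 2) (t 4 0) (t 4 1) (t 4 2) (t 5 0) (t 5 1) (t 5 2) (t 3 4) (t 3 5)
      (t 4 5) = true := by
    unfold val3
    rw [← n30, ← n31, ← n32, ← n40, ← n41, ← n42, ← n50, ← n51, ← n52]
    rw [ht.lt4 0 3 4 5 (by decide) (by decide) (by decide) (by decide) (by decide) (by decide),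
      ht.lt4 1 3 4 5 (by decide) (by decide) (by decide) (by decide) (by decide) (by decide),
      ht.lt4 2 3 4 5 (by decide) (by decide) (by decide) (by decide) (by decide) (by decide)]
    rfl
  have fin := key ((v1 3).resolve_right (by decide)) (t 4 0) (t 4 1) (t 4 2)
    ((v1 4).resolve_right (by decide)) (t 3 4) (v2 3 4 (by decide) (by decide)) (t 5 0) (t 5 1) (t 5 2)
    ((v1 5).resolve_right (by decide)) (t 3 5) (v2 3 5 (by decide) (by decide)) (t 4 5)
    (v2 4 5 (by decide) (by decide)) v3
  convert fin using 2
  funext p q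
  fin_cases p <;> fin_cases q <;> first | exact ht.irr _ | assumption | rfl

end MV

open MeasureTheory Real
namespace MV

def pentC (c : Fin 6 → Fin 6 → Fin 6 → Bool) (v i j l u : Fin 6) : Bool :=
  c v i j && c i j l && c j l u && c l u v && c u v i

def C0 (c : Fin 6 → Fin 6 → Fin 6 → Bool) : Bool :=
  ((c 3 1 2).toNat + (c 0 3 2).toNat + (c 0 1 3).toNat == 1) &&
  (!(c 3 1 2 && c 0 4 2 && c 0 1 5) ||
    (!(c 3 5 4) && ((c 3 4 5).toNat + (pentC c 5 0 1 2 3).toNat + (pentC c 3 1 2 0 4).toNat + (pentC c 4 2 0 1 5).toNat == 1)))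

def gC (c : Fin 6 → Fin 6 → Fin 6 → Bool) (i j l u v x : Fin 6) : ℕ :=
  (pentC c v i j l u).toNat * ((c j x u).toNat + (c v x j).toNat)

def hC (c : Fin 6 → Fin 6 → Fin 6 → Bool) (a b d : Fin 6) : ℕ :=
  (c a 1 2 && c 0 b 2 && c 0 1 d && c a b d).toNat + gC c 0 1 2 a b d + gC c 1 2 0 a b d + gC c 2 0 1 a b d

def C1 (c : Fin 6 → Fin 6 → Fin 6 → Bool) : Bool :=
  hC c 3 4 5 + hC c 4 5 3 + hC c 5 3 4 + hC c 3 5 4 + hC c 5 4 3 + hC c 4 3 5 ==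
   (c 3 4 5).toNat + (c 3 5 4).toNat

def C2 (c : Fin 6 → Fin 6 → Fin 6 → Bool) : Bool :=
  !(pentC c 4 0 1 2 3) || (
    ((c 4 5 1).toNat + (c 0 5 2).toNat + (c 1 5 3).toNat + (c 2 5 4).toNat + (c 3 5 0).toNat == 1) &&
    ((c 0 1 5).toNat == (c 1 5 3).toNat + (c 3 5 0).toNat))

def qC (c : Fin 6 → Fin 6 → Fin 6 → Bool) (a b : Fin 6) : Bool :=
  pentC c b 0 1 2 a || pentC c b 1 2 0 a || pentC c b 2 0 1 a

def tC (c : Fin 6 → Fin 6 → Fin 6 → Bool) (a b d : Fin 6) : Bool :=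
  c a 1 2 && c 0 b 2 && c 0 1 d

def C3 (c : Fin 6 → Fin 6 → Fin 6 → Bool) : Bool :=
  (qC c 3 4 || qC c 4 3 || qC c 3 5 || qC c 5 3 || qC c 4 5 || qC c 5 4) ||
  ((tC c 3 4 5 || tC c 4 5 3 || tC c 5 3 4) == c 3 4 5)


theorem pre0 {ι : Type*} [DecidableEq ι] {s : ι → ι → Bool} (h : LT s) (i j l x y z : ι)
    (hc : cy s i j l = true) :
    C0 (fun p q r => cy s (![i, j, l, x, y, z] p) (![i, j, l, x, y, z] q)
      (![i, j, l, x, y, z] r)) = true :=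
  six_principle (fun c => C0 c = true) (by decide +kernel) h i j l x y z hc

theorem pre1 {ι : Type*} [DecidableEq ι] {s : ι → ι → Bool} (h : LT s) (i j l x y z : ι)
    (hc : cy s i j l = true) :
    C1 (fun p q r => cy s (![i, j, l, x, y, z] p) (![i, j, l, x, y, z] q)
      (![i, j, l, x, y, z] r)) = true :=
  six_principle (fun c => C1 c = true) (by decide +kernel) h i j l x y z hc

theorem pre2 {ι : Type*} [DecidableEq ι] {s : ι → ι → Bool} (h : LT s) (i j l x y z : ι)
    (hc : cy s i j l = true) :
    C2 (fun p q r => cy s (![i, j, l, x, y, z] p) (![i, j, l, x, y, z] q)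
      (![i, j, l, x, y, z] r)) = true :=
  six_principle (fun c => C2 c = true) (by decide +kernel) h i j l x y z hc

theorem pre3 {ι : Type*} [DecidableEq ι] {s : ι → ι → Bool} (h : LT s) (i j l x y z : ι)
    (hc : cy s i j l = true) :
    C3 (fun p q r => cy s (![i, j, l, x, y, z] p) (![i, j, l, x, y, z] q)
      (![i, j, l, x, y, z] r)) = true :=
  six_principle (fun c => C3 c = true) (by decide +kernel) h i j l x y z hc

/-- each point replaces exactly one member of a cycle -/
theorem repl {ι : Type*} [DecidableEq ι] {s : ι → ι → Bool} (h : LT s) {i j l : ι} (x : ι)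
    (hc : cy s i j l = true) :
    (cy s x j l).toNat + (cy s i x l).toNat + (cy s i j x).toNat = 1 := by
  have := pre0 h i j l x x x hc
  simp only [C0, Bool.and_eq_true, beq_iff_eq] at this
  exact this.1

theorem trans_pent {ι : Type*} [DecidableEq ι] {s : ι → ι → Bool} (h : LT s) {i j l : ι} (x y z : ι)
    (hc : cy s i j l = true) (hx : cy s x j l = true) (hy : cy s i y l = true)
    (hz : cy s i j z = true) :
    cy s x z y = false ∧ (cy s x y z).toNat + (pent s z i j l x).toNat + (pent s x j l i y).toNat +
      (pent s y l i j z).toNat = 1 := by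
  have := pre0 h i j l x y z hc
  simp only [C0, Bool.and_eq_true, beq_iff_eq] at this
  have h2 := this.2
  change ((!(cy s x j l && cy s i y l && cy s i j z) ||
    (!(cy s x z y) && ((cy s x y z).toNat + (pent s z i j l x).toNat + (pent s x j l i y).toNat +
      (pent s y l i j z).toNat == 1))) = true) at h2
  rw [hx, hy, hz] at h2
  simpa using h2

def gP {ι : Type*} (s : ι → ι → Bool) (i j l u v x : ι) : ℕ :=
  (pent s v i j l u).toNat * ((cy s j x u).toNat + (cy s v x j).toNat)

def hP {ι : Type*} (s : ι → ι → Bool) (i j l a b d : ι) : ℕ :=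
  (cy s a j l && cy s i b l && cy s i j d && cy s a b d).toNat + gP s i j l a b d +
    gP s j l i a b d + gP s l i j a b d

theorem count3 {ι : Type*} [DecidableEq ι] {s : ι → ι → Bool} (h : LT s) {i j l : ι} (x y z : ι)
    (hc : cy s i j l = true) :
    hP s i j l x y z + hP s i j l y z x + hP s i j l z x y + hP s i j l x z y + hP s i j l z y x
      + hP s i j l y x z = (cy s x y z).toNat + (cy s x z y).toNat := by
  have := pre1 h i j l x y z hc
  simp only [C1, beq_iff_eq] at this
  exact this

theorem pent_repl {ι : Type*} [DecidableEq ι] {s : ι → ι → Bool} (h : LT s) {v i j l u : ι} (x : ι)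
    (hp : pent s v i j l u = true) :
    (cy s v x j).toNat + (cy s i x l).toNat + (cy s j x u).toNat + (cy s l x v).toNat +
      (cy s u x i).toNat = 1 ∧ (cy s i j x).toNat = (cy s j x u).toNat + (cy s u x i).toNat := by
  have hc : cy s i j l = true := by
    simp only [pent, Bool.and_eq_true] at hp; exact hp.1.1.1.2
  have := pre2 h i j l u v x hc
  change ((!(pent s v i j l u) || (
    ((cy s v x j).toNat + (cy s i x l).toNat + (cy s j x u).toNat + (cy s l x v).toNat +
      (cy s u x i).toNat == 1) &&
    ((cy s i j x).toNat == (cy s j x u).toNat + (cy s u x i).toNat))) = true) at this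
  rw [hp] at this
  simpa using this

theorem no_pent {ι : Type*} [DecidableEq ι] {s : ι → ι → Bool} (h : LT s) {i j l : ι} (x y z : ι)
    (hc : cy s i j l = true)
    (hn : ∀ u v, pent s v i j l u = false ∧ pent s v j l i u = false ∧ pent s v l i j u = false) :
    cy s x y z = ((cy s x j l && cy s i y l && cy s i j z) || (cy s y j l && cy s i z l && cy s i j x)
      || (cy s z j l && cy s i x l && cy s i j y)) := by
  have := pre3 h i j l x y z hc
  have q : ∀ a b, (pent s b i j l a || pent s b j l i a || pent s b l i j a) = false := by
    intro a b
    obtain ⟨h1, h2, h3⟩ := hn a b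
    rw [h1, h2, h3]; rfl
  change (((pent s y i j l x || pent s y j l i x || pent s y l i j x) ||
    (pent s x i j l y || pent s x j l i y || pent s x l i j y) ||
    (pent s z i j l x || pent s z j l i x || pent s z l i j x) ||
    (pent s x i j l z || pent s x j l i z || pent s x l i j z) ||
    (pent s z i j l y || pent s z j l i y || pent s z l i j y) ||
    (pent s y i j l z || pent s y j l i z || pent s y l i j z)) ||
    (((cy s x j l && cy s i y l && cy s i j z) || (cy s y j l && cy s i z l && cy s i j x)
      || (cy s z j l && cy s i x l && cy s i j y)) == cy s x y z)) = true at this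
  rw [q, q, q, q, q, q] at this
  simp only [Bool.or_self, Bool.false_or, beq_iff_eq] at this
  exact this.symm

/-- four point cocycle condition -/
theorem cocycle {ι : Type*} [DecidableEq ι] {s : ι → ι → Bool} (h : LT s) (x i j l : ι) :
    (cy s i j l).toInt - (cy s l j i).toInt =
     ((cy s x i j).toInt - (cy s j i x).toInt) + ((cy s x j l).toInt - (cy s l j x).toInt)
      + ((cy s x l i).toInt - (cy s i l x).toInt) := by
  set f := ![x, i, j, l] with hf
  have ht := pb_LT h f
  have e : ∀ p q r, cy s (f p) (f q) (f r) = cy (pb s f) p q r := fun p q r => (pb_cy h f p q r).symm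
  have key : (cy (pb s f) 1 2 3).toInt - (cy (pb s f) 3 2 1).toInt =
     ((cy (pb s f) 0 1 2).toInt - (cy (pb s f) 2 1 0).toInt) +
     ((cy (pb s f) 0 2 3).toInt - (cy (pb s f) 3 2 0).toInt)
      + ((cy (pb s f) 0 3 1).toInt - (cy (pb s f) 1 3 0).toInt) := by
    have l4 := ht.lt4 0 1 2 3 (by decide) (by decide) (by decide) (by decide) (by decide) (by decide)
    simp only [cy]
    rw [ht.asy 0 1 (by decide), ht.asy 0 2 (by decide), ht.asy 0 3 (by decide),
      ht.asy 1 2 (by decide), ht.asy 1 3 (by decide), ht.asy 2 3 (by decide)]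
    revert l4
    generalize pb s f 0 1 = x1
    generalize pb s f 0 2 = x2
    generalize pb s f 0 3 = x3
    generalize pb s f 1 2 = x4
    generalize pb s f 1 3 = x5
    generalize pb s f 2 3 = x6
    revert x1 x2 x3 x4 x5 x6
    decide +kernel
  simp only [← e] at key
  exact key

end MV

open MeasureTheory Real
namespace MV

def cr {ι : Type*} (s : ι → ι → Bool) (i j l : ι) : ℝ := ((cy s i j l).toNat : ℝ)
def pr {ι : Type*} (s : ι → ι → Bool) (v i j l u : ι) : ℝ := ((pent s v i j l u).toNat : ℝ)
def ps {ι : Type*} (s : ι → ι → Bool) (i j l : ι) : ℝ := cr s i j l - cr s l j i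

theorem cr_rot {ι : Type*} (s : ι → ι → Bool) (i j l : ι) : cr s i j l = cr s j l i := by
  unfold cr; rw [cy_rot]
theorem pr_rot {ι : Type*} (s : ι → ι → Bool) (v i j l u : ι) : pr s v i j l u = pr s i j l u v := by
  unfold pr; rw [pent_rot]

theorem cr_01 {ι : Type*} (s : ι → ι → Bool) (i j l : ι) : cr s i j l = 0 ∨ cr s i j l = 1 := by
  unfold cr; cases cy s i j l <;> simp

theorem cr_one {ι : Type*} {s : ι → ι → Bool} {i j l : ι} : cr s i j l = 1 ↔ cy s i j l = true := by
  unfold cr; cases cy s i j l <;> simp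
theorem cr_zero {ι : Type*} {s : ι → ι → Bool} {i j l : ι} : cr s i j l = 0 ↔ cy s i j l = false := by
  unfold cr; cases cy s i j l <;> simp

theorem cr_repl {ι : Type*} [DecidableEq ι] {s : ι → ι → Bool} (h : LT s) {i j l : ι} (x : ι)
    (hc : cr s i j l = 1) : cr s x j l + cr s i x l + cr s i j x = 1 := by
  have := repl h x (cr_one.1 hc)
  unfold cr; exact_mod_cast this

theorem ps_rot {ι : Type*} (s : ι → ι → Bool) (i j l : ι) : ps s i j l = ps s j l i := by
  unfold ps; rw [cr_rot s i j l, cr_rot s l j i, cr_rot s j i l]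

theorem ps_swap {ι : Type*} (s : ι → ι → Bool) (i j l : ι) : ps s l j i = - ps s i j l := by
  unfold ps; ring

theorem ps_swap' {ι : Type*} (s : ι → ι → Bool) (i j l : ι) : ps s i l j = - ps s i j l := by
  rw [← ps_swap, ps_rot s i l j]

theorem ps_cocycle {ι : Type*} [DecidableEq ι] {s : ι → ι → Bool} (h : LT s) (x i j l : ι) :
    ps s i j l = ps s x i j + ps s x j l + ps s x l i := by
  have := cocycle h x i j l
  have e : ∀ b : Bool, ((b.toInt : ℤ) : ℝ) = (b.toNat : ℝ) := by intro b; cases b <;> simp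
  have := congrArg (fun z : ℤ => (z : ℝ)) this
  simp only [Int.cast_add, Int.cast_sub, e] at this
  simpa only [ps, cr] using this

/-- transversal count of cycles -/
noncomputable def tq {ι : Type*} [Fintype ι] (s : ι → ι → Bool) (i j l : ι) : ℝ :=
  ∑ x, ∑ y, ∑ z, cr s x j l * cr s i y l * cr s i j z * cr s x y z

noncomputable def Nr {ι : Type*} [Fintype ι] (s : ι → ι → Bool) (j l : ι) : ℝ := ∑ x, cr s x j l

theorem sum_rot3 {ι : Type*} [Fintype ι] (F : ι → ι → ι → ℝ) :
    ∑ i, ∑ j, ∑ l, F i j l = ∑ i, ∑ j, ∑ l, F l i j := by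
  conv_rhs => rw [Finset.sum_congr rfl (fun i _ => Finset.sum_comm)]
  exact Finset.sum_comm

theorem sum_rev3 {ι : Type*} [Fintype ι] (F : ι → ι → ι → ℝ) :
    ∑ i, ∑ j, ∑ l, F i j l = ∑ i, ∑ j, ∑ l, F l j i := by
  rw [sum_rot3, Finset.sum_comm]

theorem sum_rot5 {ι : Type*} [Fintype ι] (F : ι → ι → ι → ι → ι → ℝ) :
    ∑ v, ∑ i, ∑ j, ∑ l, ∑ u, F v i j l u = ∑ v, ∑ i, ∑ j, ∑ l, ∑ u, F u v i j l := by
  rw [Finset.sum_comm]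
  refine Finset.sum_congr rfl fun a _ => ?_
  rw [Finset.sum_comm]
  refine Finset.sum_congr rfl fun a _ => ?_
  rw [Finset.sum_comm]
  refine Finset.sum_congr rfl fun a _ => ?_
  rw [Finset.sum_comm]

theorem sum_mul3 {ι : Type*} [Fintype ι] (f g h : ι → ℝ) :
    ∑ x, ∑ y, ∑ z, f x * g y * h z = (∑ x, f x) * (∑ y, g y) * (∑ z, h z) := by
  simp only [Finset.sum_mul, Finset.mul_sum]
  exact sum_rev3 _

noncomputable def W1 {ι : Type*} [Fintype ι] (s : ι → ι → Bool) : ℝ :=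
  ∑ v, ∑ i, ∑ j, ∑ l, ∑ u, ∑ x, pr s v i j l u * cr s i x l

/-- pentagon members -/
theorem pent_mem {ι : Type*} {s : ι → ι → Bool} {v i j l u : ι} (hp : pent s v i j l u = true) :
    cy s v i j = true ∧ cy s i j l = true ∧ cy s j l u = true ∧ cy s l u v = true ∧
      cy s u v i = true := by
  simp only [pent, Bool.and_eq_true] at hp; tauto

theorem W1_rot {ι : Type*} [Fintype ι] (s : ι → ι → Bool) :
    ∑ v, ∑ i, ∑ j, ∑ l, ∑ u, ∑ x, pr s v i j l u * cr s j x u = W1 s ∧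
    ∑ v, ∑ i, ∑ j, ∑ l, ∑ u, ∑ x, pr s v i j l u * cr s v x j = W1 s := by
  unfold W1
  constructor
  · rw [sum_rot5]
    refine Finset.sum_congr rfl fun v _ => Finset.sum_congr rfl fun i _ => Finset.sum_congr rfl fun j _ =>
      Finset.sum_congr rfl fun l _ => Finset.sum_congr rfl fun u _ => Finset.sum_congr rfl fun x _ => ?_
    rw [pr_rot s u v i j l]
  · rw [eq_comm, sum_rot5]
    refine Finset.sum_congr rfl fun v _ => Finset.sum_congr rfl fun i _ => Finset.sum_congr rfl fun j _ =>
      Finset.sum_congr rfl fun l _ => Finset.sum_congr rfl fun u _ => Finset.sum_congr rfl fun x _ => ?_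
    rw [pr_rot s u v i j l]

/-- first identity for a single triple -/
theorem id_one {ι : Type*} [Fintype ι] [DecidableEq ι] {s : ι → ι → Bool} (h : LT s) (i j l : ι) :
    cr s i j l * (Nr s j l * Nr s l i * Nr s i j) = cr s i j l * tq s i j l +
      ((∑ u, ∑ v, ∑ x, pr s v i j l u * cr s i x l) + (∑ u, ∑ v, ∑ x, pr s v j l i u * cr s j x i) +
       (∑ u, ∑ v, ∑ x, pr s v l i j u * cr s l x j)) := by
  rcases cr_01 s i j l with h0 | h1
  · have hcf := cr_zero.1 h0
    have z : ∀ u v, pr s v i j l u = 0 ∧ pr s v j l i u = 0 ∧ pr s v l i j u = 0 := by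
      intro u v
      refine ⟨?_, ?_, ?_⟩
      · simp [pr, pent, hcf]
      · have : cy s j l i = false := by rw [← cy_rot]; exact hcf
        simp [pr, pent, this]
      · have : cy s l i j = false := by rw [cy_rot]; exact hcf
        simp [pr, pent, this]
    simp [h0, fun u v => (z u v).1, fun u v => (z u v).2.1, fun u v => (z u v).2.2]
  · rw [h1, one_mul, one_mul]
    have e1 : Nr s l i = ∑ y, cr s i y l := by
      unfold Nr; refine Finset.sum_congr rfl fun y _ => ?_
      rw [cr_rot s y l i, cr_rot s l i y]
    have e2 : Nr s i j = ∑ y, cr s i j y := by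
      unfold Nr; refine Finset.sum_congr rfl fun y _ => cr_rot _ _ _ _
    have e0 : Nr s j l = ∑ x, cr s x j l := rfl
    rw [e0, e1, e2, ← sum_mul3]
    have r1 : ∑ u, ∑ v, ∑ x, pr s v i j l u * cr s i x l = ∑ x, ∑ y, ∑ z, pr s z i j l x * cr s i y l := by
      refine Finset.sum_congr rfl fun u _ => ?_
      rw [Finset.sum_comm]
    have r2 : ∑ u, ∑ v, ∑ x, pr s v j l i u * cr s j x i = ∑ x, ∑ y, ∑ z, pr s x j l i y * cr s i j z := by
      rw [Finset.sum_comm]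
      refine Finset.sum_congr rfl fun u _ => Finset.sum_congr rfl fun v _ =>
        Finset.sum_congr rfl fun x _ => ?_
      rw [cr_rot s i j x]
    have r3 : ∑ u, ∑ v, ∑ x, pr s v l i j u * cr s l x j = ∑ x, ∑ y, ∑ z, pr s y l i j z * cr s x j l := by
      rw [sum_rev3]
      refine Finset.sum_congr rfl fun u _ => Finset.sum_congr rfl fun v _ =>
        Finset.sum_congr rfl fun x _ => ?_
      rw [cr_rot s l u j]
    rw [r1, r2, r3]
    unfold tq
    simp only [← Finset.sum_add_distrib]
    refine Finset.sum_congr rfl fun x _ => Finset.sum_congr rfl fun y _ =>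
        Finset.sum_congr rfl fun z _ => ?_
    have hc := cr_one.1 h1
    by_cases hx : cy s x j l = true
    · by_cases hy : cy s i y l = true
      · by_cases hz : cy s i j z = true
        · have := (trans_pent h x y z hc hx hy hz).2
          rw [cr_one.2 hx, cr_one.2 hy, cr_one.2 hz]
          simp only [mul_one, one_mul]
          unfold cr pr
          exact_mod_cast (by omega)
        · have p1 : pr s z i j l x = 0 := by
            have : cy s z i j = false := by rw [cy_rot]; simpa using hz
            simp [pr, pent, this]
          have p3 : pr s y l i j z = 0 := by
            have : cy s i j z = false := by simpa using hz
            simp [pr, pent, this]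
          rw [p1, p3, cr_zero.2 (show cy s i j z = false by simpa using hz)]; ring
      · have p1 : pr s x j l i y = 0 := by
            have : cy s l i y = false := by rw [cy_rot]; simpa using hy
            simp [pr, pent, this]
        have p3 : pr s y l i j z = 0 := by
            have : cy s y l i = false := by rw [← cy_rot]; simpa using hy
            simp [pr, pent, this]
        rw [p1, p3, cr_zero.2 (show cy s i y l = false by simpa using hy)]; ring
    · have p1 : pr s z i j l x = 0 := by
            have : cy s j l x = false := by rw [← cy_rot]; simpa using hx
            simp [pr, pent, this]
      have p3 : pr s x j l i y = 0 := by
            have : cy s x j l = false := by simpa using hx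
            simp [pr, pent, this]
      rw [p1, p3, cr_zero.2 (show cy s x j l = false by simpa using hx)]; ring

noncomputable def Tq {ι : Type*} [Fintype ι] (s : ι → ι → Bool) : ℝ := ∑ i, ∑ j, ∑ l, cr s i j l
noncomputable def Qq {ι : Type*} [Fintype ι] (s : ι → ι → Bool) : ℝ :=
  ∑ i, ∑ j, ∑ l, cr s i j l * tq s i j l
noncomputable def Sq {ι : Type*} [Fintype ι] (s : ι → ι → Bool) : ℝ :=
  ∑ i, ∑ j, ∑ l, cr s i j l * (Nr s j l * Nr s l i * Nr s i j)

theorem W1_alt {ι : Type*} [Fintype ι] (F : ι → ι → ι → ι → ι → ι → ℝ) :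
    ∑ i, ∑ j, ∑ l, ∑ u, ∑ v, ∑ x, F v i j l u x = ∑ v, ∑ i, ∑ j, ∑ l, ∑ u, ∑ x, F v i j l u x := by
  conv_rhs => rw [Finset.sum_comm]
  refine Finset.sum_congr rfl fun i _ => ?_
  conv_rhs => rw [Finset.sum_comm]
  refine Finset.sum_congr rfl fun i _ => ?_
  conv_rhs => rw [Finset.sum_comm]
  refine Finset.sum_congr rfl fun i _ => ?_
  conv_rhs => rw [Finset.sum_comm]

theorem id_S {ι : Type*} [Fintype ι] [DecidableEq ι] {s : ι → ι → Bool} (h : LT s) :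
    Sq s = Qq s + 3 * W1 s := by
  unfold Sq Qq
  rw [Finset.sum_congr rfl fun i _ => Finset.sum_congr rfl fun j _ => Finset.sum_congr rfl fun l _ =>
    id_one h i j l]
  simp only [Finset.sum_add_distrib]
  have a1 : ∑ i, ∑ j, ∑ l, ∑ u, ∑ v, ∑ x, pr s v i j l u * cr s i x l = W1 s := W1_alt _
  have a2 : ∑ i, ∑ j, ∑ l, ∑ u, ∑ v, ∑ x, pr s v j l i u * cr s j x i = W1 s := by
    rw [← a1]; conv_rhs => rw [sum_rot3, sum_rot3]
  have a3 : ∑ i, ∑ j, ∑ l, ∑ u, ∑ v, ∑ x, pr s v l i j u * cr s l x j = W1 s := by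
    rw [← a1]; conv_rhs => rw [sum_rot3]
  rw [a1, a2, a3]; ring

theorem id_two {ι : Type*} [Fintype ι] [DecidableEq ι] {s : ι → ι → Bool} (h : LT s) (i j l : ι) :
    cr s i j l * Tq s = 3 * (cr s i j l * tq s i j l +
      ((∑ u, ∑ v, ∑ x, pr s v i j l u * (cr s j x u + cr s v x j)) +
       (∑ u, ∑ v, ∑ x, pr s v j l i u * (cr s l x u + cr s v x l)) +
       (∑ u, ∑ v, ∑ x, pr s v l i j u * (cr s i x u + cr s v x i)))) := by
  rcases cr_01 s i j l with h0 | h1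
  · have hcf := cr_zero.1 h0
    have z : ∀ u v, pr s v i j l u = 0 ∧ pr s v j l i u = 0 ∧ pr s v l i j u = 0 := by
      intro u v
      refine ⟨?_, ?_, ?_⟩
      · simp [pr, pent, hcf]
      · have : cy s j l i = false := by rw [← cy_rot]; exact hcf
        simp [pr, pent, this]
      · have : cy s l i j = false := by rw [cy_rot]; exact hcf
        simp [pr, pent, this]
    simp [h0, fun u v => (z u v).1, fun u v => (z u v).2.1, fun u v => (z u v).2.2]
  · have hc := cr_one.1 h1
    rw [h1, one_mul, one_mul]
    have e : tq s i j l +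
      ((∑ u, ∑ v, ∑ x, pr s v i j l u * (cr s j x u + cr s v x j)) +
       (∑ u, ∑ v, ∑ x, pr s v j l i u * (cr s l x u + cr s v x l)) +
       (∑ u, ∑ v, ∑ x, pr s v l i j u * (cr s i x u + cr s v x i))) =
       ∑ x, ∑ y, ∑ z, (hP s i j l x y z : ℝ) := by
      unfold tq
      simp only [← Finset.sum_add_distrib]
      refine Finset.sum_congr rfl fun x _ => Finset.sum_congr rfl fun y _ =>
        Finset.sum_congr rfl fun z _ => ?_
      unfold hP gP cr pr
      push_cast
      have : ((cy s x j l && cy s i y l && cy s i j z && cy s x y z).toNat : ℝ) =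
        (cy s x j l).toNat * (cy s i y l).toNat * (cy s i j z).toNat * (cy s x y z).toNat := by
        cases cy s x j l <;> cases cy s i y l <;> cases cy s i j z <;> cases cy s x y z <;> simp
      rw [this]; ring
    rw [e]
    set F : ι → ι → ι → ℝ := fun x y z => (hP s i j l x y z : ℝ) with hF
    have f1 : ∑ x, ∑ y, ∑ z, F x y z = ∑ x, ∑ y, ∑ z, F z x y := sum_rot3 F
    have f2 : ∑ x, ∑ y, ∑ z, F x y z = ∑ x, ∑ y, ∑ z, F y z x := by
      rw [f1]; exact sum_rot3 fun x y z => F z x y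
    have f3 : ∑ x, ∑ y, ∑ z, F x y z = ∑ x, ∑ y, ∑ z, F z y x := sum_rev3 F
    have f4 : ∑ x, ∑ y, ∑ z, F x y z = ∑ x, ∑ y, ∑ z, F y x z := Finset.sum_comm
    have f5 : ∑ x, ∑ y, ∑ z, F x y z = ∑ x, ∑ y, ∑ z, F x z y :=
      Finset.sum_congr rfl fun x _ => Finset.sum_comm
    have f6 : ∑ x, ∑ y, ∑ z, (F x y z + F y z x + F z x y + F x z y + F z y x + F y x z) =
       ∑ x, ∑ y, ∑ z, (cr s x y z + cr s x z y) := by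
      refine Finset.sum_congr rfl fun x _ => Finset.sum_congr rfl fun y _ =>
        Finset.sum_congr rfl fun z _ => ?_
      have := count3 h x y z hc
      simp only [hF, cr]
      exact_mod_cast this
    simp only [Finset.sum_add_distrib] at f6
    have f7 : ∑ x, ∑ y, ∑ z, cr s x z y = Tq s := by
      unfold Tq
      exact Finset.sum_congr rfl fun x _ => Finset.sum_comm
    have f8 : ∑ x, ∑ y, ∑ z, cr s x y z = Tq s := rfl
    rw [f7, f8] at f6
    change Tq s = 3 * ∑ x, ∑ y, ∑ z, F x y z
    linarith

theorem id_T {ι : Type*} [Fintype ι] [DecidableEq ι] {s : ι → ι → Bool} (h : LT s) :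
    Tq s * Tq s = 3 * (Qq s + 6 * W1 s) := by
  have : Tq s * Tq s = ∑ i, ∑ j, ∑ l, cr s i j l * Tq s := by
    generalize hT : Tq s = T
    rw [show T * T = (∑ i, ∑ j, ∑ l, cr s i j l) * T from by rw [← hT]; rfl]
    simp only [Finset.sum_mul]
  rw [this]
  rw [Finset.sum_congr rfl fun i _ => Finset.sum_congr rfl fun j _ => Finset.sum_congr rfl fun l _ =>
    id_two h i j l]
  have key : ∀ F G H K : ι → ι → ι → ℝ, ∑ i, ∑ j, ∑ l, 3 * (F i j l + (G i j l + H i j l + K i j l)) =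
      3 * ((∑ i, ∑ j, ∑ l, F i j l) + ((∑ i, ∑ j, ∑ l, G i j l) + (∑ i, ∑ j, ∑ l, H i j l) +
        (∑ i, ∑ j, ∑ l, K i j l))) := by
    intro F G H K
    simp only [← Finset.mul_sum, Finset.sum_add_distrib]
  rw [key]
  have a1 : ∑ i, ∑ j, ∑ l, ∑ u, ∑ v, ∑ x, pr s v i j l u * (cr s j x u + cr s v x j) = 2 * W1 s := by
    rw [W1_alt fun v i j l u x => pr s v i j l u * (cr s j x u + cr s v x j)]
    simp only [mul_add, Finset.sum_add_distrib]
    rw [(W1_rot s).1, (W1_rot s).2]; ring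
  have a2 : ∑ i, ∑ j, ∑ l, ∑ u, ∑ v, ∑ x, pr s v j l i u * (cr s l x u + cr s v x l) = 2 * W1 s := by
    rw [← a1]; conv_rhs => rw [sum_rot3, sum_rot3]
  have a3 : ∑ i, ∑ j, ∑ l, ∑ u, ∑ v, ∑ x, pr s v l i j u * (cr s i x u + cr s v x i) = 2 * W1 s := by
    rw [← a1]; conv_rhs => rw [sum_rot3]
  rw [a1, a2, a3]
  unfold Qq
  ring

/-- main counting identity -/
theorem id_Q {ι : Type*} [Fintype ι] [DecidableEq ι] {s : ι → ι → Bool} (h : LT s) :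
    Qq s = 2 * Sq s - Tq s ^ 2 / 3 := by
  have := id_S h
  have := id_T h
  nlinarith

end MV

open MeasureTheory Real
namespace MV

noncomputable def KK {ι : Type*} [Fintype ι] (s : ι → ι → Bool) : ι → ι → ℝ := fun j l => ∑ x, ps s x j l

theorem KK_anti {ι : Type*} [Fintype ι] (s : ι → ι → Bool) (j l : ι) : KK s l j = - KK s j l := by
  unfold KK; rw [← Finset.sum_neg_distrib]
  exact Finset.sum_congr rfl fun x _ => ps_swap' _ _ _ _

theorem KK_row {ι : Type*} [Fintype ι] (s : ι → ι → Bool) (j : ι) : ∑ l, KK s j l = 0 := by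
  have h : ∑ l, KK s j l = - ∑ l, KK s j l := by
    unfold KK
    conv_rhs => rw [Finset.sum_comm]
    rw [← Finset.sum_neg_distrib]
    refine Finset.sum_congr rfl fun x _ => ?_
    rw [← Finset.sum_neg_distrib]
    exact Finset.sum_congr rfl fun y _ => by rw [ps_swap]
  linarith

theorem KK_col {ι : Type*} [Fintype ι] (s : ι → ι → Bool) (j : ι) : ∑ l, KK s l j = 0 := by
  rw [Finset.sum_congr rfl fun l _ => KK_anti s j l, Finset.sum_neg_distrib, KK_row, neg_zero]

theorem KK_ps {ι : Type*} [Fintype ι] [DecidableEq ι] {s : ι → ι → Bool} (h : LT s) (i j l : ι) :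
    (Fintype.card ι : ℝ) * ps s i j l = KK s i j + KK s j l + KK s l i := by
  unfold KK
  rw [← Finset.sum_add_distrib, ← Finset.sum_add_distrib,
    ← Finset.sum_congr rfl fun x _ => ps_cocycle h x i j l]
  simp

/-- bilinear form -/
noncomputable def bl {ι : Type*} [Fintype ι] (s : ι → ι → Bool) (f g : ι → ℝ) : ℝ :=
  ∑ u, ∑ v, f u * KK s u v * g v

theorem bl_anti {ι : Type*} [Fintype ι] (s : ι → ι → Bool) (f g : ι → ℝ) : bl s f g = - bl s g f := by
  unfold bl
  rw [Finset.sum_comm, ← Finset.sum_neg_distrib]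
  refine Finset.sum_congr rfl fun u _ => ?_
  rw [← Finset.sum_neg_distrib]
  refine Finset.sum_congr rfl fun v _ => ?_
  rw [KK_anti]; ring

theorem bl_add {ι : Type*} [Fintype ι] (s : ι → ι → Bool) (f f' g : ι → ℝ) :
   bl s (fun u => f u + f' u) g = bl s f g + bl s f' g := by
  unfold bl
  simp only [add_mul, Finset.sum_add_distrib]
theorem bl_sub {ι : Type*} [Fintype ι] (s : ι → ι → Bool) (f f' g : ι → ℝ) :
   bl s (fun u => f u - f' u) g = bl s f g - bl s f' g := by
  unfold bl
  simp only [sub_mul, Finset.sum_sub_distrib]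
theorem bl_const {ι : Type*} [Fintype ι] (s : ι → ι → Bool) (c : ℝ) (g : ι → ℝ) :
   bl s (fun _ => c) g = 0 := by
  unfold bl
  rw [Finset.sum_comm]
  refine Finset.sum_eq_zero fun v _ => ?_
  rw [← Finset.sum_mul, ← Finset.mul_sum, KK_col]; simp
theorem bl_add_r {ι : Type*} [Fintype ι] (s : ι → ι → Bool) (f f' g : ι → ℝ) :
   bl s g (fun u => f u + f' u) = bl s g f + bl s g f' := by
  rw [bl_anti, bl_add, bl_anti s f, bl_anti s f']; ring
theorem bl_sub_r {ι : Type*} [Fintype ι] (s : ι → ι → Bool) (f f' g : ι → ℝ) :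
   bl s g (fun u => f u - f' u) = bl s g f - bl s g f' := by
  rw [bl_anti, bl_sub, bl_anti s f, bl_anti s f']; ring
theorem bl_const_r {ι : Type*} [Fintype ι] (s : ι → ι → Bool) (c : ℝ) (g : ι → ℝ) :
   bl s g (fun _ => c) = 0 := by
  rw [bl_anti, bl_const, neg_zero]

theorem bl_cyc {ι : Type*} [Fintype ι] [DecidableEq ι] {s : ι → ι → Bool} (h : LT s) (i j l : ι) :
    bl s (KK s i) (KK s j) + bl s (KK s j) (KK s l) + bl s (KK s l) (KK s i) =
      - (Fintype.card ι : ℝ)^2 * bl s (fun u => ps s i j u) (fun v => ps s i v l) := by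
  have e : (Fintype.card ι : ℝ)^2 * bl s (fun u => ps s i j u) (fun v => ps s i v l) =
    bl s (fun u => KK s i j + KK s j u - KK s i u) (fun v => KK s i v - KK s l v + KK s l i) := by
    unfold bl
    simp only [Finset.mul_sum]
    refine Finset.sum_congr rfl fun u _ => Finset.sum_congr rfl fun v _ => ?_
    have h1 := KK_ps h i j u
    have h2 := KK_ps h i v l
    have h3 : KK s i j + KK s j u - KK s i u = (Fintype.card ι : ℝ) * ps s i j u := by
      rw [h1, KK_anti s i u]; ring
    have h4 : KK s i v - KK s l v + KK s l i = (Fintype.card ι : ℝ) * ps s i v l := by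
      rw [h2, KK_anti s l v]; ring
    rw [h3, h4]; ring
  rw [neg_mul, e, bl_sub, bl_add, bl_const, bl_add_r, bl_const_r, bl_sub_r, bl_add_r, bl_const_r, bl_sub_r]
  have h0 : bl s (KK s i) (KK s i) = 0 := by
    have := bl_anti s (KK s i) (KK s i); linarith
  rw [h0, bl_anti s (KK s j) (KK s i), bl_anti s (KK s i) (KK s l)]
  ring

theorem bl_tq {ι : Type*} [Fintype ι] [DecidableEq ι] {s : ι → ι → Bool} (h : LT s) {i j l : ι}
    (hc : cr s i j l = 1) :
    bl s (fun u => ps s i j u) (fun v => ps s i v l) = - tq s i j l := by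
  have hcy := cr_one.1 hc
  have hs : s i j = true ∧ s j l = true ∧ s l i = true := by
    simpa [cy, Bool.and_eq_true, and_assoc] using hcy
  have hij : i ≠ j := by rintro rfl; have := h.irr i; simp_all
  have hli : l ≠ i := by rintro rfl; have := h.irr l; simp_all
  have a1 : ∀ u, ps s i j u = cr s i j u := by
    intro u
    have : cr s u j i = 0 := by
      rw [cr_zero]; have := h.asy i j hij; simp [cy, this, hs.1]
    rw [ps, this, sub_zero]
  have a2 : ∀ v, ps s i v l = cr s i v l := by
    intro v
    have : cr s l v i = 0 := by
      rw [cr_zero]; have := h.asy l i hli; simp [cy, this, hs.2.2]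
    rw [ps, this, sub_zero]
  simp only [a1, a2]
  unfold bl KK
  have e1 : ∀ u v, cr s i j u * (∑ x, ps s x u v) * cr s i v l =
     (∑ x, cr s i j u * cr s i v l * cr s x j l * ps s x u v) +
     (∑ x, cr s i j u * cr s i v l * cr s i x l * ps s x u v) +
     (∑ x, cr s i j u * cr s i v l * cr s i j x * ps s x u v) := by
    intro u v
    rw [← Finset.sum_add_distrib, ← Finset.sum_add_distrib, Finset.mul_sum, Finset.sum_mul]
    refine Finset.sum_congr rfl fun x _ => ?_
    have := cr_repl h x hc
    linear_combination (- cr s i j u * cr s i v l * ps s x u v) * this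
  simp only [e1, Finset.sum_add_distrib]
  have z1 : ∑ u, ∑ v, ∑ x, cr s i j u * cr s i v l * cr s i x l * ps s x u v = 0 := by
    refine Finset.sum_eq_zero fun u _ => ?_
    have : ∑ v, ∑ x, cr s i j u * cr s i v l * cr s i x l * ps s x u v =
      - ∑ v, ∑ x, cr s i j u * cr s i v l * cr s i x l * ps s x u v := by
      conv_rhs => rw [Finset.sum_comm]
      rw [← Finset.sum_neg_distrib]
      refine Finset.sum_congr rfl fun v _ => ?_
      rw [← Finset.sum_neg_distrib]
      refine Finset.sum_congr rfl fun x _ => ?_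
      rw [ps_swap s v u x]; ring
    linarith
  have z2 : ∑ u, ∑ v, ∑ x, cr s i j u * cr s i v l * cr s i j x * ps s x u v = 0 := by
    rw [Finset.sum_comm]
    refine Finset.sum_eq_zero fun v _ => ?_
    have : ∑ u, ∑ x, cr s i j u * cr s i v l * cr s i j x * ps s x u v =
      - ∑ u, ∑ x, cr s i j u * cr s i v l * cr s i j x * ps s x u v := by
      conv_rhs => rw [Finset.sum_comm]
      rw [← Finset.sum_neg_distrib]
      refine Finset.sum_congr rfl fun u _ => ?_
      rw [← Finset.sum_neg_distrib]
      refine Finset.sum_congr rfl fun x _ => ?_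
      rw [← ps_rot s v u x, ps_swap s x u v]; ring
    linarith
  rw [z1, z2, add_zero, add_zero, sum_rev3]
  unfold tq
  rw [← Finset.sum_neg_distrib]
  refine Finset.sum_congr rfl fun x _ => ?_
  rw [← Finset.sum_neg_distrib]
  refine Finset.sum_congr rfl fun y _ => ?_
  rw [← Finset.sum_neg_distrib]
  refine Finset.sum_congr rfl fun z _ => ?_
  by_cases hx : cy s x j l = true
  · by_cases hy : cy s i y l = true
    · by_cases hz : cy s i j z = true
      · have := (trans_pent h x y z hcy hx hy hz).1
        have t2 : cr s y z x = cr s x y z := by rw [cr_rot s x y z]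
        have t3 : cr s y z x = cr s x y z := t2
        rw [ps, cr_zero.2 this, cr_rot s y z x, cr_rot s z x y]; ring
      · rw [cr_zero.2 (show cy s i j z = false by simpa using hz)]; ring
    · rw [cr_zero.2 (show cy s i y l = false by simpa using hy)]; ring
  · rw [cr_zero.2 (show cy s x j l = false by simpa using hx)]; ring

noncomputable def HH {ι : Type*} [Fintype ι] (s : ι → ι → Bool) : ι → ι → ℝ :=
  fun a b => ∑ u, KK s a u * KK s b u

theorem HH_norm {ι : Type*} [Fintype ι] [DecidableEq ι] {s : ι → ι → Bool} (h : LT s) :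
    ∑ a, ∑ b, HH s a b ^ 2 = 2 * (Fintype.card ι : ℝ)^2 / 3 * Qq s := by
  have e1 : ∑ a, ∑ b, HH s a b ^ 2 = ∑ a, ∑ b, KK s a b * bl s (KK s a) (KK s b) := by
    refine Finset.sum_congr rfl fun a _ => ?_
    unfold HH bl
    simp only [sq]
    simp only [Finset.sum_mul_sum]
    simp only [Finset.mul_sum]
    rw [sum_rev3]
    refine Finset.sum_congr rfl fun b _ => Finset.sum_congr rfl fun u _ =>
      Finset.sum_congr rfl fun v _ => ?_
    rw [KK_anti s u v, KK_anti s b v]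
    ring
  set β : ι → ι → ℝ := fun a b => bl s (KK s a) (KK s b) with hβ
  have βa : ∀ a b, β a b = - β b a := fun a b => bl_anti _ _ _
  have e2 : ∑ a, ∑ b, KK s a b * β a b = ∑ i, ∑ j, ∑ l, ps s i j l * β j l := by
    unfold KK
    simp only [Finset.sum_mul]
    exact (sum_rot3 (fun i j l => ps s i j l * β j l)).symm
  have e3 : ∑ i, ∑ j, ∑ l, ps s i j l * β j l = ∑ i, ∑ j, ∑ l, ps s i j l * β i j := by
    rw [sum_rot3]
    refine Finset.sum_congr rfl fun i _ => Finset.sum_congr rfl fun j _ =>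
      Finset.sum_congr rfl fun l _ => ?_
    rw [ps_rot s l i j]
  have e4 : ∑ i, ∑ j, ∑ l, ps s i j l * β i j = ∑ i, ∑ j, ∑ l, ps s i j l * β l i := by
    rw [sum_rot3]
    refine Finset.sum_congr rfl fun i _ => Finset.sum_congr rfl fun j _ =>
      Finset.sum_congr rfl fun l _ => ?_
    rw [ps_rot s l i j]
  have e5 : ∑ i, ∑ j, ∑ l, ps s i j l * (β i j + β j l + β l i) =
     3 * ∑ a, ∑ b, KK s a b * β a b := by
    simp only [mul_add, Finset.sum_add_distrib]
    rw [← e4, e2, e3]; ring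
  have e6 : ∑ i, ∑ j, ∑ l, ps s i j l * (β i j + β j l + β l i) =
     2 * ∑ i, ∑ j, ∑ l, cr s i j l * (β i j + β j l + β l i) := by
    have : ∑ i, ∑ j, ∑ l, cr s l j i * (β i j + β j l + β l i) =
       - ∑ i, ∑ j, ∑ l, cr s i j l * (β i j + β j l + β l i) := by
      rw [sum_rev3]
      rw [← Finset.sum_neg_distrib]
      refine Finset.sum_congr rfl fun x _ => ?_
      rw [← Finset.sum_neg_distrib]
      refine Finset.sum_congr rfl fun y _ => ?_
      rw [← Finset.sum_neg_distrib]
      refine Finset.sum_congr rfl fun z _ => ?_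
      rw [βa x y, βa y z, βa z x]; ring
    unfold ps
    simp only [sub_mul, Finset.sum_sub_distrib]
    rw [this]; ring
  have e7 : ∑ i, ∑ j, ∑ l, cr s i j l * (β i j + β j l + β l i) = (Fintype.card ι : ℝ)^2 * Qq s := by
    unfold Qq
    simp only [Finset.mul_sum]
    refine Finset.sum_congr rfl fun i _ => Finset.sum_congr rfl fun j _ =>
      Finset.sum_congr rfl fun l _ => ?_
    rcases cr_01 s i j l with h0 | h1
    · rw [h0]; ring
    · rw [hβ]; simp only; rw [bl_cyc h, bl_tq h h1, h1]; ring
  change _ = ∑ a, ∑ b, KK s a b * β a b at e1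
  rw [e1]
  linarith

theorem spectral {ι : Type*} [Fintype ι] [DecidableEq ι] {s : ι → ι → Bool} (h : LT s)
    (x y : ι → ℝ) (hx : ∑ i, x i * x i = 1) (hy : ∑ i, y i * y i = 1) (hxy : ∑ i, x i * y i = 0) :
    (∑ i, ∑ j, x i * KK s i j * y j) ^ 4 ≤ (Fintype.card ι : ℝ)^2 / 3 * Qq s := by
  set c := ∑ i, ∑ j, x i * KK s i j * y j with hcdef
  have q : ∀ z w : ι → ℝ, ∑ i, w i * w i = 1 → (∑ i, ∑ j, z i * KK s i j * w j) ^ 2 ≤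
      ∑ a, ∑ b, HH s a b * (z a * z b) := by
    intro z w hw
    have e : ∑ i, ∑ j, z i * KK s i j * w j = ∑ j, (∑ i, z i * KK s i j) * w j := by
      rw [Finset.sum_comm]; exact Finset.sum_congr rfl fun j _ => by rw [Finset.sum_mul]
    rw [e]
    refine (Finset.sum_mul_sq_le_sq_mul_sq _ _ _).trans ?_
    have : ∑ i, w i ^ 2 = 1 := by simpa [sq] using hw
    rw [this, mul_one]
    apply le_of_eq
    unfold HH
    simp only [sq]
    simp only [Finset.sum_mul_sum]
    simp only [Finset.sum_mul]
    rw [sum_rot3]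
    refine Finset.sum_congr rfl fun i _ => Finset.sum_congr rfl fun j _ =>
      Finset.sum_congr rfl fun l _ => ?_
    ring
  set α := ∑ a, ∑ b, HH s a b * (x a * x b) with hα
  set β := ∑ a, ∑ b, HH s a b * (y a * y b) with hβ
  have h1 : c ^ 2 ≤ α := q x y hy
  have h2 : c ^ 2 ≤ β := by
    have := q y x hx
    have e : ∑ i, ∑ j, y i * KK s i j * x j = - c := by
      have := bl_anti s y x
      exact this
    rw [e] at this
    simpa using this
  have pr : ∀ z w : ι → ℝ, ∑ a, ∑ b, (z a * z b) * (w a * w b) = (∑ a, z a * w a)^2 := by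
    intro z w
    rw [sq, Finset.sum_mul_sum]
    refine Finset.sum_congr rfl fun i _ => Finset.sum_congr rfl fun j _ => by ring
  have h3 : 0 ≤ ∑ a, ∑ b, (HH s a b - α * (x a * x b) - β * (y a * y b))^2 :=
    Finset.sum_nonneg fun a _ => Finset.sum_nonneg fun b _ => sq_nonneg _
  have h4 : ∑ a, ∑ b, (HH s a b - α * (x a * x b) - β * (y a * y b))^2 =
     ∑ a, ∑ b, HH s a b ^ 2 + α^2 * (∑ a, ∑ b, (x a * x b) * (x a * x b)) +
      β^2 * (∑ a, ∑ b, (y a * y b) * (y a * y b)) - 2 * α * (∑ a, ∑ b, HH s a b * (x a * x b))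
      - 2 * β * (∑ a, ∑ b, HH s a b * (y a * y b)) +
      2 * α * β * (∑ a, ∑ b, (x a * x b) * (y a * y b)) := by
    simp only [Finset.mul_sum, ← Finset.sum_add_distrib, ← Finset.sum_sub_distrib]
    refine Finset.sum_congr rfl fun i _ => Finset.sum_congr rfl fun j _ => by ring
  rw [h4, pr, pr, pr, hx, hy, hxy, HH_norm h, ← hα, ← hβ] at h3
  have h5 : c^4 ≤ α^2 := by nlinarith [sq_nonneg c]
  have h6 : c^4 ≤ β^2 := by nlinarith [sq_nonneg c]
  linarith

end MV

open MeasureTheory Real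
namespace MV

def Nn {ι : Type*} [Fintype ι] (s : ι → ι → Bool) (j l : ι) : ℕ := ∑ x, (cy s x j l).toNat

theorem Nr_eq {ι : Type*} [Fintype ι] (s : ι → ι → Bool) (j l : ι) : Nr s j l = (Nn s j l : ℝ) := by
  unfold Nr Nn cr; push_cast; rfl

theorem Nn_mid {ι : Type*} [Fintype ι] (s : ι → ι → Bool) (j l : ι) :
    ∑ x, (cy s l x j).toNat = Nn s j l := by
  unfold Nn; exact Finset.sum_congr rfl fun x _ => by rw [cy_rot s l x j]
theorem Nn_last {ι : Type*} [Fintype ι] (s : ι → ι → Bool) (j l : ι) :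
    ∑ x, (cy s j l x).toNat = Nn s j l := by
  unfold Nn; exact Finset.sum_congr rfl fun x _ => by rw [cy_rot s x j l]

theorem Nn_pos {ι : Type*} [Fintype ι] {s : ι → ι → Bool} {i j l : ι} (h : cy s i j l = true) :
    1 ≤ Nn s j l := by
  unfold Nn
  have := Finset.single_le_sum (f := fun x => (cy s x j l).toNat) (fun x _ => Nat.zero_le _) (Finset.mem_univ i)
  simpa [h] using this

theorem parts_sum {ι : Type*} [Fintype ι] [DecidableEq ι] {s : ι → ι → Bool} (hs : LT s) {i j l : ι}
    (h : cy s i j l = true) : Nn s j l + Nn s l i + Nn s i j = Fintype.card ι := by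
  rw [← Nn_mid s l i, ← Nn_last s i j, Nn, ← Finset.sum_add_distrib, ← Finset.sum_add_distrib,
    Finset.sum_congr rfl fun x _ => repl hs x h]
  simp

theorem pent_counts {ι : Type*} [Fintype ι] [DecidableEq ι] {s : ι → ι → Bool} (hs : LT s) {v i j l u : ι}
    (h : pent s v i j l u = true) :
    Nn s j v + Nn s l i + Nn s u j + Nn s v l + Nn s i u = Fintype.card ι ∧
    Nn s i j = Nn s u j + Nn s i u := by
  constructor
  · rw [← Nn_mid s j v, ← Nn_mid s l i, ← Nn_mid s u j, ← Nn_mid s v l, ← Nn_mid s i u]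
    simp only [← Finset.sum_add_distrib]
    rw [Finset.sum_congr rfl fun x _ => (pent_repl hs x h).1]
    simp
  · rw [← Nn_last s i j, ← Nn_mid s u j, ← Nn_mid s i u, ← Finset.sum_add_distrib]
    exact Finset.sum_congr rfl fun x _ => (pent_repl hs x h).2

def bal {ι : Type*} [Fintype ι] (m : ℕ) (s : ι → ι → Bool) (i j l : ι) : Bool :=
  decide ((m ≤ Nn s j l ∧ Nn s j l ≤ m + 1) ∧ (m ≤ Nn s l i ∧ Nn s l i ≤ m + 1) ∧
    (m ≤ Nn s i j ∧ Nn s i j ≤ m + 1))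

theorem bal_rot {ι : Type*} [Fintype ι] (m : ℕ) (s : ι → ι → Bool) (i j l : ι) :
   bal m s i j l = bal m s j l i := by
  unfold bal; congr 1; apply propext; tauto

def bb {ι : Type*} [Fintype ι] (m : ℕ) (s : ι → ι → Bool) (i j l : ι) : ℕ :=
  (cy s i j l && bal m s i j l).toNat
def ub {ι : Type*} [Fintype ι] (m : ℕ) (s : ι → ι → Bool) (i j l : ι) : ℕ :=
  (cy s i j l && !bal m s i j l).toNat

theorem bb_rot {ι : Type*} [Fintype ι] (m : ℕ) (s : ι → ι → Bool) (i j l : ι) :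
   bb m s i j l = bb m s j l i := by
  unfold bb; rw [bal_rot, cy_rot]
theorem ub_rot {ι : Type*} [Fintype ι] (m : ℕ) (s : ι → ι → Bool) (i j l : ι) :
   ub m s i j l = ub m s j l i := by
  unfold ub; rw [bal_rot, cy_rot]

def gg (m x : ℕ) : ℕ := if m ≤ x ∧ x ≤ m + 1 then x - 1 else 0

theorem cap1 {ι : Type*} [Fintype ι] [DecidableEq ι] (m : ℕ) (s : ι → ι → Bool) (i j l : ι) :
    ub m s i j l * ∑ w, bb m s w j l ≤ ub m s i j l * gg m (Nn s j l) := by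
  by_cases h : cy s i j l = true ∧ bal m s i j l = false
  · apply Nat.mul_le_mul_left
    by_cases hr : m ≤ Nn s j l ∧ Nn s j l ≤ m + 1
    · rw [gg, if_pos hr]
      have : ∑ w, bb m s w j l + 1 ≤ Nn s j l := by
        unfold Nn
        rw [← Finset.add_sum_erase _ _ (Finset.mem_univ i),
          ← Finset.add_sum_erase _ (fun x => (cy s x j l).toNat) (Finset.mem_univ i)]
        have e : bb m s i j l = 0 := by simp [bb, h.2]
        have : ∑ x ∈ Finset.univ.erase i, bb m s x j l ≤ ∑ x ∈ Finset.univ.erase i, (cy s x j l).toNat := by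
          refine Finset.sum_le_sum fun x _ => ?_
          unfold bb; cases cy s x j l <;> cases bal m s x j l <;> simp
        simp only [e, h.1, Bool.toNat_true]
        omega
      omega
    · have : ∑ w, bb m s w j l = 0 := by
        refine Finset.sum_eq_zero fun w _ => ?_
        have : bal m s w j l = false := by unfold bal; simp only [decide_eq_false_iff_not]; tauto
        simp [bb, this]
      omega
  · have : ub m s i j l = 0 := by
      unfold ub; cases h1 : cy s i j l <;> cases h2 : bal m s i j l <;> simp_all
    simp [this]

theorem nrot3 {ι : Type*} [Fintype ι] (F : ι → ι → ι → ℕ) :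
    ∑ i, ∑ j, ∑ l, F i j l = ∑ i, ∑ j, ∑ l, F l i j := by
  conv_rhs => rw [Finset.sum_congr rfl (fun i _ => Finset.sum_comm)]
  exact Finset.sum_comm

/-- charges between neighbours -/
theorem neigh {ι : Type*} [Fintype ι] [DecidableEq ι] (m : ℕ) (s : ι → ι → Bool) :
    ∑ i, ∑ j, ∑ l, ∑ w, bb m s i j l * (ub m s w j l + ub m s i w l + ub m s i j w) ≤
    ∑ i, ∑ j, ∑ l, ub m s i j l * (gg m (Nn s j l) + gg m (Nn s l i) + gg m (Nn s i j)) := by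
  have A : ∑ i, ∑ j, ∑ l, ∑ w, bb m s i j l * ub m s w j l ≤
      ∑ i, ∑ j, ∑ l, ub m s i j l * gg m (Nn s j l) := by
    have : ∑ i, ∑ j, ∑ l, ∑ w, bb m s i j l * ub m s w j l =
      ∑ i, ∑ j, ∑ l, ub m s i j l * ∑ w, bb m s w j l := by
      simp only [Finset.mul_sum]
      rw [nrot3]
      conv_rhs => rw [nrot3]
      refine Finset.sum_congr rfl fun j _ => Finset.sum_congr rfl fun l _ => ?_
      rw [Finset.sum_comm]
      refine Finset.sum_congr rfl fun i _ => Finset.sum_congr rfl fun w _ => ?_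
      ring
    rw [this]
    exact Finset.sum_le_sum fun i _ => Finset.sum_le_sum fun j _ => Finset.sum_le_sum fun l _ =>
      cap1 m s i j l
  have B : ∑ i, ∑ j, ∑ l, ∑ w, bb m s i j l * ub m s i w l ≤
      ∑ i, ∑ j, ∑ l, ub m s i j l * gg m (Nn s l i) := by
    have e1 : ∑ i, ∑ j, ∑ l, ∑ w, bb m s i j l * ub m s i w l =
      ∑ i, ∑ j, ∑ l, ∑ w, bb m s i j l * ub m s w j l := by
      conv_rhs => rw [nrot3, nrot3]
      rw [← nrot3, nrot3]
      refine Finset.sum_congr rfl fun i _ => Finset.sum_congr rfl fun j _ =>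
        Finset.sum_congr rfl fun l _ => Finset.sum_congr rfl fun w _ => ?_
      rw [bb_rot m s i j l, ub_rot m s i w l]
    have e2 : ∑ i, ∑ j, ∑ l, ub m s i j l * gg m (Nn s j l) =
      ∑ i, ∑ j, ∑ l, ub m s i j l * gg m (Nn s l i) := by
      rw [nrot3, nrot3]
      refine Finset.sum_congr rfl fun i _ => Finset.sum_congr rfl fun j _ =>
        Finset.sum_congr rfl fun l _ => ?_
      rw [ub_rot m s i j l]
    rw [e1, ← e2]; exact A
  have C : ∑ i, ∑ j, ∑ l, ∑ w, bb m s i j l * ub m s i j w ≤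
      ∑ i, ∑ j, ∑ l, ub m s i j l * gg m (Nn s i j) := by
    have e1 : ∑ i, ∑ j, ∑ l, ∑ w, bb m s i j l * ub m s i j w =
      ∑ i, ∑ j, ∑ l, ∑ w, bb m s i j l * ub m s w j l := by
      conv_rhs => rw [nrot3]
      refine Finset.sum_congr rfl fun i _ => Finset.sum_congr rfl fun j _ =>
        Finset.sum_congr rfl fun l _ => Finset.sum_congr rfl fun w _ => ?_
      rw [← bb_rot m s l i j, ← ub_rot m s w i j]
    have e2 : ∑ i, ∑ j, ∑ l, ub m s i j l * gg m (Nn s j l) =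
      ∑ i, ∑ j, ∑ l, ub m s i j l * gg m (Nn s i j) := by
      rw [nrot3]
      refine Finset.sum_congr rfl fun i _ => Finset.sum_congr rfl fun j _ =>
        Finset.sum_congr rfl fun l _ => ?_
      rw [← ub_rot m s l i j]
    rw [e1, ← e2]; exact A
  simp only [mul_add, Finset.sum_add_distrib]
  omega

end MV

open MeasureTheory Real
namespace MV

theorem gg_le {m x : ℕ} : gg m x ≤ m := by unfold gg; split_ifs <;> omega
theorem gg_lt {m x : ℕ} (h : x < m) : gg m x = 0 := by unfold gg; rw [if_neg]; omega
theorem gg_gt {m x : ℕ} (h : m + 1 < x) : gg m x = 0 := by unfold gg; rw [if_neg]; omega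

theorem ar1p (m p b c : ℤ) (hm : 1 ≤ m) (hp : 0 ≤ p) (ha : 0 ≤ m - 1 - p) (hs : b + c = 2 * m + 2 + p) :
    (m - 1 - p) * b * c ≤ (m - 1) * (m + 1)^2 := by
  have h1 : 4 * (b * c) ≤ (2 * m + 2 + p)^2 := by rw [← hs]; nlinarith [sq_nonneg (b - c)]
  have h2 : (m - 1 - p) * (4 * (b * c)) ≤ (m - 1 - p) * (2 * m + 2 + p)^2 :=
    mul_le_mul_of_nonneg_left h1 ha
  have h3 : (m - 1 - p) * (2 * m + 2 + p)^2 ≤ 4 * ((m - 1) * (m + 1)^2) := by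
    have : 4 * ((m - 1) * (m + 1)^2) - (m - 1 - p) * (2 * m + 2 + p)^2 =
      p * (8 * m + 8 + 3 * m * p + 5 * p + p^2) := by ring
    have : 0 ≤ p * (8 * m + 8 + 3 * m * p + 5 * p + p^2) := by positivity
    linarith
  nlinarith

theorem ar2p (m p b c : ℤ) (hm : 1 ≤ m) (hp : 0 ≤ p) (ha : 0 ≤ m - 1 - p) (hs : b + c = 2 * m + 3 + p) :
    (m - 1 - p) * b * c ≤ (m - 1) * (m + 1) * (m + 2) := by
  rcases hp.eq_or_lt with rfl | hp
  · have h1 : b * c ≤ (m + 1) * (m + 2) := by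
      have : c = 2 * m + 3 - b := by linarith
      subst this
      have : 0 ≤ (b - (m+1)) * (b - (m + 2)) := by
        rcases le_or_gt b (m+1) with h | h
        · nlinarith
        · nlinarith
      nlinarith
    have := mul_le_mul_of_nonneg_left h1 ha
    linarith
  · have h1 : 4 * (b * c) ≤ (2 * m + 3 + p)^2 := by rw [← hs]; nlinarith [sq_nonneg (b - c)]
    have h2 : (m - 1 - p) * (4 * (b * c)) ≤ (m - 1 - p) * (2 * m + 3 + p)^2 :=
      mul_le_mul_of_nonneg_left h1 ha
    have h3 : (m - 1 - p) * (2 * m + 3 + p)^2 ≤ 4 * ((m - 1) * (m + 1) * (m + 2)) := by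
      have : 4 * ((m - 1) * (m + 1) * (m + 2)) - (m - 1 - p) * (2 * m + 3 + p)^2 =
        (p - 1) * (10 * m + 15) + (9 * m + 16) + p * (3 * m * p + 7 * p + p^2) := by ring
      have : 0 ≤ (p - 1) * (10 * m + 15) := by nlinarith
      have : 0 ≤ p * (3 * m * p + 7 * p + p^2) := by positivity
      linarith
    nlinarith

theorem ar1s (m a b c : ℕ) (hm : 1 ≤ m) (hab : a ≤ b) (hbc : b ≤ c) (hs : a + b + c = 3 * m + 1)
    (hn : ¬ ((m ≤ a ∧ a ≤ m + 1) ∧ (m ≤ b ∧ b ≤ m + 1) ∧ (m ≤ c ∧ c ≤ m + 1))) :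
    1 + (gg m a + gg m b + gg m c) + 2 * (a * b * c) ≤ 2 * (m^2 * (m+1)) := by
  have ha : a < m := by by_contra hh; apply hn; omega
  rw [gg_lt ha]
  have := @gg_le m b
  have := @gg_le m c
  obtain ⟨p, hp⟩ : ∃ p, m = a + 1 + p := ⟨m - a - 1, by omega⟩
  have h1 := ar1p m p b c (by omega) (by omega) (by omega) (by omega)
  have h2 : ((m : ℤ) - 1 - p) = a := by omega
  rw [h2] at h1
  have h3 : ((a * b * c : ℕ) : ℤ) ≤ ((m:ℤ) - 1) * (m + 1)^2 := by push_cast; exact h1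
  zify at *
  nlinarith

theorem ar2s (m a b c : ℕ) (hm : 1 ≤ m) (hab : a ≤ b) (hbc : b ≤ c) (hs : a + b + c = 3 * m + 2)
    (hn : ¬ ((m ≤ a ∧ a ≤ m + 1) ∧ (m ≤ b ∧ b ≤ m + 1) ∧ (m ≤ c ∧ c ≤ m + 1))) :
    m * (1 + (gg m a + gg m b + gg m c)) + (2 * m - 1) * (a * b * c) ≤ (2 * m - 1) * (m * (m+1)^2) := by
  obtain ⟨k, rfl⟩ : ∃ k, m = k + 1 := ⟨m - 1, by omega⟩
  have e : 2 * (k + 1) - 1 = 2 * k + 1 := by omega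
  rw [e]
  by_cases ha : a < k + 1
  · rw [gg_lt ha]
    have := @gg_le (k+1) b
    have := @gg_le (k+1) c
    obtain ⟨p, hp⟩ : ∃ p, k = a + p := ⟨k - a, by omega⟩
    have h1 := ar2p (k+1) p b c (by omega) (by omega) (by omega) (by omega)
    have h2 : (((k : ℤ) + 1) - 1 - p) = a := by omega
    rw [h2] at h1
    have h3 : ((a * b * c : ℕ) : ℤ) ≤ (((k:ℤ) + 1) - 1) * ((k + 1) + 1) * ((k+1) + 2) := by push_cast; exact h1
    zify at *
    have : (2 * (k:ℤ) + 1) * (a * b * c) ≤ (2 * (k:ℤ) + 1) * (k * (k + 2) * (k + 3)) := by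
      apply mul_le_mul_of_nonneg_left _ (by omega)
      nlinarith
    have : ((k:ℤ) + 1) * (1 + (0 + gg (k+1) b + gg (k+1) c)) ≤ (k + 1) * (1 + 2 * (k + 1)) := by
      apply mul_le_mul_of_nonneg_left _ (by omega)
      nlinarith
    push_cast at *
    nlinarith
  · have : a = k + 1 ∧ b = k + 1 ∧ c = k + 3 := by omega
    obtain ⟨rfl, rfl, rfl⟩ := this
    rw [@gg_gt (k+1) (k+3) (by omega)]
    have : gg (k+1) (k+1) = k := by unfold gg; rw [if_pos]; omega; omega
    rw [this]
    apply le_of_eq; ring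

theorem ar1 (m a b c : ℕ) (hm : 1 ≤ m) (hs : a + b + c = 3 * m + 1)
    (hn : ¬ ((m ≤ a ∧ a ≤ m + 1) ∧ (m ≤ b ∧ b ≤ m + 1) ∧ (m ≤ c ∧ c ≤ m + 1))) :
    1 + (gg m a + gg m b + gg m c) + 2 * (a * b * c) ≤ 2 * (m^2 * (m+1)) := by
  rcases le_total a b with h1 | h1 <;> rcases le_total b c with h2 | h2 <;> rcases le_total a c with h3 | h3
  · have := ar1s m a b c hm h1 h2 (by omega) (by tauto); linarith
  · have := ar1s m a b c hm h1 h2 (by omega) (by tauto); linarith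
  · have := ar1s m a c b hm h3 h2 (by omega) (by tauto); linarith
  · have := ar1s m c a b hm h3 h1 (by omega) (by tauto); linarith
  · have := ar1s m b a c hm h1 h3 (by omega) (by tauto); linarith
  · have := ar1s m b c a hm h2 h3 (by omega) (by tauto); linarith
  · have := ar1s m c b a hm h2 h1 (by omega) (by tauto); linarith
  · have := ar1s m c b a hm h2 h1 (by omega) (by tauto); linarith

theorem ar2 (m a b c : ℕ) (hm : 1 ≤ m) (hs : a + b + c = 3 * m + 2)
    (hn : ¬ ((m ≤ a ∧ a ≤ m + 1) ∧ (m ≤ b ∧ b ≤ m + 1) ∧ (m ≤ c ∧ c ≤ m + 1))) :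
    m * (1 + (gg m a + gg m b + gg m c)) + (2 * m - 1) * (a * b * c) ≤ (2 * m - 1) * (m * (m+1)^2) := by
  rcases le_total a b with h1 | h1 <;> rcases le_total b c with h2 | h2 <;> rcases le_total a c with h3 | h3
  · have := ar2s m a b c hm h1 h2 (by omega) (by tauto); linarith
  · have := ar2s m a b c hm h1 h2 (by omega) (by tauto); linarith
  · have := ar2s m a c b hm h3 h2 (by omega) (by tauto); rw [mul_right_comm a b c]; linarith
  · have := ar2s m c a b hm h3 h1 (by omega) (by tauto); rw [show a * b * c = c * a * b by ring]; linarith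
  · have := ar2s m b a c hm h1 h3 (by omega) (by tauto); rw [show a * b * c = b * a * c by ring]; linarith
  · have := ar2s m b c a hm h2 h3 (by omega) (by tauto); rw [show a * b * c = b * c * a by ring]; linarith
  · have := ar2s m c b a hm h2 h1 (by omega) (by tauto); rw [show a * b * c = c * b * a by ring]; linarith
  · have := ar2s m c b a hm h2 h1 (by omega) (by tauto); rw [show a * b * c = c * b * a by ring]; linarith

/-- special parts -/
def sz (m a b c : ℕ) : ℕ := if a = 2 * m ∧ b = 1 ∧ c = m + 1 then 1 else 0

theorem ar2sp (m : ℕ) (hm : 2 ≤ m) :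
    m * (1 + m + m * (2 * m - 1)) + (2 * m - 1) * (2 * m * (m + 1)) ≤ (2 * m - 1) * (m * (m+1)^2) := by
  obtain ⟨k, rfl⟩ : ∃ k, m = k + 2 := ⟨m - 2, by omega⟩
  have : 2 * (k + 2) - 1 = 2 * k + 3 := by omega
  rw [this]
  nlinarith [Nat.zero_le (k^2), Nat.zero_le (k^3), Nat.zero_le (k^4)]

theorem ar3 (m a b c : ℕ) (hm : 2 ≤ m) (hs : a + b + c = 3 * m + 2)
    (hn : ¬ ((m ≤ a ∧ a ≤ m + 1) ∧ (m ≤ b ∧ b ≤ m + 1) ∧ (m ≤ c ∧ c ≤ m + 1))) :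
    m * (1 + (gg m a + gg m b + gg m c) + (sz m a b c + sz m b c a + sz m c a b) * (m * (2 * m - 1)))
      + (2 * m - 1) * (a * b * c) ≤ (2 * m - 1) * (m * (m+1)^2) := by
  have g1 : gg m 1 = 0 := gg_lt (by omega)
  have g2 : gg m (2*m) = 0 := gg_gt (by omega)
  have g3 : gg m (m+1) = m := by unfold gg; rw [if_pos]; omega; omega
  have z : sz m (2*m) 1 (m+1) = 1 ∧ sz m 1 (m+1) (2 * m) = 0 ∧ sz m (m+1) (2*m) 1 = 0 := by
    unfold sz; refine ⟨?_, ?_, ?_⟩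
    · simp
    · rw [if_neg]; omega
    · rw [if_neg]; omega
  have key := ar2sp m hm
  have e : 1 * (m * (2 * m - 1)) = m * (2 * m - 1) := one_mul _
  by_cases h1 : a = 2 * m ∧ b = 1 ∧ c = m + 1
  · obtain ⟨rfl, rfl, rfl⟩ := h1
    rw [g1, g2, g3, z.1, z.2.1, z.2.2]
    simp only [zero_add, add_zero, one_mul, mul_one]; exact key
  · by_cases h2 : b = 2 * m ∧ c = 1 ∧ a = m + 1
    · obtain ⟨rfl, rfl, rfl⟩ := h2
      rw [g1, g2, g3, z.1, z.2.1, z.2.2]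
      simp only [zero_add, add_zero, one_mul, mul_one]; rw [mul_comm (m+1) (2 * m)]; exact key
    · by_cases h3 : c = 2 * m ∧ a = 1 ∧ b = m + 1
      · obtain ⟨rfl, rfl, rfl⟩ := h3
        rw [g1, g2, g3, z.1, z.2.1, z.2.2]
        simp only [zero_add, add_zero, one_mul, mul_one]; rw [mul_comm (m+1) (2 * m)]; exact key
      · have := ar2 m a b c (by omega) hs hn
        have e1 : sz m a b c = 0 := if_neg h1
        have e2 : sz m b c a = 0 := if_neg h2
        have e3 : sz m c a b = 0 := if_neg h3
        rw [e1, e2, e3]; simpa using this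

end MV

open MeasureTheory Real
namespace MV

variable {ι : Type*} [Fintype ι] [DecidableEq ι]

/-- number of unbalanced neighbours -/
def Ph (m : ℕ) (s : ι → ι → Bool) (i j l : ι) : ℕ := ∑ w, (ub m s w j l + ub m s i w l + ub m s i j w)

theorem Ph_rot (m : ℕ) (s : ι → ι → Bool) (i j l : ι) : Ph m s i j l = Ph m s j l i := by
  unfold Ph
  refine Finset.sum_congr rfl fun w _ => ?_
  rw [ub_rot m s w j l, ub_rot m s i w l, ub_rot m s w l i, ub_rot m s l i w, ub_rot m s i j w]; ring

theorem Ph_ge (m : ℕ) (s : ι → ι → Bool) (i j l w : ι) :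
    ub m s w j l + ub m s i w l + ub m s i j w ≤ Ph m s i j l :=
  Finset.single_le_sum (f := fun w => ub m s w j l + ub m s i w l + ub m s i j w)
    (fun x _ => Nat.zero_le _) (Finset.mem_univ w)

def spb (m : ℕ) (s : ι → ι → Bool) (l u v : ι) : Bool :=
  decide (Nn s u v = 2 * m ∧ Nn s v l = 1 ∧ Nn s l u = m + 1)

def ee (m : ℕ) (s : ι → ι → Bool) (v i j l u : ι) : ℕ := (pent s v i j l u && spb m s l u v).toNat

def EE (m : ℕ) (s : ι → ι → Bool) (i j l : ι) : ℕ := ∑ u, ∑ v, ee m s v i j l u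

theorem bal_ex {s : ι → ι → Bool} (hs : LT s) (m : ℕ) {v i j l u : ι} (hp : pent s v i j l u = true)
    (hb : bal m s i j l = true) (hcard : Fintype.card ι = 3 * m + 1 ∨ Fintype.card ι = 3 * m + 2) :
    1 ≤ Ph m s i j l ∨ (Fintype.card ι = 3 * m + 2 ∧ spb m s l u v = true) := by
  have hm := pent_mem hp
  obtain ⟨m1, m2, m3, m4, m5⟩ := hm
  by_cases h1 : bal m s j l u = true
  · by_cases h2 : bal m s v i j = true
    · right
      have p1 : pent s i j l u v = true := by rw [← pent_rot]; exact hp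
      have p2 : pent s j l u v i = true := by rw [← pent_rot]; exact p1
      have p3 : pent s l u v i j = true := by rw [← pent_rot]; exact p2
      have p4 : pent s u v i j l = true := by rw [← pent_rot]; exact p3
      have c0 := pent_counts hs hp
      have c1 := (pent_counts hs p1).2
      have c2 := (pent_counts hs p2).2
      have c3 := (pent_counts hs p3).2
      have c4 := (pent_counts hs p4).2
      have q1 : 1 ≤ Nn s v l := Nn_pos (i := u) (by rw [← cy_rot]; exact m4)
      have q2 : 1 ≤ Nn s i u := Nn_pos (i := v) (by rw [← cy_rot]; exact m5)
      unfold bal at hb h1 h2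
      unfold spb
      simp only [decide_eq_true_eq] at *
      omega
    · left
      have e : ub m s i j v = 1 := by
        rw [← ub_rot]; simp [ub, m1, h2]
      have := Ph_ge m s i j l v
      omega
  · left
    have e : ub m s u j l = 1 := by
      rw [ub_rot]; simp [ub, m3, h1]
    have := Ph_ge m s i j l u
    omega

theorem sum_bb {s : ι → ι → Bool} (m : ℕ) (hle : ∀ i j l, bb m s i j l ≤ bb m s i j l * Ph m s i j l +
      (EE m s i j l + EE m s j l i + EE m s l i j)) :
    ∑ i, ∑ j, ∑ l, bb m s i j l ≤
    ∑ i, ∑ j, ∑ l, ub m s i j l * (gg m (Nn s j l) + gg m (Nn s l i) + gg m (Nn s i j)) +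
     3 * ∑ i, ∑ j, ∑ l, EE m s i j l := by
  have h1 : ∑ i, ∑ j, ∑ l, bb m s i j l ≤ ∑ i, ∑ j, ∑ l, (bb m s i j l * Ph m s i j l +
      (EE m s i j l + EE m s j l i + EE m s l i j)) :=
    Finset.sum_le_sum fun i _ => Finset.sum_le_sum fun j _ => Finset.sum_le_sum fun l _ => hle i j l
  simp only [Finset.sum_add_distrib] at h1
  have h2 := neigh m s
  have h3 : ∑ i, ∑ j, ∑ l, bb m s i j l * Ph m s i j l =
    ∑ i, ∑ j, ∑ l, ∑ w, bb m s i j l * (ub m s w j l + ub m s i w l + ub m s i j w) := by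
    unfold Ph; simp only [Finset.mul_sum]
  have h4 : ∑ i, ∑ j, ∑ l, EE m s l i j = ∑ i, ∑ j, ∑ l, EE m s i j l := (nrot3 _).symm
  have h5 : ∑ i, ∑ j, ∑ l, EE m s j l i = ∑ i, ∑ j, ∑ l, EE m s i j l := by
    rw [nrot3 (fun i j l => EE m s i j l), nrot3 (fun i j l => EE m s l i j)]
  omega

/-- special cyclic triples -/
def spc (m : ℕ) (s : ι → ι → Bool) (l u v : ι) : ℕ := (cy s l u v && spb m s l u v).toNat

theorem ee_sum (m : ℕ) {s : ι → ι → Bool} (hs : LT s) (l u v : ι) :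
    ∑ i, ∑ j, ee m s v i j l u ≤ spc m s l u v * (m * (2 * m - 1)) := by
  by_cases h : cy s l u v = true ∧ spb m s l u v = true
  · have e : spc m s l u v = 1 := by simp [spc, h.1, h.2]
    rw [e, one_mul]
    have b : ∀ i j, ee m s v i j l u ≤ (if i = l then 0 else (cy s i u v).toNat) *
        (if j = v then 0 else (cy s j l u).toNat) := by
      intro i j
      unfold ee
      cases hp : pent s v i j l u
      · simp
      · obtain ⟨m1, m2, m3, m4, m5⟩ := pent_mem hp
        have d1 : i ≠ l := by
          rintro rfl
          have := cy_ne hs m2; tauto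
        have d2 : j ≠ v := by
          rintro rfl
          have := cy_ne hs m1; tauto
        have m6 : cy s i u v = true := by rw [cy_rot]; exact m5
        simp [d1, d2, m3, m6, h.2]
    refine (Finset.sum_le_sum fun i _ => Finset.sum_le_sum fun j _ => b i j).trans ?_
    rw [← Finset.sum_mul_sum]
    have er : ∀ (f : ι → ℕ) (a : ι), f a = 1 → ∑ i, (if i = a then 0 else f i) + 1 = ∑ i, f i := by
      intro f a ha
      rw [← Finset.add_sum_erase _ f (Finset.mem_univ a), ← Finset.add_sum_erase _ _ (Finset.mem_univ a)]
      rw [ha, if_pos rfl, zero_add, add_comm]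
      congr 1
      exact Finset.sum_congr rfl fun x hx => if_neg (Finset.ne_of_mem_erase hx)
    have e1 := er (fun i => (cy s i u v).toNat) l (by simp [h.1])
    have e2 := er (fun j => (cy s j l u).toNat) v (by
      have : cy s v l u = true := by rw [cy_rot]; exact h.1
      simp [this])
    have hh := h.2
    unfold spb Nn at hh
    simp only [decide_eq_true_eq] at hh
    rw [hh.1] at e1
    rw [hh.2.2] at e2
    have e3 : ∑ i, (if i = l then 0 else (cy s i u v).toNat) = 2 * m - 1 := by omega
    have e4 : ∑ i, (if i = v then 0 else (cy s i l u).toNat) = m := by omega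
    rw [e3, e4, mul_comm]
  · have : ∑ i, ∑ j, ee m s v i j l u = 0 := by
      refine Finset.sum_eq_zero fun i _ => Finset.sum_eq_zero fun j _ => ?_
      unfold ee
      cases hp : pent s v i j l u
      · simp
      · obtain ⟨m1, m2, m3, m4, m5⟩ := pent_mem hp
        cases hq : spb m s l u v
        · simp
        · exact absurd ⟨m4, hq⟩ h
    rw [this]; exact Nat.zero_le _

theorem EE_sum (m : ℕ) {s : ι → ι → Bool} (hs : LT s) :
    3 * ∑ i, ∑ j, ∑ l, EE m s i j l ≤
      ∑ l, ∑ u, ∑ v, (spc m s l u v + spc m s u v l + spc m s v l u) * (m * (2 * m - 1)) := by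
  have h1 : ∑ i, ∑ j, ∑ l, EE m s i j l = ∑ l, ∑ u, ∑ v, ∑ i, ∑ j, ee m s v i j l u := by
    unfold EE
    have a : ∀ F : ι → ι → ι → ι → ι → ℕ, ∑ i, ∑ j, ∑ l, ∑ u, ∑ v, F i j l u v =
        ∑ l, ∑ u, ∑ v, ∑ i, ∑ j, F i j l u v := by
      intro F
      have b : ∀ G : ι → ι → ι → ℕ, ∑ i, ∑ j, ∑ l, G i j l = ∑ l, ∑ i, ∑ j, G i j l := by
        intro G; rw [nrot3, nrot3]
      rw [b]
      refine Finset.sum_congr rfl fun l _ => ?_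
      rw [b]
      refine Finset.sum_congr rfl fun u _ => ?_
      rw [b]
    exact a _
  have h2 : ∑ l, ∑ u, ∑ v, ∑ i, ∑ j, ee m s v i j l u ≤ ∑ l, ∑ u, ∑ v, spc m s l u v * (m * (2 * m - 1)) :=
    Finset.sum_le_sum fun l _ => Finset.sum_le_sum fun u _ => Finset.sum_le_sum fun v _ => ee_sum m hs l u v
  have h3 : ∑ l, ∑ u, ∑ v, spc m s v l u * (m * (2 * m - 1)) = ∑ l, ∑ u, ∑ v, spc m s l u v * (m * (2 * m - 1)) :=
    (nrot3 _).symm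
  have h4 : ∑ l, ∑ u, ∑ v, spc m s u v l * (m * (2 * m - 1)) = ∑ l, ∑ u, ∑ v, spc m s l u v * (m * (2 * m - 1)) := by
    rw [nrot3 (fun l u v => spc m s l u v * (m * (2 * m - 1))), nrot3 (fun l u v => spc m s v l u * (m * (2 * m - 1)))]
  simp only [add_mul, Finset.sum_add_distrib]
  rw [h1]
  omega

/-- every balanced triple is in a pentagon -/
def AllPent (m : ℕ) (s : ι → ι → Bool) : Prop :=
  ∀ i j l, cy s i j l = true → bal m s i j l = true →
    ∃ u v, pent s v i j l u = true ∨ pent s v j l i u = true ∨ pent s v l i j u = true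

theorem hle_of {s : ι → ι → Bool} (hs : LT s) (m : ℕ)
    (hcard : Fintype.card ι = 3 * m + 1 ∨ Fintype.card ι = 3 * m + 2) (hA : AllPent m s) (i j l : ι) :
    bb m s i j l ≤ bb m s i j l * Ph m s i j l + (EE m s i j l + EE m s j l i + EE m s l i j) := by
  by_cases h : cy s i j l = true ∧ bal m s i j l = true
  · have e : bb m s i j l = 1 := by simp [bb, h.1, h.2]
    rw [e, one_mul]
    have ge : ∀ i j l u v, ee m s v i j l u ≤ EE m s i j l := by
      intro i j l u v
      unfold EE
      exact (Finset.single_le_sum (f := fun v => ee m s v i j l u)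
        (fun x _ => Nat.zero_le _) (Finset.mem_univ v)).trans (Finset.single_le_sum
          (f := fun u => ∑ v, ee m s v i j l u) (fun x _ => Nat.zero_le _) (Finset.mem_univ u))
    obtain ⟨u, v, hp | hp | hp⟩ := hA i j l h.1 h.2
    · rcases bal_ex hs m hp h.2 hcard with h1 | h1
      · omega
      · have := ge i j l u v
        have : ee m s v i j l u = 1 := by simp [ee, hp, h1.2]
        omega
    · rcases bal_ex hs m hp (by rw [← bal_rot]; exact h.2) hcard with h1 | h1
      · rw [← Ph_rot] at h1; omega
      · have := ge j l i u v
        have : ee m s v j l i u = 1 := by simp [ee, hp, h1.2]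
        omega
    · rcases bal_ex hs m hp (by rw [bal_rot]; exact h.2) hcard with h1 | h1
      · rw [Ph_rot] at h1; omega
      · have := ge l i j u v
        have : ee m s v l i j u = 1 := by simp [ee, hp, h1.2]
        omega
  · have : bb m s i j l = 0 := by
      unfold bb; cases h1 : cy s i j l <;> cases h2 : bal m s i j l <;> simp_all
    omega

theorem mu0 {s : ι → ι → Bool} (hs : LT s) (M : ℕ)
    (hM : ∀ a b c : ℕ, a + b + c = Fintype.card ι → a * b * c ≤ M) : Sq s ≤ M * Tq s := by
  unfold Sq Tq
  simp only [Finset.mul_sum]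
  refine Finset.sum_le_sum fun i _ => Finset.sum_le_sum fun j _ => Finset.sum_le_sum fun l _ => ?_
  rcases cr_01 s i j l with h0 | h1
  · rw [h0]; simp
  · rw [h1, one_mul, mul_one, Nr_eq, Nr_eq, Nr_eq]
    exact_mod_cast hM _ _ _ (parts_sum hs (cr_one.1 h1))

theorem EE_zero {s : ι → ι → Bool} (hs : LT s) (m : ℕ) (hcard : Fintype.card ι = 3 * m + 1) (hm : 2 ≤ m)
   (i j l : ι) :
    EE m s i j l = 0 := by
  unfold EE
  refine Finset.sum_eq_zero fun u _ => Finset.sum_eq_zero fun v _ => ?_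
  unfold ee
  cases hp : pent s v i j l u
  · simp
  · obtain ⟨m1, m2, m3, m4, m5⟩ := pent_mem hp
    have : spb m s l u v = false := by
      have := parts_sum hs m4
      unfold spb
      simp only [decide_eq_false_iff_not]
      omega
    simp [this]

/-- final pointwise summation -/
theorem final_sum {s : ι → ι → Bool} (hs : LT s) (m κ la M : ℕ) (X : ι → ι → ι → ℕ)
    (hsum : ∑ i, ∑ j, ∑ l, bb m s i j l ≤ ∑ i, ∑ j, ∑ l, (ub m s i j l *
      (gg m (Nn s j l) + gg m (Nn s l i) + gg m (Nn s i j)) + X i j l))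
    (hX : ∀ i j l, cy s i j l = false → X i j l = 0)
    (hbal : ∀ i j l, cy s i j l = true → bal m s i j l = true → X i j l = 0 ∧
       Nn s j l * Nn s l i * Nn s i j ≤ M)
    (hub : ∀ i j l, cy s i j l = true → bal m s i j l = false →
       la * (1 + (gg m (Nn s j l) + gg m (Nn s l i) + gg m (Nn s i j)) + X i j l) +
         κ * (Nn s j l * Nn s l i * Nn s i j) ≤ κ * M) :
    (κ : ℝ) * Sq s + la * Tq s ≤ κ * M * Tq s := by
  have h1 : (κ : ℝ) * Sq s + la * Tq s + la * ∑ i, ∑ j, ∑ l, ((ub m s i j l *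
      (gg m (Nn s j l) + gg m (Nn s l i) + gg m (Nn s i j)) + X i j l : ℕ) : ℝ) ≤
      κ * M * Tq s + la * ∑ i, ∑ j, ∑ l, (bb m s i j l : ℝ) := by
    unfold Sq Tq
    simp only [Finset.mul_sum, ← Finset.sum_add_distrib]
    refine Finset.sum_le_sum fun i _ => Finset.sum_le_sum fun j _ => Finset.sum_le_sum fun l _ => ?_
    cases hc : cy s i j l
    · rw [cr_zero.2 hc, hX i j l hc]
      simp [ub, bb, hc]
    · rw [cr_one.2 hc, Nr_eq, Nr_eq, Nr_eq]
      cases hb : bal m s i j l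
      · have := hub i j l hc hb
        have e1 : ub m s i j l = 1 := by simp [ub, hc, hb]
        have e2 : bb m s i j l = 0 := by simp [bb, hb]
        rw [e1, e2]
        have t : ((la * (1 + (gg m (Nn s j l) + gg m (Nn s l i) + gg m (Nn s i j)) + X i j l) +
         κ * (Nn s j l * Nn s l i * Nn s i j) : ℕ) : ℝ) ≤ (κ * M : ℕ) := by exact_mod_cast this
        push_cast at t ⊢
        linarith
      · obtain ⟨x0, h2⟩ := hbal i j l hc hb
        have e1 : ub m s i j l = 0 := by simp [ub, hb]
        have e2 : bb m s i j l = 1 := by simp [bb, hc, hb]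
        rw [e1, e2, x0]
        have t : ((Nn s j l * Nn s l i * Nn s i j : ℕ) : ℝ) ≤ M := by exact_mod_cast h2
        have : (κ : ℝ) * (Nn s j l * Nn s l i * Nn s i j : ℕ) ≤ κ * M :=
          mul_le_mul_of_nonneg_left t (Nat.cast_nonneg _)
        push_cast at this ⊢
        linarith
  have h2 : (la : ℝ) * ∑ i, ∑ j, ∑ l, (bb m s i j l : ℝ) ≤ la * ∑ i, ∑ j, ∑ l, ((ub m s i j l *
      (gg m (Nn s j l) + gg m (Nn s l i) + gg m (Nn s i j)) + X i j l : ℕ) : ℝ) := by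
    apply mul_le_mul_of_nonneg_left _ (Nat.cast_nonneg _)
    exact_mod_cast hsum
  linarith

theorem mu1 {s : ι → ι → Bool} (hs : LT s) (m : ℕ) (hm : 2 ≤ m) (hcard : Fintype.card ι = 3 * m + 1)
    (hA : AllPent m s) : Sq s ≤ ((m:ℝ)^2 * (m + 1) - 1/2) * Tq s := by
  have h1 := sum_bb m (hle_of hs m (Or.inl hcard) hA)
  simp only [EE_zero hs m hcard hm, Finset.sum_const_zero, mul_zero, add_zero] at h1
  have := final_sum hs m 2 1 (m^2 * (m+1)) (fun _ _ _ => 0) (by simpa using h1) (by simp) (by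
    intro i j l hc hb
    refine ⟨rfl, ?_⟩
    have := parts_sum hs hc
    unfold bal at hb
    simp only [decide_eq_true_eq] at hb
    generalize Nn s j l = a at *
    generalize Nn s l i = b at *
    generalize Nn s i j = c at *
    have : (a = m ∧ b = m ∧ c = m + 1) ∨ (a = m ∧ b = m + 1 ∧ c = m) ∨ (a = m + 1 ∧ b = m ∧ c = m) := by omega
    rcases this with ⟨rfl, rfl, rfl⟩ | ⟨rfl, rfl, rfl⟩ | ⟨rfl, rfl, rfl⟩ <;> apply le_of_eq <;> ring) (by
    intro i j l hc hb
    have h2 := parts_sum hs hc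
    unfold bal at hb
    simp only [decide_eq_false_iff_not] at hb
    have := ar1 m _ _ _ (by omega) (h2.trans hcard) hb
    simpa using this)
  push_cast at this
  linarith

theorem mu2 {s : ι → ι → Bool} (hs : LT s) (m : ℕ) (hm : 2 ≤ m) (hcard : Fintype.card ι = 3 * m + 2)
    (hA : AllPent m s) : (2 * (m:ℝ) - 1) * Sq s ≤ ((2 * m - 1) * (m * (m + 1)^2) - m) * Tq s := by
  have h1 := sum_bb m (hle_of hs m (Or.inr hcard) hA)
  have h3 := EE_sum m hs
  have := final_sum hs m (2 * m - 1) m (m * (m+1)^2)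
    (fun l u v => (spc m s l u v + spc m s u v l + spc m s v l u) * (m * (2 * m - 1))) (by
      simp only [Finset.sum_add_distrib] at h1 h3 ⊢
      linarith) (by
      intro i j l hc
      have e2 : cy s j l i = false := by rw [← cy_rot]; exact hc
      have e3 : cy s l i j = false := by rw [cy_rot]; exact hc
      simp [spc, hc, e2, e3]) (by
    intro i j l hc hb
    have := parts_sum hs hc
    unfold spc spb
    unfold bal at hb
    simp only [decide_eq_true_eq] at hb
    generalize Nn s j l = a at *
    generalize Nn s l i = b at *
    generalize Nn s i j = c at *
    constructor
    · have t1 : ¬ (a = 2 * m ∧ b = 1 ∧ c = m + 1) := by omega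
      have t2 : ¬ (b = 2 * m ∧ c = 1 ∧ a = m + 1) := by omega
      have t3 : ¬ (c = 2 * m ∧ a = 1 ∧ b = m + 1) := by omega
      simp [t1, t2, t3]
    · have : (a = m + 1 ∧ b = m + 1 ∧ c = m) ∨ (a = m + 1 ∧ b = m ∧ c = m + 1) ∨ (a = m ∧ b = m + 1 ∧ c = m + 1) := by omega
      rcases this with ⟨rfl, rfl, rfl⟩ | ⟨rfl, rfl, rfl⟩ | ⟨rfl, rfl, rfl⟩ <;> apply le_of_eq <;> ring) (by
    intro i j l hc hb
    have h2 := parts_sum hs hc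
    unfold bal at hb
    simp only [decide_eq_false_iff_not] at hb
    have := ar3 m _ _ _ hm (h2.trans hcard) hb
    have e2 : cy s j l i = true := by rw [← cy_rot]; exact hc
    have e3 : cy s l i j = true := by rw [cy_rot]; exact hc
    have f : ∀ a b c, (decide (a = 2 * m ∧ b = 1 ∧ c = m + 1)).toNat = sz m a b c := by
      intro a b c; unfold sz; by_cases h : a = 2 * m ∧ b = 1 ∧ c = m + 1 <;> simp [h]
    have g1 : spc m s i j l = sz m (Nn s j l) (Nn s l i) (Nn s i j) := by
      rw [← f]; simp [spc, spb, hc]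
    have g2 : spc m s j l i = sz m (Nn s l i) (Nn s i j) (Nn s j l) := by
      rw [← f]; simp [spc, spb, e2]
    have g3 : spc m s l i j = sz m (Nn s i j) (Nn s j l) (Nn s l i) := by
      rw [← f]; simp [spc, spb, e3]
    rw [g1, g2, g3]
    exact this)
  have e : ((2 * m - 1 : ℕ) : ℝ) = 2 * (m:ℝ) - 1 := by
    rw [Nat.cast_sub (by omega)]; push_cast; ring
  rw [e] at this
  push_cast at this
  linarith

end MV

open MeasureTheory Real
namespace MV

theorem c_bound {ι : Type*} [Fintype ι] [DecidableEq ι] {s : ι → ι → Bool} (h : LT s) (μ : ℝ) (hμ : 0 ≤ μ)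
    (hS : Sq s ≤ μ * Tq s) (x y : ι → ℝ) (hx : ∑ i, x i * x i = 1) (hy : ∑ i, y i * y i = 1)
    (hxy : ∑ i, x i * y i = 0) :
    (∑ i, ∑ j, x i * KK s i j * y j) ^ 2 ≤ (Fintype.card ι : ℝ) * μ := by
  have h1 := spectral h x y hx hy hxy
  rw [id_Q h] at h1
  have h2 : 2 * Sq s - Tq s ^ 2 / 3 ≤ 3 * μ^2 := by nlinarith [sq_nonneg (Tq s - 3 * μ)]
  have h3 : (∑ i, ∑ j, x i * KK s i j * y j) ^ 4 ≤ ((Fintype.card ι : ℝ) * μ)^2 := by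
    have : (Fintype.card ι : ℝ)^2 / 3 * (2 * Sq s - Tq s ^ 2 / 3) ≤ (Fintype.card ι : ℝ)^2 / 3 * (3 * μ^2) :=
      mul_le_mul_of_nonneg_left h2 (by positivity)
    nlinarith
  refine abs_le_of_sq_le_sq' ?_ (by positivity) |>.2
  nlinarith

noncomputable def F0 {ι : Type*} [Fintype ι] (x y : ι → ℝ) : ℝ :=
  ∑ i, ∑ j, if 0 < y i ∧ y j < 0 ∧ 0 < x j * y i - x i * y j then x j * y i - x i * y j else 0

/-- order on slopes -/
noncomputable def prc {ι : Type*} (x y : ι → ℝ) (e : ι → ℕ) (i j : ι) : Bool :=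
  open Classical in decide (x j / y j < x i / y i ∨ (x j / y j = x i / y i ∧ e i < e j))

noncomputable def epb {ι : Type*} (y : ι → ℝ) (i : ι) : Bool := open Classical in decide (0 < y i)

noncomputable def ss {ι : Type*} [DecidableEq ι] (x y : ι → ℝ) (e : ι → ℕ) (i j : ι) : Bool :=
  (decide (i ≠ j)) && (prc x y e i j == (epb y i == epb y j))

theorem prc_asy {ι : Type*} (x y : ι → ℝ) {e : ι → ℕ} (he : Function.Injective e) {i j : ι} (h : i ≠ j) :
    prc x y e j i = !prc x y e i j := by
  unfold prc
  have : e i ≠ e j := fun hh => h (he hh)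
  rw [← decide_not]
  congr 1
  apply propext
  rcases lt_trichotomy (x i / y i) (x j / y j) with h1 | h1 | h1
  · simp [h1, h1.le, h1.ne', h1.not_gt]
  · simp only [h1, lt_irrefl, false_or, true_and]; omega
  · simp [h1, h1.le, h1.ne', h1.not_gt, h1.ne]

theorem prc_tr {ι : Type*} (x y : ι → ℝ) (e : ι → ℕ) (i j l : ι) :
    (prc x y e i j && prc x y e j l && prc x y e l i) = false := by
  rw [Bool.eq_false_iff]
  intro h
  simp only [prc, Bool.and_eq_true, decide_eq_true_eq] at h
  obtain ⟨⟨h1, h2⟩, h3⟩ := h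
  rcases h1 with h1 | h1 <;> rcases h2 with h2 | h2 <;> rcases h3 with h3 | h3 <;>
    linarith

theorem out_bool : ∀ pax pay paz pxy pyz pzx ea ex ey ez : Bool,
    (pax && pxy && !pay) = false → (!pax && !pxy && pay) = false →
    (pay && pyz && !paz) = false → (!pay && !pyz && paz) = false →
    (paz && pzx && !pax) = false → (!paz && !pzx && pax) = false →
    (pxy && pyz && pzx) = false → (!pxy && !pyz && !pzx) = false →
    ((pax == (ea == ex)) && (pay == (ea == ey)) && (paz == (ea == ez)) &&
     (pxy == (ex == ey)) && (pyz == (ey == ez)) && (pzx == (ez == ex))) = false := by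
  intro pax pay paz pxy pyz pzx
  cases pax <;> cases pay <;> cases paz <;> cases pxy <;> cases pyz <;> cases pzx <;> simp <;> decide

theorem inn_bool : ∀ pax pay paz pxy pyz pzx ea ex ey ez : Bool,
    (pax && pxy && !pay) = false → (!pax && !pxy && pay) = false →
    (pay && pyz && !paz) = false → (!pay && !pyz && paz) = false →
    (paz && pzx && !pax) = false → (!paz && !pzx && pax) = false →
    (pxy && pyz && pzx) = false → (!pxy && !pyz && !pzx) = false →
    (((!pax) == (ex == ea)) && ((!pay) == (ey == ea)) && ((!paz) == (ez == ea)) &&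
     (pxy == (ex == ey)) && (pyz == (ey == ez)) && (pzx == (ez == ex))) = false := by
  intro pax pay paz pxy pyz pzx
  cases pax <;> cases pay <;> cases paz <;> cases pxy <;> cases pyz <;> cases pzx <;> simp <;> decide

theorem ss_LT {ι : Type*} [DecidableEq ι] (x y : ι → ℝ) {e : ι → ℕ} (he : Function.Injective e) :
    LT (ss x y e) := by
  have asy : ∀ {i j}, i ≠ j → prc x y e j i = !prc x y e i j := fun h => prc_asy x y he h
  have ne : ∀ {i j}, ss x y e i j = true → i ≠ j := by
    intro i j h; simp only [ss, Bool.and_eq_true, decide_eq_true_eq] at h; exact h.1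
  have eq : ∀ {i j}, ss x y e i j = true → (prc x y e i j == (epb y i == epb y j)) = true := by
    intro i j h; simp only [ss, Bool.and_eq_true, decide_eq_true_eq] at h; exact h.2
  have tr := prc_tr x y e
  refine ⟨?_, ?_, ?_, ?_⟩
  · intro i; simp [ss]
  · intro i j h
    simp only [ss]
    rw [asy h]
    have h' := h.symm
    simp only [ne_eq, h, h', not_false_eq_true, decide_true, Bool.true_and]
    cases prc x y e i j <;> cases epb y i <;> cases epb y j <;> rfl
  · intro a u v w h1 h2 h3 ⟨h4, h5, h6⟩
    have n1 := ne h1; have n2 := ne h2; have n3 := ne h3; have n4 := ne h4; have n5 := ne h5; have n6 := ne h6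
    have := out_bool (prc x y e a u) (prc x y e a v) (prc x y e a w) (prc x y e u v) (prc x y e v w)
      (prc x y e w u) (epb y a) (epb y u) (epb y v) (epb y w)
      (by rw [← asy n2]; exact tr a u v)
      (by rw [← asy n1, ← asy n4, Bool.and_right_comm, Bool.and_comm (prc x y e u a)];
          rw [Bool.and_right_comm]; exact tr a v u)
      (by rw [← asy n3]; exact tr a v w)
      (by rw [← asy n2, ← asy n5, Bool.and_right_comm, Bool.and_comm (prc x y e v a)];
          rw [Bool.and_right_comm]; exact tr a w v)
      (by rw [← asy n1]; exact tr a w u)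
      (by rw [← asy n3, ← asy n6, Bool.and_right_comm, Bool.and_comm (prc x y e w a)];
          rw [Bool.and_right_comm]; exact tr a u w)
      (tr u v w)
      (by rw [← asy n4, ← asy n5, ← asy n6]; rw [Bool.and_right_comm];
          have := tr v u w; exact this)
    rw [eq h1, eq h2, eq h3, eq h4, eq h5, eq h6] at this
    simp at this
  · intro a u v w h1 h2 h3 ⟨h4, h5, h6⟩
    have n1 := (ne h1).symm; have n2 := (ne h2).symm; have n3 := (ne h3).symm
    have n4 := ne h4; have n5 := ne h5; have n6 := ne h6
    have := inn_bool (prc x y e a u) (prc x y e a v) (prc x y e a w) (prc x y e u v) (prc x y e v w)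
      (prc x y e w u) (epb y a) (epb y u) (epb y v) (epb y w)
      (by rw [← asy n2]; exact tr a u v)
      (by rw [← asy n1, ← asy n4, Bool.and_right_comm, Bool.and_comm (prc x y e u a)];
          rw [Bool.and_right_comm]; exact tr a v u)
      (by rw [← asy n3]; exact tr a v w)
      (by rw [← asy n2, ← asy n5, Bool.and_right_comm, Bool.and_comm (prc x y e v a)];
          rw [Bool.and_right_comm]; exact tr a w v)
      (by rw [← asy n1]; exact tr a w u)
      (by rw [← asy n3, ← asy n6, Bool.and_right_comm, Bool.and_comm (prc x y e w a)];
          rw [Bool.and_right_comm]; exact tr a u w)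
      (tr u v w)
      (by rw [← asy n4, ← asy n5, ← asy n6]; rw [Bool.and_right_comm];
          have := tr v u w; exact this)
    rw [← asy n1, ← asy n2, ← asy n3, eq h1, eq h2, eq h3, eq h4, eq h5, eq h6] at this
    simp at this

end MV

open MeasureTheory Real
namespace MV

/-- boolean e_ij -/
noncomputable def eij {ι : Type*} [DecidableEq ι] (x y : ι → ℝ) (e : ι → ℕ) (i j : ι) : Bool :=
  epb y i && !epb y j && prc x y e i j

noncomputable def xi {ι : Type*} [DecidableEq ι] (x y : ι → ℝ) (e : ι → ℕ) (i j : ι) : ℝ :=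
  ((eij x y e j i).toNat : ℝ) - ((eij x y e i j).toNat : ℝ)

theorem xi_bool : ∀ pij pjl pli ei ej el : Bool,
    (pij && pjl && pli) = false → (!pij && !pjl && !pli) = false →
    ((ej && !ei && !pij).toInt - (ei && !ej && pij).toInt) + ((el && !ej && !pjl).toInt - (ej && !el && pjl).toInt)
     + ((ei && !el && !pli).toInt - (el && !ei && pli).toInt) =
     ((pij == (ei == ej)) && (pjl == (ej == el)) && (pli == (el == ei))).toInt -
      (((!pjl) == (el == ej)) && ((!pij) == (ej == ei)) && ((!pli) == (ei == el))).toInt := by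
  intro pij pjl pli
  cases pij <;> cases pjl <;> cases pli <;> decide

theorem xi_ps {ι : Type*} [DecidableEq ι] (x y : ι → ℝ) {e : ι → ℕ} (he : Function.Injective e) (i j l : ι) :
    xi x y e i j + xi x y e j l + xi x y e l i = ps (ss x y e) i j l := by
  have asy : ∀ {i j}, i ≠ j → prc x y e j i = !prc x y e i j := fun h => prc_asy x y he h
  have hLT := ss_LT x y he
  have xs : ∀ i j, xi x y e i j = - xi x y e j i := by intro i j; unfold xi; ring
  have x0 : ∀ i, xi x y e i i = 0 := by intro i; unfold xi; ring
  by_cases h1 : i = j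
  · subst h1
    have : ps (ss x y e) i i l = 0 := by have := ps_swap' (ss x y e) l i i; rw [ps_rot, ps_rot]; linarith
    rw [this, x0, xs i l]; ring
  by_cases h2 : j = l
  · subst h2
    have : ps (ss x y e) i j j = 0 := by have := ps_swap' (ss x y e) i j j; linarith
    rw [this, x0, xs i j]; ring
  by_cases h3 : l = i
  · subst h3
    have : ps (ss x y e) l j l = 0 := by have := ps_swap (ss x y e) l j l; linarith
    rw [this, x0, xs l j]; ring
  have key := xi_bool (prc x y e i j) (prc x y e j l) (prc x y e l i) (epb y i) (epb y j) (epb y l)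
    (prc_tr x y e i j l) (by rw [← asy h1, ← asy h2, ← asy h3, Bool.and_right_comm]; exact prc_tr x y e j i l)
  rw [← asy h1, ← asy h2, ← asy h3] at key
  have h1' := Ne.symm h1
  have h2' := Ne.symm h2
  have h3' := Ne.symm h3
  have en : ∀ b : Bool, ((b.toInt : ℤ) : ℝ) = (b.toNat : ℝ) := by intro b; cases b <;> simp
  have key2 := congrArg (fun z : ℤ => (z : ℝ)) key
  simp only [Int.cast_add, Int.cast_sub, en] at key2
  unfold xi eij ps cr cy ss
  simp only [ne_eq, h1, h2, h3, h1', h2', h3', not_false_eq_true, decide_true, Bool.true_and]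
  exact key2

theorem F0_eq {ι : Type*} [Fintype ι] [DecidableEq ι] (x y : ι → ℝ) (e : ι → ℕ)
   (h0 : ∀ i, y i = 0 → x i = 0) : F0 x y = ∑ i, ∑ j, xi x y e i j * (x i * y j) := by
  have h1 : F0 x y = ∑ i, ∑ j, ((eij x y e i j).toNat : ℝ) * (x j * y i - x i * y j) := by
    unfold F0
    refine Finset.sum_congr rfl fun i _ => Finset.sum_congr rfl fun j _ => ?_
    unfold eij epb prc
    by_cases hi : 0 < y i
    · rcases lt_trichotomy (y j) 0 with hj | hj | hj
      · have hj2 : ¬ 0 < y j := by linarith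
        have t : x j / y j < x i / y i ↔ 0 < x j * y i - x i * y j := by
          rw [lt_div_iff₀ hi, div_mul_eq_mul_div, div_lt_iff_of_neg hj]
          constructor <;> intro h <;> linarith
        have t2 : x j / y j = x i / y i ↔ x j * y i - x i * y j = 0 := by
          rw [div_eq_div_iff hj.ne hi.ne']
          constructor <;> intro h <;> linarith
        simp only [t, t2]
        by_cases h : 0 < x j * y i - x i * y j
        · simp [hi, hj, hj2, h]
        · by_cases h' : x j * y i - x i * y j = 0
          · rw [h']; simp
          · simp [hi, hj, hj2, h, h']
      · rw [hj, h0 j hj]; simp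
      · have hj2 : ¬ y j < 0 := by linarith
        simp [hi, hj, hj2]
    · simp [hi]
  rw [h1]
  unfold xi
  simp only [sub_mul, mul_sub, Finset.sum_sub_distrib]
  congr 1
  rw [Finset.sum_comm]

theorem xKy {ι : Type*} [Fintype ι] [DecidableEq ι] (x y : ι → ℝ) {e : ι → ℕ} (he : Function.Injective e)
   (h0 : ∀ i, y i = 0 → x i = 0) (hx : ∑ i, x i = 0) (hy : ∑ i, y i = 0) :
   ∑ i, ∑ j, x i * KK (ss x y e) i j * y j = (Fintype.card ι : ℝ) * F0 x y := by
  rw [F0_eq x y e h0]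
  unfold KK
  have h1 : ∑ i, ∑ j, x i * (∑ k, ps (ss x y e) k i j) * y j =
     ∑ i, ∑ j, (∑ k, (xi x y e k i * x i * y j + xi x y e i j * (x i * y j) + xi x y e j k * y j * x i)) := by
    refine Finset.sum_congr rfl fun i _ => Finset.sum_congr rfl fun j _ => ?_
    rw [Finset.mul_sum, Finset.sum_mul]
    refine Finset.sum_congr rfl fun k _ => ?_
    rw [← xi_ps x y he]; ring
  rw [h1]
  simp only [Finset.sum_add_distrib]
  have z1 : ∑ i, ∑ j, ∑ k, xi x y e k i * x i * y j = 0 := by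
    refine Finset.sum_eq_zero fun i _ => ?_
    rw [Finset.sum_comm]
    refine Finset.sum_eq_zero fun k _ => ?_
    rw [← Finset.mul_sum, hy, mul_zero]
  have z2 : ∑ i, ∑ j, ∑ k, xi x y e j k * y j * x i = 0 := by
    rw [Finset.sum_comm]
    refine Finset.sum_eq_zero fun j _ => ?_
    rw [Finset.sum_comm]
    refine Finset.sum_eq_zero fun k _ => ?_
    rw [← Finset.mul_sum, hx, mul_zero]
  rw [z1, z2]
  simp only [Finset.sum_const, Finset.card_univ, nsmul_eq_mul, zero_add, add_zero, Finset.mul_sum]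

/-- three class case -/
theorem caseC {ι : Type*} [Fintype ι] [DecidableEq ι] {s : ι → ι → Bool} (hs : LT s) {i j l : ι}
    (hc : cy s i j l = true)
    (hn : ∀ u v, pent s v i j l u = false ∧ pent s v j l i u = false ∧ pent s v l i j u = false)
    (x y : ι → ℝ) (hx : ∑ i, x i = 0) (hy : ∑ i, y i = 0) :
    ∑ a, ∑ b, x a * KK s a b * y b = (Fintype.card ι : ℝ) *
      ((∑ a, cr s a j l * x a) * (∑ a, cr s i a l * y a) - (∑ a, cr s i a l * x a) * (∑ a, cr s a j l * y a)) := by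
  have hcr : cr s i j l = 1 := cr_one.2 hc
  have rp := fun x => cr_repl hs x hcr
  set A : ι → ℝ := fun a => cr s a j l with hA
  set B : ι → ℝ := fun a => cr s i a l with hB
  set C : ι → ℝ := fun a => cr s i j a with hC
  have e : ∀ x y z, ps s x y z = (A x * B y * C z + A y * B z * C x + A z * B x * C y) -
      (A z * B y * C x + A y * B x * C z + A x * B z * C y) := by
    have f : ∀ x y z, cr s x y z = A x * B y * C z + A y * B z * C x + A z * B x * C y := by
      intro x y z
      have h1 := no_pent hs x y z hc hn
      have r1 := repl hs x hc
      have r2 := repl hs y hc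
      have r3 := repl hs z hc
      simp only [hA, hB, hC, cr, h1]
      revert r1 r2 r3
      cases cy s x j l <;> cases cy s i x l <;> cases cy s i j x <;>
      cases cy s y j l <;> cases cy s i y l <;> cases cy s i j y <;>
      cases cy s z j l <;> cases cy s i z l <;> cases cy s i j z <;> simp
    intro x y z
    rw [ps, f, f z y x]
  have n : (Fintype.card ι : ℝ) = ∑ a, A a + ∑ a, B a + ∑ a, C a := by
    rw [← Finset.sum_add_distrib, ← Finset.sum_add_distrib, Finset.sum_congr rfl fun x _ => rp x]; simp
  have sx : ∀ w : ι → ℝ, ∑ i, w i = 0 → ∑ a, C a * w a = - (∑ a, A a * w a) - (∑ a, B a * w a) := by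
    intro w hw
    have : ∑ a, A a * w a + ∑ a, B a * w a + ∑ a, C a * w a = 0 := by
      rw [← hw, ← Finset.sum_add_distrib, ← Finset.sum_add_distrib]
      refine Finset.sum_congr rfl fun a _ => ?_
      have := rp a
      linear_combination (w a) * this
    linarith
  have hxC := sx x hx
  have hyC := sx y hy
  have main : ∑ a, ∑ b, x a * KK s a b * y b =
     (∑ k, A k) * ((∑ a, B a * x a) * (∑ a, C a * y a) - (∑ a, C a * x a) * (∑ a, B a * y a)) +
     (∑ k, B k) * ((∑ a, C a * x a) * (∑ a, A a * y a) - (∑ a, A a * x a) * (∑ a, C a * y a)) +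
     (∑ k, C k) * ((∑ a, A a * x a) * (∑ a, B a * y a) - (∑ a, B a * x a) * (∑ a, A a * y a)) := by
    have : ∀ P Q R : ι → ℝ, (∑ k, P k) * ((∑ a, Q a * x a) * (∑ a, R a * y a)) =
        ∑ a, ∑ b, ∑ k, P k * ((Q a * x a) * (R b * y b)) := by
      intro P Q R
      rw [Finset.sum_mul_sum, Finset.mul_sum]
      refine Finset.sum_congr rfl fun a _ => ?_
      rw [Finset.mul_sum]
      refine Finset.sum_congr rfl fun b _ => ?_
      rw [Finset.sum_mul]
    simp only [mul_sub, this]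
    simp only [← Finset.sum_add_distrib, ← Finset.sum_sub_distrib]
    refine Finset.sum_congr rfl fun a _ => Finset.sum_congr rfl fun b _ => ?_
    unfold KK
    rw [Finset.mul_sum, Finset.sum_mul]
    refine Finset.sum_congr rfl fun k _ => ?_
    rw [e]; ring
  rw [main, n, hxC, hyC]
  ring

end MV

open MeasureTheory Real
namespace MV

/-- the function x log(1+1/x) -/
noncomputable def hh (x : ℝ) : ℝ := x * (Real.log (x + 1) - Real.log x)

theorem hh_conv {κ : ℝ} (hκ : 0 < κ) :
    ConvexOn ℝ (Set.Ici κ) (fun x => hh x + 1 / (κ * (κ + 1) ^ 2) / 2 * x ^ 2) := by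
  set c : ℝ := 1 / (κ * (κ + 1) ^ 2) with hc
  have d1 : ∀ x : ℝ, 0 < x → HasDerivAt (fun x => hh x + c / 2 * x ^ 2)
      ((Real.log (x + 1) - Real.log x) - 1 / (x + 1) + c * x) x := by
    intro x hx
    have e1 : HasDerivAt (fun x : ℝ => Real.log (x + 1)) (1 / (x + 1)) x :=
      ((hasDerivAt_id x).add_const 1).log (by positivity)
    have e2 : HasDerivAt (fun x : ℝ => Real.log x) (x⁻¹) x := Real.hasDerivAt_log hx.ne'
    have e3 := (hasDerivAt_id x).mul (e1.sub e2)
    have e4 := ((hasDerivAt_id x).pow 2).const_mul (c / 2)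
    have e5 := e3.add e4
    refine e5.congr_deriv ?_
    simp only [id, Pi.sub_apply]
    field_simp
    ring
  have d2 : ∀ x : ℝ, 0 < x → HasDerivAt (fun x => (Real.log (x + 1) - Real.log x) - 1 / (x + 1) + c * x)
      (c - 1 / (x * (x + 1) ^ 2)) x := by
    intro x hx
    have e1 : HasDerivAt (fun x : ℝ => Real.log (x + 1)) (1 / (x + 1)) x :=
      ((hasDerivAt_id x).add_const 1).log (by positivity)
    have e2 : HasDerivAt (fun x : ℝ => Real.log x) (x⁻¹) x := Real.hasDerivAt_log hx.ne'
    have e3 : HasDerivAt (fun x : ℝ => 1 / (x + 1)) (-1 / (x + 1) ^ 2) x := by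
      have := ((hasDerivAt_id x).add_const 1).inv (by simp only [id]; positivity)
      have h2 : (fun x : ℝ => 1 / (x + 1)) = (fun x : ℝ => id x + 1)⁻¹ := by
        funext z; simp
      rw [h2]; exact this
    have e4 := ((e1.sub e2).sub e3).add ((hasDerivAt_id x).const_mul c)
    refine e4.congr_deriv ?_
    field_simp
    ring
  apply convexOn_of_hasDerivWithinAt2_nonneg (convex_Ici κ)
    (f' := fun x => (Real.log (x + 1) - Real.log x) - 1 / (x + 1) + c * x)
    (f'' := fun x => c - 1 / (x * (x + 1) ^ 2))
  · intro x hx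
    exact (d1 x (lt_of_lt_of_le hκ hx)).continuousAt.continuousWithinAt
  · intro x hx
    rw [interior_Ici] at hx ⊢
    exact (d1 x (hκ.trans hx)).hasDerivWithinAt
  · intro x hx
    rw [interior_Ici] at hx ⊢
    exact (d2 x (hκ.trans hx)).hasDerivWithinAt
  · intro x hx
    rw [interior_Ici] at hx
    have hx' : κ < x := hx
    have hx0 : 0 < x := hκ.trans hx'
    rw [sub_nonneg, hc]
    gcongr

theorem hh_gap {κ u v w : ℝ} (hκ : 0 < κ) (hu : κ ≤ u) (hv : κ ≤ v) (hw : κ ≤ w) :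
    3 * hh ((u + v + w) / 3) ≤ hh u + hh v + hh w +
      1 / (κ * (κ + 1) ^ 2) / 2 * (u ^ 2 + v ^ 2 + w ^ 2 - 3 * ((u + v + w) / 3) ^ 2) := by
  have hc := hh_conv hκ
  have h1 := hc.2 hu hv (show (0:ℝ) ≤ 1 / 2 by norm_num) (show (0:ℝ) ≤ 1 / 2 by norm_num) (by norm_num)
  have hm : (u + v) / 2 ∈ Set.Ici κ := by simp only [Set.mem_Ici]; linarith
  have h2 := hc.2 hm hw (show (0:ℝ) ≤ 2 / 3 by norm_num) (show (0:ℝ) ≤ 1 / 3 by norm_num) (by norm_num)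
  simp only [smul_eq_mul] at h1 h2
  rw [show (1:ℝ) / 2 * u + 1 / 2 * v = (u + v) / 2 by ring] at h1
  rw [show (2:ℝ) / 3 * ((u + v) / 2) + 1 / 3 * w = (u + v + w) / 3 by ring] at h2
  linarith

theorem hh_pow {k : ℕ} (hk : 0 < k) : Real.exp (hh k) = (((k:ℝ) + 1) / k) ^ k := by
  have hk' : (0:ℝ) < k := by exact_mod_cast hk
  unfold hh
  rw [← Real.log_div (by positivity) (by positivity), mul_comm, Real.exp_mul, Real.exp_log (by positivity),
    Real.rpow_natCast]

theorem hh_pow3 {d : ℕ} (hd : 0 < d) : Real.exp (3 * hh ((d:ℝ) / 3)) = (((d:ℝ) + 3) / d) ^ d := by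
  have hk' : (0:ℝ) < d := by exact_mod_cast hd
  unfold hh
  rw [← Real.log_div (by positivity) (by positivity), ← mul_assoc, mul_comm, Real.exp_mul, Real.exp_log (by positivity),
    show 3 * ((d:ℝ) / 3) = d by ring, Real.rpow_natCast]
  congr 1
  field_simp

/-- general ratio bound -/
theorem ratio_bound {d k1 k2 k3 κ : ℕ} (hκ : 0 < κ) (h1 : κ ≤ k1) (h2 : κ ≤ k2) (h3 : κ ≤ k3) (hd : k1 + k2 + k3 = d)
    {M δ : ℝ} (hM : 0 < M) (hδ : δ < M)
    (hq : 1 / ((κ:ℝ) * ((κ:ℝ) + 1) ^ 2) / 2 * ((k1:ℝ) ^ 2 + (k2:ℝ) ^ 2 + (k3:ℝ) ^ 2 - 3 * ((d:ℝ) / 3) ^ 2) ≤ δ / M) :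
    (M - δ) * (((d:ℝ) + 3) / d) ^ d ≤ M * ((((k1:ℝ) + 1) / k1) ^ k1 * (((k2:ℝ) + 1) / k2) ^ k2 * (((k3:ℝ) + 1) / k3) ^ k3) := by
  have hd0 : 0 < d := by omega
  rw [← hh_pow3 hd0, ← hh_pow (by omega : 0 < k1), ← hh_pow (by omega : 0 < k2), ← hh_pow (by omega : 0 < k3),
    ← Real.exp_add, ← Real.exp_add]
  have g := hh_gap (κ := (κ:ℝ)) (u := k1) (v := k2) (w := k3) (by exact_mod_cast hκ)
    (by exact_mod_cast h1) (by exact_mod_cast h2) (by exact_mod_cast h3)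
  have hdr : (k1:ℝ) + k2 + k3 = d := by exact_mod_cast hd
  rw [hdr] at g
  have g2 : 3 * hh ((d:ℝ) / 3) ≤ (hh k1 + hh k2 + hh k3) + δ / M := by linarith
  have g3 := Real.exp_le_exp.2 g2
  rw [Real.exp_add] at g3
  have g4 : (1 - δ / M) * Real.exp (δ / M) ≤ 1 := by
    have := Real.add_one_le_exp (-(δ / M))
    have e : Real.exp (-(δ/M)) * Real.exp (δ / M) = 1 := by rw [← Real.exp_add]; simp
    nlinarith [Real.exp_pos (δ / M)]
  have h5 : M - δ = M * (1 - δ / M) := by field_simp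
  have h6 : 0 ≤ 1 - δ / M := by rw [sub_nonneg, div_le_one hM]; exact hδ.le
  rw [h5, mul_assoc]
  refine mul_le_mul_of_nonneg_left ?_ hM.le
  calc _ ≤ (1 - δ / M) * (Real.exp (hh k1 + hh k2 + hh k3) * Real.exp (δ / M)) := mul_le_mul_of_nonneg_left g3 h6
    _ = ((1 - δ / M) * Real.exp (δ / M)) * Real.exp (hh k1 + hh k2 + hh k3) := by ring
    _ ≤ 1 * Real.exp (hh k1 + hh k2 + hh k3) := mul_le_mul_of_nonneg_right g4 (Real.exp_pos _).le
    _ = _ := one_mul _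

/-- squared target -/
noncomputable def B2 (k1 k2 k3 : ℕ) : ℝ :=
  (((k1:ℝ) + 1) ^ (k1 + 1) / (k1:ℝ) ^ k1) * (((k2:ℝ) + 1) ^ (k2 + 1) / (k2:ℝ) ^ k2) * (((k3:ℝ) + 1) ^ (k3 + 1) / (k3:ℝ) ^ k3)

theorem B2_eq (k1 k2 k3 : ℕ) : B2 k1 k2 k3 = (((k1:ℝ) + 1) * ((k2:ℝ) + 1) * ((k3:ℝ) + 1)) *
   ((((k1:ℝ) + 1) / k1) ^ k1 * (((k2:ℝ) + 1) / k2) ^ k2 * (((k3:ℝ) + 1) / k3) ^ k3) := by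
  unfold B2
  simp only [div_pow, pow_succ]
  ring

theorem ana0 (k : ℕ) (hk : 0 < k) : ((k:ℝ) + 1) ^ 3 * ((((3 * k : ℕ):ℝ) + 3) / ((3 * k : ℕ):ℝ)) ^ (3 * k) = B2 k k k := by
  have hk' : (0:ℝ) < k := by exact_mod_cast hk
  rw [B2_eq]
  have : (((3 * k : ℕ):ℝ) + 3) / ((3 * k : ℕ):ℝ) = ((k:ℝ) + 1) / k := by
    push_cast; field_simp
  rw [this, mul_comm 3 k, pow_mul]
  ring

/-- n = 3m+1 with m = p+3 -/
theorem ana1 (m : ℕ) (hm : m = 3 ∨ 5 ≤ m) : ((m:ℝ) ^ 2 * (m + 1) - 1 / 2) * ((((3 * m - 2 : ℕ):ℝ) + 3) / ((3 * m - 2 : ℕ):ℝ)) ^ (3 * m - 2)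
    ≤ B2 (m - 1) (m - 1) m := by
  rw [B2_eq]
  rcases hm with rfl | hm
  · norm_num
  · obtain ⟨p, rfl⟩ : ∃ p, m = p + 5 := ⟨m - 5, by omega⟩
    have := ratio_bound (d := 3 * (p + 5) - 2) (k1 := p + 5 - 1) (k2 := p + 5 - 1) (k3 := p + 5) (κ := p + 4) (by omega) (by omega)
      (by omega) (by omega) (by omega) (M := (((p + 5 : ℕ):ℝ)) ^ 2 * (((p + 5 : ℕ):ℝ) + 1)) (δ := 1 / 2) (by positivity)
      (by push_cast; nlinarith [show (0:ℝ) ≤ (p:ℝ) by positivity, show (0:ℝ) ≤ (p:ℝ) ^ 3 by positivity]) (by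
        rw [show p + 5 - 1 = p + 4 by omega, show 3 * (p + 5) - 2 = 3 * p + 13 by omega]
        push_cast
        rw [div_div, div_mul_eq_mul_div, div_le_div_iff₀ (by positivity) (by positivity)]
        ring_nf
        nlinarith [show (0:ℝ) ≤ (p:ℝ) by positivity, show (0:ℝ) ≤ (p:ℝ) ^ 2 by positivity, show (0:ℝ) ≤ (p:ℝ) ^ 3 by positivity, show (0:ℝ) ≤ (p:ℝ) ^ 4 by positivity])
    refine this.trans (le_of_eq ?_)
    congr 1
    rw [show p + 5 - 1 = p + 4 by omega]
    push_cast; ring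

theorem ana2 (m : ℕ) (hm : m = 2 ∨ m = 4 ∨ 6 ≤ m) :
    ((m:ℝ) * (m + 1) ^ 2 - m / (2 * m - 1)) * ((((3 * m - 1 : ℕ):ℝ) + 3) / ((3 * m - 1 : ℕ):ℝ)) ^ (3 * m - 1)
    ≤ B2 (m - 1) m m := by
  rw [B2_eq]
  rcases hm with rfl | rfl | hm
  · norm_num
  · norm_num
  · obtain ⟨p, rfl⟩ : ∃ p, m = p + 6 := ⟨m - 6, by omega⟩
    have hp : (0:ℝ) ≤ (p:ℝ) := by positivity
    have hden : (0:ℝ) < 2 * ((p + 6 : ℕ):ℝ) - 1 := by push_cast; linarith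
    have := ratio_bound (d := 3 * (p + 6) - 1) (k1 := p + 6 - 1) (k2 := p + 6) (k3 := p + 6) (κ := p + 5) (by omega) (by omega)
      (by omega) (by omega) (by omega) (M := (((p + 6 : ℕ):ℝ)) * (((p + 6 : ℕ):ℝ) + 1) ^ 2)
      (δ := ((p + 6 : ℕ):ℝ) / (2 * ((p + 6 : ℕ):ℝ) - 1)) (by positivity)
      (by
        rw [div_lt_iff₀ hden, mul_assoc]
        refine lt_mul_of_one_lt_right (by positivity) ?_
        push_cast; nlinarith [show (0:ℝ) ≤ (p:ℝ) ^ 3 by positivity]) (by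
        rw [show p + 6 - 1 = p + 5 by omega, show 3 * (p + 6) - 1 = 3 * p + 17 by omega]
        rw [div_div, div_mul_eq_mul_div, div_div, div_le_div_iff₀ (by positivity) (by positivity)]
        push_cast
        ring_nf
        nlinarith [show (0:ℝ) ≤ (p:ℝ) by positivity, show (0:ℝ) ≤ (p:ℝ) ^ 2 by positivity, show (0:ℝ) ≤ (p:ℝ) ^ 3 by positivity, show (0:ℝ) ≤ (p:ℝ) ^ 4 by positivity, show (0:ℝ) ≤ (p:ℝ) ^ 5 by positivity])
    refine this.trans (le_of_eq ?_)
    congr 1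
    rw [show p + 6 - 1 = p + 5 by omega]
    push_cast; ring

end MV

open MeasureTheory Real
namespace MV

theorem det_amgm {n : Type*} [Fintype n] [DecidableEq n] [Nonempty n] (X : Matrix n n ℝ) :
    X.det ^ 2 ≤ ((∑ i, ∑ j, X i j ^ 2) / (Fintype.card n : ℝ)) ^ Fintype.card n := by
  have hps : (X * X.conjTranspose).PosSemidef := Matrix.posSemidef_self_mul_conjTranspose X
  have h1 : (X * X.conjTranspose).det = X.det ^ 2 := by
    rw [Matrix.det_mul, Matrix.det_conjTranspose]; simp [sq]
  have h2 : (X * X.conjTranspose).trace = ∑ i, ∑ j, X i j ^ 2 := by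
    simp [Matrix.trace, Matrix.mul_apply, sq]
  have h3 := hps.isHermitian.det_eq_prod_eigenvalues
  have h4 := hps.isHermitian.trace_eq_sum_eigenvalues
  simp only [RCLike.ofReal_real_eq_id, id] at h3 h4
  rw [← h1, ← h2, h3, h4]
  have hn : (0:ℝ) < Fintype.card n := by exact_mod_cast Fintype.card_pos
  have hz := hps.eigenvalues_nonneg
  have g := Real.geom_mean_le_arith_mean Finset.univ (fun _ => (1:ℝ)) hps.isHermitian.eigenvalues
    (fun _ _ => zero_le_one) (by simpa using hn) (fun i _ => hz i)
  simp only [Real.rpow_one, one_mul, Finset.sum_const, Finset.card_univ, nsmul_eq_mul, mul_one] at g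
  have hp : 0 ≤ ∏ i, hps.isHermitian.eigenvalues i := Finset.prod_nonneg fun i _ => hz i
  have g2 := pow_le_pow_left₀ (Real.rpow_nonneg hp _) g (Fintype.card n)
  rwa [← Real.rpow_natCast, ← Real.rpow_mul hp, inv_mul_cancel₀ hn.ne', Real.rpow_one] at g2

/-- matrix with columns (p k, f 0 k, f 1 k, f 2 k) -/
def Mt {d : ℕ} {ι : Type*} (p : ι → Fin d → ℝ) (f : Fin 3 → ι → ℝ) : Matrix (Fin d ⊕ Fin 3) ι ℝ :=
  fun r k => Sum.elim (fun a => p k a) (fun t => f t k) r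

theorem det_pair {d : ℕ} (p : (Fin d ⊕ Fin 3) → Fin d → ℝ) (x y r1 r2 : (Fin d ⊕ Fin 3) → ℝ)
    (px : ∀ a, ∑ k, p k a * x k = 0) (py : ∀ a, ∑ k, p k a * y k = 0)
    (hx : ∑ k, x k = 0) (hy : ∑ k, y k = 0) (xx : ∑ k, x k * x k = 1) (yy : ∑ k, y k * y k = 1)
    (xy : ∑ k, x k * y k = 0) :
    (Mt p ![1, r1, r2]).det * (Mt p ![1, x, y]).det = (Mt p ![1, x, y]).det ^ 2 *
      ((∑ k, r1 k * x k) * (∑ k, r2 k * y k) - (∑ k, r1 k * y k) * (∑ k, r2 k * x k)) := by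
  set M := Mt p ![1, x, y] with hM
  set R := Mt p ![1, r1, r2] with hR
  by_cases hD : M.det = 0
  · rw [hD]; ring
  have hu : IsUnit M.det := isUnit_iff_ne_zero.2 hD
  set T := R * M⁻¹ with hT
  have hTM : T * M = R := by rw [hT, Matrix.mul_assoc, Matrix.nonsing_inv_mul _ hu, Matrix.mul_one]
  have top : ∀ r, R r = M r → ∀ k, T r k = (1 : Matrix _ _ ℝ) r k := by
    intro r hr k
    rw [← Matrix.mul_nonsing_inv _ hu, hT, Matrix.mul_apply, Matrix.mul_apply, hr]
  have ml : ∀ a k, M (Sum.inl a) k = p k a := fun a k => rfl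
  have m0 : ∀ k, M (Sum.inr 0) k = 1 := fun k => rfl
  have m1 : ∀ k, M (Sum.inr 1) k = x k := fun k => rfl
  have m2 : ∀ k, M (Sum.inr 2) k = y k := fun k => rfl
  have cx : ∀ s, T s (Sum.inr 1) = ∑ k, R s k * x k := by
    intro s
    have h : ∑ k, R s k * x k = ∑ r, T s r * ∑ k, M r k * x k := by
      rw [← hTM]
      simp only [Matrix.mul_apply, Finset.sum_mul, Finset.mul_sum]
      rw [Finset.sum_comm]
      simp only [mul_assoc]
    rw [h]
    rw [Fintype.sum_sum_type, Fin.sum_univ_three]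
    have yx : ∑ k, y k * x k = 0 := by rw [← xy]; exact Finset.sum_congr rfl fun k _ => mul_comm _ _
    simp only [m0, m1, m2, ml, px, one_mul, hx, xx, yx]
    simp
  have cy : ∀ s, T s (Sum.inr 2) = ∑ k, R s k * y k := by
    intro s
    have h : ∑ k, R s k * y k = ∑ r, T s r * ∑ k, M r k * y k := by
      rw [← hTM]
      simp only [Matrix.mul_apply, Finset.sum_mul, Finset.mul_sum]
      rw [Finset.sum_comm]
      simp only [mul_assoc]
    rw [h]
    rw [Fintype.sum_sum_type, Fin.sum_univ_three]
    simp only [m0, m1, m2, ml, py, one_mul, hy, yy, xy]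
    simp
  have tl : ∀ a, R (Sum.inl a) = M (Sum.inl a) := fun a => rfl
  have t0 : R (Sum.inr 0) = M (Sum.inr 0) := rfl
  have hblk : T = Matrix.fromBlocks 1 0 (Matrix.of fun s a => T (Sum.inr s) (Sum.inl a))
      (Matrix.of fun s t => T (Sum.inr s) (Sum.inr t)) := by
    ext r k
    rcases r with r | r <;> rcases k with k | k
    · rw [top _ (tl r)]; simp [Matrix.one_apply]
    · rw [top _ (tl r)]; simp
    · simp
    · simp
  have hdT : T.det = ((∑ k, r1 k * x k) * (∑ k, r2 k * y k) - (∑ k, r1 k * y k) * (∑ k, r2 k * x k)) := by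
    rw [hblk, Matrix.det_fromBlocks_zero₁₂, Matrix.det_one, one_mul, Matrix.det_fin_three]
    simp only [Matrix.of_apply]
    rw [top _ t0, top _ t0, top _ t0]
    simp only [cx, cy]
    simp [hR, Mt]
  rw [← hTM, Matrix.det_mul, hdT]
  ring

theorem wdet {d : ℕ} (p : (Fin d ⊕ Fin 3) → Fin d → ℝ) (hp : ∀ k, ∑ a, p k a ^ 2 = 1) (f : Fin 3 → (Fin d ⊕ Fin 3) → ℝ)
    (w : (Fin d ⊕ Fin 3) → ℝ) (hw : ∀ k, 0 ≤ w k) (β : Fin 3 → ℝ) (hβ : ∀ t, 0 ≤ β t) :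
    (Mt p f).det ^ 2 * (∏ k, w k) * (∏ t, β t) ≤
      ((∑ k, w k + ∑ t, β t * ∑ k, w k * f t k ^ 2) / ((d:ℝ) + 3)) ^ (d + 3) := by
  set X : Matrix (Fin d ⊕ Fin 3) (Fin d ⊕ Fin 3) ℝ :=
    Matrix.diagonal (Sum.elim (fun _ => 1) (fun t => √(β t))) * Mt p f * Matrix.diagonal (fun k => √(w k)) with hX
  have h := det_amgm X
  have hc : Fintype.card (Fin d ⊕ Fin 3) = d + 3 := by simp
  rw [hc] at h
  have h1 : X.det ^ 2 = (Mt p f).det ^ 2 * (∏ k, w k) * (∏ t, β t) := by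
    rw [hX, Matrix.det_mul, Matrix.det_mul, Matrix.det_diagonal, Matrix.det_diagonal, mul_pow, mul_pow,
      ← Finset.prod_pow, ← Finset.prod_pow]
    simp only [Real.sq_sqrt (hw _)]
    rw [Fintype.prod_sum_type]
    simp only [Sum.elim_inl, Sum.elim_inr, Real.sq_sqrt (hβ _)]
    simp; ring
  have h2 : ∑ i, ∑ j, X i j ^ 2 = ∑ k, w k + ∑ t, β t * ∑ k, w k * f t k ^ 2 := by
    rw [Fintype.sum_sum_type]
    congr 1
    · rw [Finset.sum_comm]
      refine Finset.sum_congr rfl fun k _ => ?_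
      have : ∀ a, X (Sum.inl a) k ^ 2 = p k a ^ 2 * w k := by
        intro a
        rw [hX, Matrix.mul_diagonal, Matrix.diagonal_mul, mul_pow, Real.sq_sqrt (hw k)]
        simp [Mt]
      simp only [this]
      rw [← Finset.sum_mul, hp, one_mul]
    · refine Finset.sum_congr rfl fun t _ => ?_
      rw [Finset.mul_sum]
      refine Finset.sum_congr rfl fun k _ => ?_
      rw [hX, Matrix.mul_diagonal, Matrix.diagonal_mul, mul_pow, Real.sq_sqrt (hw k), mul_pow]
      simp only [Sum.elim_inr, Real.sq_sqrt (hβ _), Mt]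
      ring
  rw [h1, h2] at h
  push_cast at h
  exact h

theorem D_bound {d : ℕ} (hd : 0 < d) (p : (Fin d ⊕ Fin 3) → Fin d → ℝ) (hp : ∀ k, ∑ a, p k a ^ 2 = 1) (x y : (Fin d ⊕ Fin 3) → ℝ)
    (xx : ∑ k, x k * x k = 1) (yy : ∑ k, y k * y k = 1) :
    (Mt p ![1, x, y]).det ^ 2 ≤ ((d:ℝ) + 3) * (((d:ℝ) + 3) / d) ^ d := by
  have hd' : (0:ℝ) < d := by exact_mod_cast hd
  have h := wdet p hp ![1, x, y] (fun _ => 1) (fun _ => zero_le_one) ![1 / d, (d + 3) / d, (d + 3) / d]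
    (by intro t; fin_cases t <;> simp <;> positivity)
  have e : (∑ k : Fin d ⊕ Fin 3, (1:ℝ)) = d + 3 := by simp
  simp only [Fin.sum_univ_three, Fin.prod_univ_three, Finset.prod_const_one, mul_one, one_mul] at h
  simp only [Matrix.cons_val, Pi.one_apply, one_pow, e] at h
  simp only [sq (x _), sq (y _), xx, yy, mul_one] at h
  have e2 : ((d:ℝ) + 3 + (1 / d * (d + 3) + (d + 3) / d + (d + 3) / d)) / (d + 3) = (d + 3) / d := by
    field_simp; ring
  rw [e2] at h
  rw [pow_add] at h
  have e3 : ((1:ℝ) / d * ((d + 3) / d) * ((d + 3) / d)) * ((d + 3) * ((d + 3) / d) ^ d) = ((d + 3) / d) ^ d * ((d + 3) / d) ^ 3 := by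
    field_simp
  rw [← e3, mul_comm] at h
  exact le_of_mul_le_mul_left h (by positivity)

theorem class_bound {d : ℕ} (p : (Fin d ⊕ Fin 3) → Fin d → ℝ) (hp : ∀ k, ∑ a, p k a ^ 2 = 1)
    (A B C : (Fin d ⊕ Fin 3) → ℝ) (hA : ∀ a, A a = 0 ∨ A a = 1) (hB : ∀ a, B a = 0 ∨ B a = 1) (hC : ∀ a, C a = 0 ∨ C a = 1)
    (h1 : ∀ a, A a + B a + C a = 1) {k1 k2 k3 : ℕ} (hk1 : 0 < k1) (hk2 : 0 < k2) (hk3 : 0 < k3)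
    (sA : ∑ a, A a = k1 + 1) (sB : ∑ a, B a = k2 + 1) (sC : ∑ a, C a = k3 + 1) :
    (Mt p ![1, A, B]).det ^ 2 ≤ B2 k1 k2 k3 := by
  have p1 : (0:ℝ) < k1 := by exact_mod_cast hk1
  have p2 : (0:ℝ) < k2 := by exact_mod_cast hk2
  have p3 : (0:ℝ) < k3 := by exact_mod_cast hk3
  have hdk : (d:ℝ) + 3 = k1 + k2 + k3 + 3 := by
    have : ∑ a, (A a + B a + C a) = d + 3 := by simp only [h1]; simp
    rw [Finset.sum_add_distrib, Finset.sum_add_distrib, sA, sB, sC] at this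
    linarith
  set w : (Fin d ⊕ Fin 3) → ℝ := fun a => A a * (k1 / (k1 + 1)) + B a * (k2 / (k2 + 1)) + C a * (k3 / (k3 + 1)) with hw
  have A0 : ∀ a, 0 ≤ A a := fun a => by rcases hA a with h | h <;> rw [h] <;> norm_num
  have B0 : ∀ a, 0 ≤ B a := fun a => by rcases hB a with h | h <;> rw [h] <;> norm_num
  have C0 : ∀ a, 0 ≤ C a := fun a => by rcases hC a with h | h <;> rw [h] <;> norm_num
  have h := wdet p hp ![C, A, B] w (fun a => by
      have := A0 a; have := B0 a; have := C0 a
      simp only [hw]; positivity) ![1 / k3, 1 / k1, 1 / k2] (by intro t; fin_cases t <;> simp)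
  have cases : ∀ a, (A a = 1 ∧ B a = 0 ∧ C a = 0) ∨ (A a = 0 ∧ B a = 1 ∧ C a = 0) ∨ (A a = 0 ∧ B a = 0 ∧ C a = 1) := by
    intro a
    have := h1 a
    rcases hA a with hA | hA <;> rcases hB a with hB | hB <;> rcases hC a with hC | hC <;>
      rw [hA, hB, hC] at this <;> norm_num at this <;> simp [hA, hB, hC]
  have sw : ∑ a, w a = k1 + k2 + k3 := by
    simp only [hw, Finset.sum_add_distrib, ← Finset.sum_mul, sA, sB, sC]
    field_simp
  have wA : ∑ a, w a * A a ^ 2 = k1 := by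
    have : ∀ a, w a * A a ^ 2 = A a * (k1 / (k1 + 1)) := by
      intro a; simp only [hw]; rcases cases a with ⟨h, h', h''⟩ | ⟨h, h', h''⟩ | ⟨h, h', h''⟩ <;> rw [h, h', h''] <;> ring
    simp only [this, ← Finset.sum_mul, sA]; field_simp
  have wB : ∑ a, w a * B a ^ 2 = k2 := by
    have : ∀ a, w a * B a ^ 2 = B a * (k2 / (k2 + 1)) := by
      intro a; simp only [hw]; rcases cases a with ⟨h, h', h''⟩ | ⟨h, h', h''⟩ | ⟨h, h', h''⟩ <;> rw [h, h', h''] <;> ring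
    simp only [this, ← Finset.sum_mul, sB]; field_simp
  have wC : ∑ a, w a * C a ^ 2 = k3 := by
    have : ∀ a, w a * C a ^ 2 = C a * (k3 / (k3 + 1)) := by
      intro a; simp only [hw]; rcases cases a with ⟨h, h', h''⟩ | ⟨h, h', h''⟩ | ⟨h, h', h''⟩ <;> rw [h, h', h''] <;> ring
    simp only [this, ← Finset.sum_mul, sC]; field_simp
  have pk : ∀ (F : (Fin d ⊕ Fin 3) → ℝ) (k : ℕ) (c : ℝ), (∀ a, F a = 0 ∨ F a = 1) → ∑ a, F a = k + 1 →
      ∏ a, (if F a = 1 then c else 1) = c ^ (k + 1) := by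
    intro F k c hF hs
    rw [Finset.prod_ite, Finset.prod_const, Finset.prod_const_one, mul_one]
    congr 1
    have : ∑ a, F a = ((Finset.univ.filter fun a => F a = 1).card : ℝ) := by
      rw [Finset.card_filter]; push_cast
      refine Finset.sum_congr rfl fun a _ => ?_
      rcases hF a with h | h <;> rw [h] <;> simp
    rw [this] at hs
    exact_mod_cast hs
  have pw : ∏ a, w a = (k1 / (k1 + 1) : ℝ) ^ (k1 + 1) * (k2 / (k2 + 1) : ℝ) ^ (k2 + 1) * (k3 / (k3 + 1) : ℝ) ^ (k3 + 1) := by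
    rw [← pk A k1 _ hA sA, ← pk B k2 _ hB sB, ← pk C k3 _ hC sC, ← Finset.prod_mul_distrib, ← Finset.prod_mul_distrib]
    refine Finset.prod_congr rfl fun a _ => ?_
    simp only [hw]; rcases cases a with ⟨h, h', h''⟩ | ⟨h, h', h''⟩ | ⟨h, h', h''⟩ <;> rw [h, h', h''] <;> simp
  have hdet : (Mt p ![1, A, B]).det = (Mt p ![C, A, B]).det := by
    have : Mt p ![1, A, B] = Matrix.fromBlocks 1 0 0 !![1, 1, 1; 0, 1, 0; 0, 0, 1] * Mt p ![C, A, B] := by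
      ext r k
      rw [Matrix.mul_apply, Fintype.sum_sum_type]
      rcases r with r | r
      · simp [Mt, Matrix.one_apply]
      · have := h1 k
        fin_cases r <;> simp [Mt, Fin.sum_univ_three]
        linarith
    rw [this, Matrix.det_mul, Matrix.det_fromBlocks_zero₁₂]
    simp [Matrix.det_fin_three]
  rw [← hdet, pw] at h
  simp only [Fin.sum_univ_three, Fin.prod_univ_three] at h
  simp only [Matrix.cons_val, wA, wB, wC, sw, hdk] at h
  have e2 : ((k1:ℝ) + k2 + k3 + (1 / k3 * k3 + 1 / k1 * k1 + 1 / k2 * k2)) / (k1 + k2 + k3 + 3) = 1 := by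
    field_simp; ring
  rw [e2, one_pow] at h
  have e3 : ((k1 / (k1 + 1) : ℝ) ^ (k1 + 1) * (k2 / (k2 + 1) : ℝ) ^ (k2 + 1) * (k3 / (k3 + 1) : ℝ) ^ (k3 + 1)) * (1 / k3 * (1 / k1) * (1 / k2)) * B2 k1 k2 k3 = 1 := by
    unfold B2
    simp only [div_pow, pow_succ]
    field_simp
  have h' := h.trans_eq e3.symm
  rw [mul_assoc, mul_comm] at h'
  refine le_of_mul_le_mul_left h' (by positivity)

end MV

open MeasureTheory Real
namespace MV

theorem det_pair' {d : ℕ} (p : (Fin d ⊕ Fin 3) → Fin d → ℝ) (x y r1 r2 : (Fin d ⊕ Fin 3) → ℝ)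
    (px : ∀ a, ∑ k, p k a * x k = 0) (py : ∀ a, ∑ k, p k a * y k = 0)
    (hx : ∑ k, x k = 0) (hy : ∑ k, y k = 0) (xx : ∑ k, x k * x k = 1) (yy : ∑ k, y k * y k = 1)
    (xy : ∑ k, x k * y k = 0) :
    (Mt p ![1, r1, r2]).det = (Mt p ![1, x, y]).det *
      ((∑ k, r1 k * x k) * (∑ k, r2 k * y k) - (∑ k, r1 k * y k) * (∑ k, r2 k * x k)) := by
  have h := det_pair p x y r1 r2 px py hx hy xx yy xy
  by_cases hD : (Mt p ![1, x, y]).det = 0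
  · rw [hD, zero_mul]
    obtain ⟨v, hv0, hv⟩ := Matrix.exists_vecMul_eq_zero_iff.2 hD
    have hv' : ∀ k, ∑ a, v (Sum.inl a) * p k a + (v (Sum.inr 0) + v (Sum.inr 1) * x k + v (Sum.inr 2) * y k) = 0 := by
      intro k
      have := congrFun hv k
      simpa [Matrix.vecMul, dotProduct, Fintype.sum_sum_type, Fin.sum_univ_three, Mt] using this
    have yx : ∑ k, y k * x k = 0 := by rw [← xy]; exact Finset.sum_congr rfl fun k _ => mul_comm _ _
    have key : ∀ z : (Fin d ⊕ Fin 3) → ℝ, (∀ a, ∑ k, p k a * z k = 0) → ∑ k, z k = 0 →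
        v (Sum.inr 1) * (∑ k, x k * z k) + v (Sum.inr 2) * (∑ k, y k * z k) = 0 := by
      intro z pz hz
      have e : ∑ k, (∑ a, v (Sum.inl a) * p k a + (v (Sum.inr 0) + v (Sum.inr 1) * x k + v (Sum.inr 2) * y k)) * z k = 0 := by
        simp only [hv']; simp
      have e1 : ∑ k, (∑ a, v (Sum.inl a) * p k a) * z k = 0 := by
        simp only [Finset.sum_mul]
        rw [Finset.sum_comm]
        refine Finset.sum_eq_zero fun a _ => ?_
        simp only [mul_assoc]
        rw [← Finset.mul_sum, pz, mul_zero]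
      simp only [add_mul, Finset.sum_add_distrib] at e
      rw [e1, ← Finset.mul_sum, hz] at e
      simp only [mul_assoc, ← Finset.mul_sum] at e
      linarith
    have z1 : v (Sum.inr 1) = 0 := by have := key x px hx; rw [xx, yx] at this; linarith
    have z2 : v (Sum.inr 2) = 0 := by have := key y py hy; rw [xy, yy] at this; linarith
    apply Matrix.exists_vecMul_eq_zero_iff.1
    refine ⟨v, hv0, ?_⟩
    funext k
    have := hv' k
    rw [z1, z2] at this
    simp only [Matrix.vecMul, dotProduct, Fintype.sum_sum_type, Fin.sum_univ_three, Mt, z1, z2]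
    simpa using this
  · refine mul_right_cancel₀ hD ?_
    rw [h]; ring

/-- solid simplex -/
def Sx (d : ℕ) (t : ℝ) : Set (Fin d → ℝ) := {z | (∀ i, 0 ≤ z i) ∧ ∑ i, z i ≤ t}

theorem Sx_meas (d : ℕ) (t : ℝ) : MeasurableSet (Sx d t) := by
  have : Sx d t = (⋂ i, {z | 0 ≤ z i}) ∩ {z | ∑ i, z i ≤ t} := by ext z; simp [Sx]
  rw [this]
  refine MeasurableSet.inter (MeasurableSet.iInter fun i => measurableSet_le (by fun_prop) (by fun_prop))
    (measurableSet_le (by fun_prop) (by fun_prop))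

theorem Sx_vol (d : ℕ) : ∀ t : ℝ, 0 ≤ t → volume (Sx d t) = ENNReal.ofReal (t ^ d / (d.factorial : ℝ)) := by
  induction d with
  | zero =>
    intro t ht
    have : Sx 0 t = Set.univ := by ext z; simp [Sx, ht]
    rw [this, volume_pi, Measure.pi_empty_univ]; simp
  | succ n ih =>
    intro t ht
    have mp := volume_preserving_piFinSuccAbove (fun _ : Fin (n + 1) => ℝ) 0
    set S : Set (ℝ × (Fin n → ℝ)) := {q | 0 ≤ q.1 ∧ q.2 ∈ Sx n (t - q.1)} with hS
    have hSm : MeasurableSet S := by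
      have : S = {q | 0 ≤ q.1} ∩ ((⋂ i, {q | 0 ≤ q.2 i}) ∩ {q | ∑ i, q.2 i ≤ t - q.1}) := by
        ext q; simp [hS, Sx]
      rw [this]
      refine (measurableSet_le (by fun_prop) (by fun_prop)).inter (MeasurableSet.inter (MeasurableSet.iInter fun i => measurableSet_le (by fun_prop) (by fun_prop))
        (measurableSet_le (by fun_prop) (by fun_prop)))
    have hpre : Sx (n + 1) t = (MeasurableEquiv.piFinSuccAbove (fun _ : Fin (n + 1) => ℝ) 0) ⁻¹' S := by
      ext z
      simp only [Sx, hS, Set.mem_setOf_eq, Set.mem_preimage, MeasurableEquiv.piFinSuccAbove_apply, Fin.insertNthEquiv_zero,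
        Fin.forall_fin_succ, Fin.sum_univ_succ]
      simp [Fin.tail]
      constructor
      · rintro ⟨⟨h1, h2⟩, h3⟩; exact ⟨h1, h2, by linarith⟩
      · rintro ⟨h1, h2, h3⟩; exact ⟨⟨h1, h2⟩, by linarith⟩
    rw [hpre, mp.measure_preimage hSm.nullMeasurableSet, Measure.volume_eq_prod, Measure.prod_apply hSm]
    have hsl : ∀ x : ℝ, volume (Prod.mk x ⁻¹' S) = (Set.Icc 0 t).indicator (fun x => ENNReal.ofReal ((t - x) ^ n / (n.factorial : ℝ))) x := by
      intro x
      by_cases hx : x ∈ Set.Icc 0 t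
      · rw [Set.indicator_of_mem hx, ← ih (t - x) (by linarith [hx.2])]
        congr 1
        ext z
        simp [hS, hx.1]
      · rw [Set.indicator_of_notMem hx]
        have : Prod.mk x ⁻¹' S = ∅ := by
          ext z
          simp only [hS, Set.mem_preimage, Set.mem_setOf_eq, Set.mem_empty_iff_false, iff_false]
          rintro ⟨h1, h2, h3⟩
          apply hx
          have : 0 ≤ ∑ i, z i := Finset.sum_nonneg fun i _ => h2 i
          exact ⟨h1, by linarith⟩
        rw [this]; simp
    simp only [hsl]
    rw [lintegral_indicator measurableSet_Icc, ← ofReal_integral_eq_lintegral_ofReal]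
    · congr 1
      rw [integral_Icc_eq_integral_Ioc, ← intervalIntegral.integral_of_le ht, intervalIntegral.integral_div]
      have := intervalIntegral.integral_comp_sub_left (a := 0) (b := t) (fun u : ℝ => u ^ n) t
      rw [this, integral_pow]
      simp [Nat.factorial_succ]
      field_simp
    · apply ContinuousOn.integrableOn_Icc
      fun_prop
    · rw [Filter.EventuallyLE, ae_restrict_iff' measurableSet_Icc]
      refine Filter.Eventually.of_forall fun x hx => ?_
      have : 0 ≤ t - x := by linarith [hx.2]
      simp only [Pi.zero_apply]
      positivity

/-- convex combinations with weights vanishing at i, j -/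
def Cij {d : ℕ} (p : (Fin d ⊕ Fin 3) → Fin d → ℝ) (i j : Fin d ⊕ Fin 3) : Set (Fin d → ℝ) :=
  {z | ∃ c : (Fin d ⊕ Fin 3) → ℝ, (∀ k, 0 ≤ c k) ∧ ∑ k, c k = 1 ∧ c i = 0 ∧ c j = 0 ∧ z = ∑ k, c k • p k}

theorem Cij_vol_aux {d : ℕ} (p : (Fin d ⊕ Fin 3) → Fin d → ℝ) :
    volume (Cij p (Sum.inr 1) (Sum.inr 2)) ≤
      ENNReal.ofReal (|(Mt p ![1, Pi.single (Sum.inr 1) 1, Pi.single (Sum.inr 2) 1]).det| / (d.factorial : ℝ)) := by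
  set L : Matrix (Fin d) (Fin d) ℝ := Matrix.of fun a k => p (Sum.inl k) a - p (Sum.inr 0) a with hL
  have hsub : Cij p (Sum.inr 1) (Sum.inr 2) ⊆ (fun z => p (Sum.inr 0) + z) '' (Matrix.toLin' L '' Sx d 1) := by
    rintro z ⟨c, h0, h1, hi, hj, rfl⟩
    rw [Fintype.sum_sum_type, Fin.sum_univ_three, hi, hj] at h1
    refine ⟨Matrix.toLin' L (fun k => c (Sum.inl k)), ⟨_, ⟨fun k => h0 _, ?_⟩, rfl⟩, ?_⟩
    · have := h0 (Sum.inr 0); linarith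
    · funext a
      simp only [Matrix.toLin'_apply, Matrix.mulVec, dotProduct, hL, Matrix.of_apply, Pi.add_apply, Finset.sum_apply, Pi.smul_apply,
        smul_eq_mul, Fintype.sum_sum_type, Fin.sum_univ_three, hi, hj, sub_mul, Finset.sum_sub_distrib, ← Finset.mul_sum]
      have e : c (Sum.inr 0) = 1 - ∑ k, c (Sum.inl k) := by linarith
      rw [e]
      have : ∑ k, p (Sum.inl k) a * c (Sum.inl k) = ∑ k, c (Sum.inl k) * p (Sum.inl k) a :=
        Finset.sum_congr rfl fun k _ => mul_comm _ _
      rw [this]; ring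
  have hdet : (Mt p ![1, Pi.single (Sum.inr 1) 1, Pi.single (Sum.inr 2) 1]).det = L.det := by
    have e : Mt p ![1, Pi.single (Sum.inr 1) 1, Pi.single (Sum.inr 2) 1] *
        Matrix.fromBlocks 1 0 (Matrix.of fun (s : Fin 3) (_ : Fin d) => if s = 0 then (-1 : ℝ) else 0) 1 =
        Matrix.fromBlocks L (Matrix.of fun a s => p (Sum.inr s) a) 0 !![1, 1, 1; 0, 1, 0; 0, 0, 1] := by
      ext r k
      rw [Matrix.mul_apply, Fintype.sum_sum_type, Fin.sum_univ_three]
      rcases r with r | r <;> rcases k with k | k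
      · simp [Mt, hL, Matrix.one_apply]; ring
      · fin_cases k <;> simp [Mt, Matrix.one_apply]
      · fin_cases r <;> simp [Mt, Matrix.one_apply]
      · fin_cases r <;> fin_cases k <;> simp [Mt, Matrix.one_apply]
    have := congrArg Matrix.det e
    rw [Matrix.det_mul, Matrix.det_fromBlocks_zero₁₂, Matrix.det_fromBlocks_zero₂₁] at this
    simpa [Matrix.det_fin_three] using this
  refine (measure_mono hsub).trans ?_
  rw [Set.image_add_left, measure_preimage_add, Measure.addHaar_image_linearMap, LinearMap.det_toLin', hdet, Sx_vol d 1 zero_le_one,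
    ← ENNReal.ofReal_mul (abs_nonneg _)]
  apply le_of_eq
  congr 1
  rw [one_pow]; ring

theorem Cij_vol {d : ℕ} (p : (Fin d ⊕ Fin 3) → Fin d → ℝ) {i j : Fin d ⊕ Fin 3} (hij : i ≠ j) :
    volume (Cij p i j) ≤
      ENNReal.ofReal (|(Mt p ![1, Pi.single i 1, Pi.single j 1]).det| / (d.factorial : ℝ)) := by
  obtain ⟨σ, h1, h2⟩ : ∃ σ : Equiv.Perm (Fin d ⊕ Fin 3), σ (Sum.inr 1) = i ∧ σ (Sum.inr 2) = j := by
    set τ : Equiv.Perm (Fin d ⊕ Fin 3) := Equiv.swap (Sum.inr 1) i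
    refine ⟨τ.trans (Equiv.swap (τ (Sum.inr 2)) j), ?_, ?_⟩
    · have e : τ (Sum.inr 1) = i := Equiv.swap_apply_left _ _
      simp only [Equiv.trans_apply, e]
      apply Equiv.swap_apply_of_ne_of_ne
      · rw [← e]; intro h; have := τ.injective h; simp at this
      · exact hij
    · simp
  have h := Cij_vol_aux (fun k => p (σ k))
  have e1 : Cij p i j ⊆ Cij (fun k => p (σ k)) (Sum.inr 1) (Sum.inr 2) := by
    rintro z ⟨c, h0, hs, hi, hj, rfl⟩
    refine ⟨fun k => c (σ k), fun k => h0 _, ?_, ?_, ?_, ?_⟩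
    · rw [← hs]; exact Equiv.sum_comp σ c
    · simp only [h1, hi]
    · simp only [h2, hj]
    · exact (Equiv.sum_comp σ (fun k => c k • p k)).symm
  refine (measure_mono e1).trans (h.trans (le_of_eq ?_))
  congr 2
  have e2 : Mt (fun k => p (σ k)) ![1, Pi.single (Sum.inr 1) 1, Pi.single (Sum.inr 2) 1] =
      (Mt p ![1, Pi.single i 1, Pi.single j 1]).submatrix id σ := by
    ext r k
    rcases r with r | r
    · simp [Mt]
    · fin_cases r <;> simp [Mt, Pi.single_apply, ← h1, ← h2]
  rw [e2, Matrix.det_permute']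
  rcases Int.units_eq_one_or (Equiv.Perm.sign σ) with h | h <;> simp [h]

end MV

open MeasureTheory Real
namespace MV

theorem pos_pair {ι : Type*} [Fintype ι] (x y : ι → ℝ) (h0 : ∀ i, y i = 0 → x i = 0)
    (hx : ∑ k, x k = 0) (hy : ∑ k, y k = 0) (xx : ∑ k, x k * x k = 1) (yy : ∑ k, y k * y k = 1)
    (xy : ∑ k, x k * y k = 0) : ∃ i j, 0 < y i ∧ y j < 0 ∧ 0 < x j * y i - x i * y j := by
  classical
  by_contra! hcon
  set P : Finset ι := Finset.univ.filter fun i => 0 < y i with hP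
  set N : Finset ι := Finset.univ.filter fun i => y i < 0 with hN
  have split : ∀ z : ι → ℝ, (∀ i, y i = 0 → z i = 0) → ∑ k, z k = ∑ k ∈ P, z k + ∑ k ∈ N, z k := by
    intro z hz
    rw [hP, hN, Finset.sum_filter, Finset.sum_filter, ← Finset.sum_add_distrib]
    refine Finset.sum_congr rfl fun k _ => ?_
    rcases lt_trichotomy (y k) 0 with h | h | h
    · simp [h, h.le.not_gt]
    · simp [hz k h]
    · simp [h, h.le.not_gt]
  have sx := split x h0
  have sy := split y (fun _ h => h)
  rw [hx] at sx
  rw [hy] at sy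
  have tot : ∑ i ∈ P, ∑ j ∈ N, (x j * y i - x i * y j) = 0 := by
    have : ∑ i ∈ P, ∑ j ∈ N, (x j * y i - x i * y j) = (∑ j ∈ N, x j) * (∑ i ∈ P, y i) - (∑ i ∈ P, x i) * (∑ j ∈ N, y j) := by
      simp only [Finset.sum_sub_distrib]
      rw [Finset.sum_mul_sum, Finset.sum_mul_sum, Finset.sum_comm]
    rw [this, show ∑ j ∈ N, x j = - ∑ i ∈ P, x i by linarith, show ∑ j ∈ N, y j = - ∑ i ∈ P, y i by linarith]
    ring
  have memP : ∀ {i}, i ∈ P ↔ 0 < y i := by intro i; simp [hP]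
  have memN : ∀ {i}, i ∈ N ↔ y i < 0 := by intro i; simp [hN]
  have all0 : ∀ i ∈ P, ∀ j ∈ N, x j * y i - x i * y j = 0 := by
    intro i hi j hj
    have h1 := (Finset.sum_eq_zero_iff_of_nonpos (s := P) (f := fun i => ∑ j ∈ N, (x j * y i - x i * y j)) (fun i hi =>
      Finset.sum_nonpos fun j hj => hcon i j (memP.1 hi) (memN.1 hj))).1 tot i hi
    exact (Finset.sum_eq_zero_iff_of_nonpos fun j hj => hcon i j (memP.1 hi) (memN.1 hj)).1 h1 j hj
  have hne : ∃ i, y i ≠ 0 := by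
    by_contra! h
    simp [h] at yy
  have hPne : P.Nonempty := by
    rw [Finset.nonempty_iff_ne_empty]
    intro hPe
    rw [hPe, Finset.sum_empty, zero_add] at sy
    obtain ⟨i, hi⟩ := hne
    have := (Finset.sum_eq_zero_iff_of_nonpos (fun j hj => (memN.1 hj).le)).1 sy.symm
    rcases lt_or_gt_of_ne hi with h | h
    · exact hi (this i (memN.2 h))
    · have := memP.2 h; rw [hPe] at this; simp at this
  have hNne : N.Nonempty := by
    rw [Finset.nonempty_iff_ne_empty]
    intro hNe
    rw [hNe, Finset.sum_empty, add_zero] at sy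
    obtain ⟨i, hi⟩ := hPne
    have := Finset.sum_pos (fun j hj => memP.1 hj) ⟨i, hi⟩
    linarith
  obtain ⟨i0, hi0⟩ := hPne
  obtain ⟨j0, hj0⟩ := hNne
  have yi0 := memP.1 hi0
  have yj0 := memN.1 hj0
  have hm : ∀ k, x k = x i0 / y i0 * y k := by
    intro k
    rcases lt_trichotomy (y k) 0 with h | h | h
    · have := all0 i0 hi0 k (memN.2 h)
      field_simp; linarith
    · rw [h, h0 k h, mul_zero]
    · have e1 := all0 k (memP.2 h) j0 hj0
      have e2 := all0 i0 hi0 j0 hj0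
      rw [div_mul_eq_mul_div, eq_div_iff yi0.ne']
      have : (x k * y i0 - x i0 * y k) * y j0 = 0 := by linear_combination y k * e2 - y i0 * e1
      rcases mul_eq_zero.1 this with h | h
      · linarith
      · linarith
  have h1 : x i0 / y i0 = 0 := by
    have : ∑ k, x k * y k = x i0 / y i0 * ∑ k, y k * y k := by
      rw [Finset.mul_sum]
      refine Finset.sum_congr rfl fun k _ => ?_
      rw [hm k]; ring
    rw [xy, yy] at this; linarith
  have : ∀ k, x k = 0 := by intro k; rw [hm k, h1, zero_mul]
  simp [this] at xx

theorem cover {ι : Type*} [Fintype ι] (x y c : ι → ℝ) (h0 : ∀ i, y i = 0 → x i = 0)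
    (hx : ∑ k, x k = 0) (hy : ∑ k, y k = 0) (xx : ∑ k, x k * x k = 1) (yy : ∑ k, y k * y k = 1)
    (xy : ∑ k, x k * y k = 0) (hc : ∀ k, 0 ≤ c k) :
    ∃ i j s t, 0 < y i ∧ y j < 0 ∧ 0 < x j * y i - x i * y j ∧ (∀ k, 0 ≤ c k + s * x k + t * y k) ∧
      c i + s * x i + t * y i = 0 ∧ c j + s * x j + t * y j = 0 := by
  classical
  set S : Finset (ι × ι) := Finset.univ.filter fun q => 0 < y q.1 ∧ y q.2 < 0 ∧ 0 < x q.2 * y q.1 - x q.1 * y q.2 with hS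
  have hSne : S.Nonempty := by
    obtain ⟨i, j, h⟩ := pos_pair x y h0 hx hy xx yy xy
    exact ⟨(i, j), by simpa [hS] using h⟩
  obtain ⟨⟨i, j⟩, hm, hmin⟩ := S.exists_min_image (fun q => (c q.2 * y q.1 - c q.1 * y q.2) / (x q.2 * y q.1 - x q.1 * y q.2)) hSne
  have hm' : 0 < y i ∧ y j < 0 ∧ 0 < x j * y i - x i * y j := by simpa [hS] using hm
  obtain ⟨hi, hj, hp⟩ := hm'
  set r := (c j * y i - c i * y j) / (x j * y i - x i * y j) with hr
  have hr0 : 0 ≤ r := by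
    apply div_nonneg _ hp.le
    have := mul_nonneg (hc j) hi.le
    have := mul_nonneg (hc i) (neg_nonneg.2 hj.le)
    linarith
  have hre : r * (x j * y i - x i * y j) = c j * y i - c i * y j := div_mul_cancel₀ _ hp.ne'
  have pairs : ∀ k l, 0 < y k → y l < 0 → 0 ≤ (c l * y k - c k * y l) - r * (x l * y k - x k * y l) := by
    intro k l hk hl
    have hcc : 0 ≤ c l * y k - c k * y l := by
      have := mul_nonneg (hc l) hk.le
      have := mul_nonneg (hc k) (neg_nonneg.2 hl.le)
      linarith
    by_cases h : 0 < x l * y k - x k * y l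
    · have h1 := hmin (k, l) (by simp [hS, hk, hl]; linarith)
      simp only at h1
      rw [le_div_iff₀ h] at h1
      linarith
    · have := mul_nonneg hr0 (by linarith : 0 ≤ -(x l * y k - x k * y l))
      linarith
  have e1 : c i + -r * x i + (-(c i - r * x i) / y i) * y i = 0 := by field_simp; ring
  have e2 : c j + -r * x j + (-(c i - r * x i) / y i) * y j = 0 := by
    field_simp
    linear_combination -hre
  refine ⟨i, j, -r, -(c i - r * x i) / y i, hi, hj, hp, ?_, e1, e2⟩
  set t := -(c i - r * x i) / y i
  intro k
  rcases lt_trichotomy (y k) 0 with h | h | h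
  · have := pairs i k hi h
    have e : (c k + -r * x k + t * y k) * y i = (c k * y i - c i * y k) - r * (x k * y i - x i * y k) := by
      linear_combination y k * e1
    rw [← e] at this
    exact nonneg_of_mul_nonneg_left this hi
  · rw [h, h0 k h]; simpa using hc k
  · have := pairs k j h hj
    have e : (c k + -r * x k + t * y k) * (-y j) = (c j * y k - c k * y j) - r * (x j * y k - x k * y j) := by
      linear_combination -y k * e2
    rw [← e] at this
    exact nonneg_of_mul_nonneg_left this (by linarith)

theorem hull_range {ι E : Type*} [Fintype ι] [AddCommGroup E] [Module ℝ E] (p : ι → E) {z : E}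
    (hz : z ∈ convexHull ℝ (Set.range p)) :
    ∃ c : ι → ℝ, (∀ k, 0 ≤ c k) ∧ ∑ k, c k = 1 ∧ ∑ k, c k • p k = z := by
  classical
  have : convexHull ℝ (Set.range p) ⊆ {z | ∃ c : ι → ℝ, (∀ k, 0 ≤ c k) ∧ ∑ k, c k = 1 ∧ ∑ k, c k • p k = z} := by
    apply convexHull_min
    · rintro _ ⟨i, rfl⟩
      refine ⟨Pi.single i 1, ?_, by simp, by simp [Pi.single_apply, ite_smul]⟩
      intro k
      by_cases h : k = i
      · subst h; simp
      · simp [h]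
    · rintro _ ⟨c, h0, h1, rfl⟩ _ ⟨c', h0', h1', rfl⟩ a b ha hb hab
      refine ⟨fun k => a * c k + b * c' k, ?_, ?_, ?_⟩
      · intro k
        have := h0 k
        have := h0' k
        positivity
      · rw [Finset.sum_add_distrib, ← Finset.mul_sum, ← Finset.mul_sum, h1, h1']; linarith
      · simp only [add_smul, Finset.sum_add_distrib, mul_smul, ← Finset.smul_sum]
  exact this hz

theorem vol_le {d : ℕ} (p : (Fin d ⊕ Fin 3) → Fin d → ℝ) (x y : (Fin d ⊕ Fin 3) → ℝ)
    (px : ∀ a, ∑ k, p k a * x k = 0) (py : ∀ a, ∑ k, p k a * y k = 0) (h0 : ∀ i, y i = 0 → x i = 0)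
    (hx : ∑ k, x k = 0) (hy : ∑ k, y k = 0) (xx : ∑ k, x k * x k = 1) (yy : ∑ k, y k * y k = 1)
    (xy : ∑ k, x k * y k = 0) :
    volume (convexHull ℝ (Set.range p)) ≤ ENNReal.ofReal (|(Mt p ![1, x, y]).det| * F0 x y / (d.factorial : ℝ)) := by
  classical
  set S : Finset ((Fin d ⊕ Fin 3) × (Fin d ⊕ Fin 3)) :=
    Finset.univ.filter fun q => 0 < y q.1 ∧ y q.2 < 0 ∧ 0 < x q.2 * y q.1 - x q.1 * y q.2 with hS
  have hsub : convexHull ℝ (Set.range p) ⊆ ⋃ q ∈ S, Cij p q.1 q.2 := by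
    intro z hz
    obtain ⟨c, hc0, hc1, rfl⟩ := hull_range p hz
    obtain ⟨i, j, s, t, hi, hj, hp, hk, ei, ej⟩ := cover x y c h0 hx hy xx yy xy hc0
    simp only [Set.mem_iUnion]
    refine ⟨(i, j), by simp only [hS, Finset.mem_filter, Finset.mem_univ, true_and]; exact ⟨hi, hj, hp⟩,
      fun k => c k + s * x k + t * y k, hk, ?_, ei, ej, ?_⟩
    · simp only [Finset.sum_add_distrib, ← Finset.mul_sum, hx, hy, hc1]; ring
    · funext a
      simp only [Finset.sum_apply, Pi.smul_apply, smul_eq_mul, add_mul, Finset.sum_add_distrib, mul_assoc, ← Finset.mul_sum]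
      simp only [mul_comm (x _), mul_comm (y _), px, py]; ring
  refine (measure_mono hsub).trans ((measure_biUnion_finset_le S _).trans ?_)
  have hb : ∀ q ∈ S, volume (Cij p q.1 q.2) ≤ ENNReal.ofReal (|(Mt p ![1, x, y]).det| * (x q.2 * y q.1 - x q.1 * y q.2) / (d.factorial : ℝ)) := by
    rintro ⟨i, j⟩ hq
    have hq' : 0 < y i ∧ y j < 0 ∧ 0 < x j * y i - x i * y j := by simpa [hS] using hq
    have hij : i ≠ j := by rintro rfl; linarith [hq'.1, hq'.2.1]
    refine (Cij_vol p hij).trans (le_of_eq ?_)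
    congr 2
    rw [det_pair' p x y (Pi.single i 1) (Pi.single j 1) px py hx hy xx yy xy, abs_mul]
    congr 1
    have e : ∀ (i : Fin d ⊕ Fin 3) (z : (Fin d ⊕ Fin 3) → ℝ), ∑ k, (Pi.single i 1 : (Fin d ⊕ Fin 3) → ℝ) k * z k = z i := by
      intro i z; simp [Pi.single_apply]
    simp only [e]
    rw [abs_of_neg (by linarith)]; ring
  refine (Finset.sum_le_sum hb).trans ?_
  rw [← ENNReal.ofReal_sum_of_nonneg]
  · apply le_of_eq
    congr 1
    rw [← Finset.sum_div, ← Finset.mul_sum]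
    congr 2
    unfold F0
    rw [hS, Finset.sum_filter, ← Finset.univ_product_univ, Finset.sum_product]
  · rintro ⟨i, j⟩ hq
    have hq' : 0 < y i ∧ y j < 0 ∧ 0 < x j * y i - x i * y j := by simpa [hS] using hq
    have := hq'.2.2
    simp only
    positivity

end MV

open MeasureTheory Real
namespace MV

theorem B2_perm {κ a b c a' b' c' : ℕ} (ha : a = κ ∨ a = κ + 1) (hb : b = κ ∨ b = κ + 1) (hc : c = κ ∨ c = κ + 1)
    (ha' : a' = κ ∨ a' = κ + 1) (hb' : b' = κ ∨ b' = κ + 1) (hc' : c' = κ ∨ c' = κ + 1)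
    (hs : a + b + c = a' + b' + c') : B2 a b c = B2 a' b' c' := by
  rcases ha with rfl | rfl <;> rcases hb with rfl | rfl <;> rcases hc with rfl | rfl <;>
  rcases ha' with rfl | rfl <;> rcases hb' with rfl | rfl <;> rcases hc' with rfl | rfl <;>
  first
  | (exfalso; omega)
  | rfl
  | (unfold B2; push_cast; ring)

theorem xy_exists {d : ℕ} (p : (Fin d ⊕ Fin 3) → Fin d → ℝ) :
    ∃ x y : (Fin d ⊕ Fin 3) → ℝ, (∀ a, ∑ k, p k a * x k = 0) ∧ (∀ a, ∑ k, p k a * y k = 0) ∧ (∀ i, y i = 0 → x i = 0) ∧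
     ∑ k, x k = 0 ∧ ∑ k, y k = 0 ∧ ∑ k, x k * x k = 1 ∧ ∑ k, y k * y k = 1 ∧ ∑ k, x k * y k = 0 := by
  classical
  set A : Matrix (Fin d ⊕ Unit) (Fin d ⊕ Fin 3) ℝ := fun r k => Sum.elim (fun a => p k a) (fun _ => 1) r with hA
  set Φ : EuclideanSpace ℝ (Fin d ⊕ Fin 3) →ₗ[ℝ] (Fin d ⊕ Unit → ℝ) :=
    (Matrix.toLin' A).comp (WithLp.linearEquiv 2 ℝ ((Fin d ⊕ Fin 3) → ℝ)).toLinearMap with hΦ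
  have hrk := LinearMap.finrank_range_add_finrank_ker Φ
  have hr : Module.finrank ℝ (LinearMap.range Φ) ≤ d + 1 := by
    refine (Submodule.finrank_le _).trans ?_
    simp
  have hk : 2 ≤ Module.finrank ℝ (LinearMap.ker Φ) := by
    rw [finrank_euclideanSpace] at hrk
    simp only [Fintype.card_sum, Fintype.card_fin] at hrk
    omega
  set b := stdOrthonormalBasis ℝ (LinearMap.ker Φ)
  have hb := b.orthonormal
  set u : EuclideanSpace ℝ (Fin d ⊕ Fin 3) := (b ⟨0, by omega⟩).1 with hu
  set v : EuclideanSpace ℝ (Fin d ⊕ Fin 3) := (b ⟨1, by omega⟩).1 with hv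
  have inn : ∀ f g : EuclideanSpace ℝ (Fin d ⊕ Fin 3), inner ℝ f g = ∑ k, f k * g k := by
    intro f g
    rw [PiLp.inner_apply]
    refine Finset.sum_congr rfl fun k _ => ?_
    simp [mul_comm]
  have huu : ∑ k, u k * u k = 1 := by
    rw [← inn, real_inner_self_eq_norm_sq]
    have := hb.1 ⟨0, by omega⟩
    rw [Submodule.coe_norm] at this
    rw [hu, this]; norm_num
  have hvv : ∑ k, v k * v k = 1 := by
    rw [← inn, real_inner_self_eq_norm_sq]
    have := hb.1 ⟨1, by omega⟩
    rw [Submodule.coe_norm] at this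
    rw [hv, this]; norm_num
  have huv : ∑ k, u k * v k = 0 := by
    rw [← inn]
    have := hb.2 (i := ⟨0, by omega⟩) (j := ⟨1, by omega⟩) (by simp)
    exact this
  have ker : ∀ w : LinearMap.ker Φ, (∀ a, ∑ k, p k a * (w : EuclideanSpace ℝ (Fin d ⊕ Fin 3)) k = 0) ∧ ∑ k, (w : EuclideanSpace ℝ (Fin d ⊕ Fin 3)) k = 0 := by
    intro w
    have h := w.2
    rw [LinearMap.mem_ker] at h
    have h' : Matrix.mulVec A (fun k => w.1 k) = 0 := h
    refine ⟨fun a => ?_, ?_⟩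
    · have := congrFun h' (Sum.inl a)
      simp only [Matrix.mulVec, dotProduct, hA, Sum.elim_inl, Pi.zero_apply] at this
      exact this
    · have := congrFun h' (Sum.inr ())
      simp only [Matrix.mulVec, dotProduct, hA, Sum.elim_inr, Pi.zero_apply, one_mul] at this
      exact this
  obtain ⟨ku, su⟩ := ker (b ⟨0, by omega⟩)
  obtain ⟨kv, sv⟩ := ker (b ⟨1, by omega⟩)
  rw [← hu] at ku su
  rw [← hv] at kv sv
  obtain ⟨t, ht⟩ := Set.Infinite.exists_notMem_finset (Set.infinite_univ (α := ℝ)) (Finset.univ.image fun k => - v k / u k)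
  have ht' : ∀ k, v k + t * u k = 0 → u k = 0 ∧ v k = 0 := by
    intro k hk
    have : u k = 0 := by
      by_contra h
      apply ht.2
      rw [Finset.mem_image]
      refine ⟨k, Finset.mem_univ _, ?_⟩
      rw [div_eq_iff h]; linarith
    refine ⟨this, ?_⟩
    rw [this] at hk; linarith
  have hsq : (0:ℝ) < 1 + t ^ 2 := by positivity
  set r : ℝ := 1 / √(1 + t ^ 2) with hr
  have hr2 : r * r * (1 + t ^ 2) = 1 := by
    rw [hr, div_mul_div_comm, Real.mul_self_sqrt hsq.le]; field_simp
  have hr0 : r ≠ 0 := by intro h; rw [h] at hr2; norm_num at hr2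
  have key : ∀ (α β γ δ : ℝ), ∑ k, (r * (α * u k + β * v k)) * (r * (γ * u k + δ * v k)) = r * r * (α * γ + β * δ) := by
    intro α β γ δ
    have : ∀ k, (r * (α * u k + β * v k)) * (r * (γ * u k + δ * v k)) =
      (r * r * (α * γ)) * (u k * u k) + (r * r * (α * δ + β * γ)) * (u k * v k) + (r * r * (β * δ)) * (v k * v k) := by intro k; ring
    simp only [this, Finset.sum_add_distrib, ← Finset.mul_sum, huu, huv, hvv]
    ring
  have lin : ∀ (q : (Fin d ⊕ Fin 3) → ℝ) (α β : ℝ), ∑ k, q k * u k = 0 → ∑ k, q k * v k = 0 → ∑ k, q k * (r * (α * u k + β * v k)) = 0 := by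
    intro q α β h1 h2
    have : ∀ k, q k * (r * (α * u k + β * v k)) = (r * α) * (q k * u k) + (r * β) * (q k * v k) := by intro k; ring
    simp only [this, Finset.sum_add_distrib, ← Finset.mul_sum, h1, h2]; ring
  refine ⟨fun k => r * (1 * u k + (-t) * v k), fun k => r * (t * u k + 1 * v k), ?_, ?_, ?_, ?_, ?_, ?_, ?_, ?_⟩
  · intro a; exact lin (fun k => p k a) _ _ (ku a) (kv a)
  · intro a; exact lin (fun k => p k a) _ _ (ku a) (kv a)
  · intro k hk
    have h1 : t * u k + 1 * v k = 0 := (mul_eq_zero.1 hk).resolve_left hr0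
    obtain ⟨e1, e2⟩ := ht' k (by linarith)
    simp only [e1, e2]; ring
  · have := lin (fun _ => 1) 1 (-t) (by simpa using su) (by simpa using sv)
    simpa using this
  · have := lin (fun _ => 1) t 1 (by simpa using su) (by simpa using sv)
    simpa using this
  · rw [key]; linarith
  · rw [key]; linarith
  · rw [key]; ring

theorem amgm3 (a b c q : ℕ) (h : a + b + c = 3 * q) : a * b * c ≤ q ^ 3 := by
  have h1 : ((a:ℝ) + b + c) = 3 * q := by exact_mod_cast h
  have h2 : ((a:ℝ) * b * c) ≤ (q:ℝ) ^ 3 := by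
    have hq : (q:ℝ) = (a + b + c) / 3 := by linarith
    rw [hq]
    have ha : (0:ℝ) ≤ a := by positivity
    have hb : (0:ℝ) ≤ b := by positivity
    have hc : (0:ℝ) ≤ c := by positivity
    nlinarith [mul_nonneg ha (sq_nonneg ((b:ℝ) - c)), mul_nonneg hb (sq_nonneg ((a:ℝ) - c)), mul_nonneg hc (sq_nonneg ((a:ℝ) - b)),
      mul_nonneg ha (sq_nonneg ((a:ℝ) - b)), mul_nonneg ha (sq_nonneg ((a:ℝ) - c)), mul_nonneg hb (sq_nonneg ((a:ℝ) - b)),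
      mul_nonneg hb (sq_nonneg ((b:ℝ) - c)), mul_nonneg hc (sq_nonneg ((a:ℝ) - c)), mul_nonneg hc (sq_nonneg ((b:ℝ) - c))]
  exact_mod_cast h2

theorem core_mu {d : ℕ} (hd : 0 < d) (p : (Fin d ⊕ Fin 3) → Fin d → ℝ) (hp : ∀ k, ∑ a, p k a ^ 2 = 1)
    (x y : (Fin d ⊕ Fin 3) → ℝ) (h0 : ∀ i, y i = 0 → x i = 0)
    (hx : ∑ k, x k = 0) (hy : ∑ k, y k = 0) (xx : ∑ k, x k * x k = 1) (yy : ∑ k, y k * y k = 1)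
    (xy : ∑ k, x k * y k = 0) {e : (Fin d ⊕ Fin 3) → ℕ} (he : Function.Injective e) (μ : ℝ) (hμ : 0 ≤ μ)
    (hS : Sq (ss x y e) ≤ μ * Tq (ss x y e)) :
    (|(Mt p ![1, x, y]).det| * F0 x y) ^ 2 ≤ μ * (((d:ℝ) + 3) / d) ^ d := by
  have h1 := c_bound (ss_LT x y he) μ hμ hS x y xx yy xy
  rw [xKy x y he h0 hx hy] at h1
  have hc : (Fintype.card (Fin d ⊕ Fin 3) : ℝ) = d + 3 := by simp
  rw [hc] at h1
  have hn : (0:ℝ) < (d:ℝ) + 3 := by positivity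
  have h2 : ((d:ℝ) + 3) * F0 x y ^ 2 ≤ μ := by
    have : ((d:ℝ) + 3) * (((d:ℝ) + 3) * F0 x y ^ 2) ≤ ((d:ℝ) + 3) * μ := by linarith
    exact le_of_mul_le_mul_left this hn
  have h3 := D_bound hd p hp x y xx yy
  rw [mul_pow, sq_abs]
  calc _ ≤ ((d:ℝ) + 3) * (((d:ℝ) + 3) / d) ^ d * F0 x y ^ 2 := mul_le_mul_of_nonneg_right h3 (sq_nonneg _)
    _ = (((d:ℝ) + 3) * F0 x y ^ 2) * (((d:ℝ) + 3) / d) ^ d := by ring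
    _ ≤ _ := mul_le_mul_of_nonneg_right h2 (by positivity)

theorem core_class {d : ℕ} (p : (Fin d ⊕ Fin 3) → Fin d → ℝ) (hp : ∀ k, ∑ a, p k a ^ 2 = 1)
    (x y : (Fin d ⊕ Fin 3) → ℝ) (px : ∀ a, ∑ k, p k a * x k = 0) (py : ∀ a, ∑ k, p k a * y k = 0) (h0 : ∀ i, y i = 0 → x i = 0)
    (hx : ∑ k, x k = 0) (hy : ∑ k, y k = 0) (xx : ∑ k, x k * x k = 1) (yy : ∑ k, y k * y k = 1)
    (xy : ∑ k, x k * y k = 0) {e : (Fin d ⊕ Fin 3) → ℕ} (he : Function.Injective e) {m : ℕ} (hm : 2 ≤ m)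
    (hA : ¬ AllPent m (ss x y e)) :
    ∃ k1 k2 k3 : ℕ, (k1 = m - 1 ∨ k1 = m - 1 + 1) ∧ (k2 = m - 1 ∨ k2 = m - 1 + 1) ∧ (k3 = m - 1 ∨ k3 = m - 1 + 1) ∧ k1 + k2 + k3 = d ∧
      (|(Mt p ![1, x, y]).det| * F0 x y) ^ 2 ≤ B2 k1 k2 k3 := by
  unfold AllPent at hA
  push Not at hA
  obtain ⟨i, j, l, hcy, hbal, hpent⟩ := hA
  have hs := ss_LT x y he
  set s := ss x y e with hsdef
  have hn : ∀ u v, pent s v i j l u = false ∧ pent s v j l i u = false ∧ pent s v l i j u = false := by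
    intro u v
    have := hpent u v
    simpa using this
  have h1 := caseC hs hcy hn x y hx hy
  rw [hsdef, xKy x y he h0 hx hy, ← hsdef] at h1
  have hcard : (0:ℝ) < (Fintype.card (Fin d ⊕ Fin 3) : ℝ) := by simp; positivity
  have h2 := mul_left_cancel₀ hcard.ne' h1
  have hsum := parts_sum hs hcy
  simp only [Fintype.card_sum, Fintype.card_fin] at hsum
  unfold bal at hbal
  have hb := of_decide_eq_true hbal
  have cA : ∑ a, cr s a j l = (Nn s j l : ℝ) := by rw [← Nr_eq]; rfl
  have cB : ∑ a, cr s i a l = (Nn s l i : ℝ) := by rw [← Nn_mid]; push_cast; rfl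
  have cC : ∑ a, cr s i j a = (Nn s i j : ℝ) := by rw [← Nn_last]; push_cast; rfl
  have hbd := class_bound p hp (fun a => cr s a j l) (fun a => cr s i a l) (fun a => cr s i j a) (fun a => cr_01 s _ _ _)
    (fun a => cr_01 s _ _ _) (fun a => cr_01 s _ _ _) (fun a => cr_repl hs a (cr_one.2 hcy)) (k1 := Nn s j l - 1) (k2 := Nn s l i - 1)
    (k3 := Nn s i j - 1) (by omega) (by omega) (by omega)
    (by rw [cA]; norm_cast; omega) (by rw [cB]; norm_cast; omega) (by rw [cC]; norm_cast; omega)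
  refine ⟨Nn s j l - 1, Nn s l i - 1, Nn s i j - 1, by omega, by omega, by omega, by omega, ?_⟩
  rw [det_pair' p x y _ _ px py hx hy xx yy xy, mul_pow] at hbd
  rw [mul_pow, sq_abs, h2]
  convert hbd using 3
  ring

theorem core {d k1 k2 k3 : ℕ} (hd : 3 ≤ d) (hodd : Odd d) (hk : k1 + k2 + k3 = d)
    (h1 : k1 = d / 3 ∨ k1 = (d + 2) / 3) (h2 : k2 = d / 3 ∨ k2 = (d + 2) / 3) (h3 : k3 = d / 3 ∨ k3 = (d + 2) / 3)
    (p : (Fin d ⊕ Fin 3) → Fin d → ℝ) (hp : ∀ k, ∑ a, p k a ^ 2 = 1)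
    (x y : (Fin d ⊕ Fin 3) → ℝ) (px : ∀ a, ∑ k, p k a * x k = 0) (py : ∀ a, ∑ k, p k a * y k = 0) (h0 : ∀ i, y i = 0 → x i = 0)
    (hx : ∑ k, x k = 0) (hy : ∑ k, y k = 0) (xx : ∑ k, x k * x k = 1) (yy : ∑ k, y k * y k = 1)
    (xy : ∑ k, x k * y k = 0) :
    (|(Mt p ![1, x, y]).det| * F0 x y) ^ 2 ≤ B2 k1 k2 k3 := by
  obtain ⟨e, he⟩ : ∃ e : (Fin d ⊕ Fin 3) → ℕ, Function.Injective e :=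
    ⟨fun k => (Fintype.equivFin _ k : ℕ), fun a b h => (Fintype.equivFin _).injective (Fin.ext h)⟩
  have hs := ss_LT x y he
  have hc : Fintype.card (Fin d ⊕ Fin 3) = d + 3 := by simp
  rw [Nat.odd_iff] at hodd
  have hd3 : d % 3 = 0 ∨ d % 3 = 1 ∨ d % 3 = 2 := by omega
  rcases hd3 with hd3 | hd3 | hd3
  · obtain ⟨k, rfl⟩ : ∃ k, d = 3 * k := ⟨d / 3, by omega⟩
    have e1 : k1 = k := by omega
    have e2 : k2 = k := by omega
    have e3 : k3 = k := by omega
    rw [e1, e2, e3, ← ana0 k (by omega)]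
    refine core_mu (by omega) p hp x y h0 hx hy xx yy xy he (((k:ℝ) + 1) ^ 3) (by positivity) ?_
    have := mu0 hs ((k + 1) ^ 3) (fun a b c h => amgm3 a b c (k + 1) (by rw [h, hc]; ring))
    push_cast at this
    exact this
  · obtain ⟨m, hm⟩ : ∃ m, d = 3 * m - 2 ∧ 1 ≤ m := ⟨d / 3 + 1, by omega, by omega⟩
    obtain ⟨rfl, hm1⟩ := hm
    by_cases hA : AllPent m (ss x y e)
    · rw [B2_perm (κ := m - 1) (a' := m - 1) (b' := m - 1) (c' := m) (by omega) (by omega) (by omega) (by omega) (by omega) (by omega) (by omega)]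
      have h := mu1 hs m (by omega) (by rw [hc]; omega) hA
      have hm' : (1:ℝ) ≤ m := by exact_mod_cast hm1
      exact (core_mu (by omega) p hp x y h0 hx hy xx yy xy he _ (by nlinarith) h).trans (ana1 m (by omega))
    · obtain ⟨a, b, c, ha, hb, hcc, hsum, hle⟩ := core_class p hp x y px py h0 hx hy xx yy xy he (by omega) hA
      rwa [B2_perm (κ := m - 1) (a' := a) (b' := b) (c' := c) (by omega) (by omega) (by omega) ha hb hcc (by omega)]
  · obtain ⟨m, hm⟩ : ∃ m, d = 3 * m - 1 ∧ 1 ≤ m := ⟨d / 3 + 1, by omega, by omega⟩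
    obtain ⟨rfl, hm1⟩ := hm
    by_cases hA : AllPent m (ss x y e)
    · rw [B2_perm (κ := m - 1) (a' := m - 1) (b' := m) (c' := m) (by omega) (by omega) (by omega) (by omega) (by omega) (by omega) (by omega)]
      have h := mu2 hs m (by omega) (by rw [hc]; omega) hA
      have hm' : (1:ℝ) ≤ m := by exact_mod_cast hm1
      have hpos : (0:ℝ) < 2 * m - 1 := by linarith
      refine (core_mu (by omega) p hp x y h0 hx hy xx yy xy he ((m:ℝ) * (m + 1) ^ 2 - m / (2 * m - 1)) ?_ ?_).trans (ana2 m (by omega))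
      · rw [sub_nonneg, div_le_iff₀ hpos, mul_assoc]
        refine le_mul_of_one_le_right (by linarith) ?_
        nlinarith
      · refine le_of_mul_le_mul_left ?_ hpos
        refine h.trans (le_of_eq ?_)
        field_simp
    · obtain ⟨a, b, c, ha, hb, hcc, hsum, hle⟩ := core_class p hp x y px py h0 hx hy xx yy xy he (by omega) hA
      rwa [B2_perm (κ := m - 1) (a' := a) (b' := b) (c' := c) (by omega) (by omega) (by omega) ha hb hcc (by omega)]

theorem upper {d k1 k2 k3 : ℕ} (hd : 3 ≤ d) (hodd : Odd d) (hk : k1 + k2 + k3 = d)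
    (h1 : k1 = d / 3 ∨ k1 = (d + 2) / 3) (h2 : k2 = d / 3 ∨ k2 = (d + 2) / 3) (h3 : k3 = d / 3 ∨ k3 = (d + 2) / 3)
    (p : (Fin d ⊕ Fin 3) → Fin d → ℝ) (hp : ∀ k, ∑ a, p k a ^ 2 = 1) :
    volume (convexHull ℝ (Set.range p)) ≤ ENNReal.ofReal (√(B2 k1 k2 k3) / (d.factorial : ℝ)) := by
  obtain ⟨x, y, px, py, h0, hx, hy, xx, yy, xy⟩ := xy_exists p
  refine (vol_le p x y px py h0 hx hy xx yy xy).trans ?_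
  apply ENNReal.ofReal_le_ofReal
  gcongr
  exact Real.le_sqrt_of_sq_le (core hd hodd hk h1 h2 h3 p hp x y px py h0 hx hy xx yy xy)

end MV

open MeasureTheory Real
namespace MV

theorem cl_exists (d : ℕ) (k : Fin 3 → ℕ) (hd : ∑ t, k t = d) :
    ∃ cl : (Fin d ⊕ Fin 3) → Fin 3, ∀ t, (Finset.univ.filter fun a => cl a = t).card = k t + 1 := by
  classical
  have hc : Fintype.card (Σ t : Fin 3, Fin (k t + 1)) = Fintype.card (Fin d ⊕ Fin 3) := by
    simp [Finset.sum_add_distrib, ← hd]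
  let e := Fintype.equivOfCardEq hc
  refine ⟨fun a => (e.symm a).1, fun t => ?_⟩
  rw [← Fintype.card_subtype]
  have : {a // (e.symm a).1 = t} ≃ Fin (k t + 1) :=
    (e.symm.subtypeEquiv (q := fun s => s.1 = t) (fun a => Iff.rfl)).trans (Equiv.sigmaSubtype t)
  rw [Fintype.card_congr this]; simp

theorem pts_exists (d : ℕ) (k : Fin 3 → ℕ) (hk : ∀ t, 0 < k t) (hd : ∑ t, k t = d) :
    ∃ (cl : (Fin d ⊕ Fin 3) → Fin 3) (p : (Fin d ⊕ Fin 3) → Fin d → ℝ),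
      (∀ t, (∑ a, if cl a = t then (1:ℝ) else 0) = k t + 1) ∧
      (∀ t, (Finset.univ.filter fun a => cl a = t).card = k t + 1) ∧
      (∀ a b, ∑ i, p a i * p b i = (if a = b then 1 + 1 / (k (cl a) : ℝ) else 0) - (if cl a = cl b then 1 / (k (cl a) : ℝ) else 0)) ∧
      (∀ t i, (∑ a, if cl a = t then p a i else 0) = 0) := by
  classical
  obtain ⟨cl, hcl⟩ := cl_exists d k hd
  have hclr : ∀ t, (∑ a, if cl a = t then (1:ℝ) else 0) = k t + 1 := by
    intro t
    rw [Finset.sum_boole, hcl]; push_cast; rfl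
  have kp : ∀ t, (0:ℝ) < k t := fun t => by exact_mod_cast hk t
  set Φ : EuclideanSpace ℝ (Fin d ⊕ Fin 3) →ₗ[ℝ] (Fin 3 → ℝ) :=
    (Matrix.toLin' (Matrix.of fun (t : Fin 3) (a : Fin d ⊕ Fin 3) => if cl a = t then (1:ℝ) else 0)).comp
      (WithLp.linearEquiv 2 ℝ ((Fin d ⊕ Fin 3) → ℝ)).toLinearMap with hΦ
  have Φa : ∀ (z : EuclideanSpace ℝ (Fin d ⊕ Fin 3)) t, Φ z t = ∑ a, if cl a = t then z a else 0 := by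
    intro z t
    have : Φ z t = ∑ a, (if cl a = t then (1:ℝ) else 0) * z a := rfl
    rw [this]
    refine Finset.sum_congr rfl fun a _ => ?_
    split_ifs <;> simp
  have hsurj : Function.Surjective Φ := by
    intro f
    refine ⟨WithLp.toLp 2 (fun a => f (cl a) / (k (cl a) + 1)), ?_⟩
    funext t
    rw [Φa]
    have : ∀ a, (if cl a = t then (WithLp.toLp 2 (fun a => f (cl a) / ((k (cl a) : ℝ) + 1)) : EuclideanSpace ℝ (Fin d ⊕ Fin 3)) a else 0) = (f t / (k t + 1)) * (if cl a = t then (1:ℝ) else 0) := by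
      intro a
      by_cases h : cl a = t
      · simp [h]
      · simp [h]
    simp only [this]
    rw [← Finset.mul_sum, hclr]
    have := kp t
    field_simp
  have hfr : Module.finrank ℝ (LinearMap.ker Φ) = d := by
    have hrk := LinearMap.finrank_range_add_finrank_ker Φ
    rw [LinearMap.range_eq_top.2 hsurj, finrank_top, finrank_euclideanSpace] at hrk
    simp at hrk
    omega
  let b : OrthonormalBasis (Fin d) ℝ (LinearMap.ker Φ) := (stdOrthonormalBasis ℝ (LinearMap.ker Φ)).reindex (finCongr hfr)
  let s : Fin 3 → ℝ := fun t => √(((k t : ℝ) + 1) / k t)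
  have ss : ∀ t, s t * s t = ((k t : ℝ) + 1) / k t := fun t => Real.mul_self_sqrt (by have := kp t; positivity)
  let u0 : (Fin d ⊕ Fin 3) → (Fin d ⊕ Fin 3) → ℝ := fun a j => s (cl a) * ((if a = j then 1 else 0) - (if cl a = cl j then 1 / ((k (cl a) : ℝ) + 1) else 0))
  have u0s : ∀ a j, u0 a j = u0 j a := by
    intro a j
    by_cases h : cl a = cl j
    · simp only [u0, h, eq_comm (a := a)]
    · have : a ≠ j := fun h' => h (by rw [h'])
      simp only [u0, h, Ne.symm h, this, this.symm, if_false]; simp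
  have u0c : ∀ a t, (∑ j, if cl j = t then u0 a j else 0) = 0 := by
    intro a t
    have : ∀ j, (if cl j = t then u0 a j else 0) = s (cl a) * (if a = j then (if cl a = t then 1 else 0) else 0) -
        s (cl a) * (if cl a = t then 1 / ((k t : ℝ) + 1) else 0) * (if cl j = t then 1 else 0) := by
      intro j
      by_cases h : cl j = t
      · by_cases h2 : cl a = t
        · simp only [u0, h, h2, if_true]; ring
        · have : a ≠ j := fun h' => h2 (by rw [h', h])
          simp [u0, h, h2, this]
      · by_cases h2 : a = j
        · subst h2; simp [h]
        · simp [h, h2]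
    simp only [this, Finset.sum_sub_distrib, ← Finset.mul_sum, hclr]
    by_cases h : cl a = t
    · have := kp t
      simp [h]; field_simp; simp
    · simp [h]
  let u : (Fin d ⊕ Fin 3) → LinearMap.ker Φ := fun a => ⟨WithLp.toLp 2 (u0 a), by
    rw [LinearMap.mem_ker]; funext t; rw [Φa]; exact u0c a t⟩
  have huin : ∀ a c, inner ℝ (u a) (u c) = (if a = c then 1 + 1 / (k (cl a) : ℝ) else 0) - (if cl a = cl c then 1 / (k (cl a) : ℝ) else 0) := by
    intro a c
    have h1 : inner ℝ (u a) (u c) = ∑ j, u0 a j * u0 c j := by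
      rw [Submodule.coe_inner, PiLp.inner_apply]
      refine Finset.sum_congr rfl fun j _ => ?_
      simp [u, mul_comm]
    have h2 : ∀ j, u0 a j * u0 c j = (if a = j then s (cl a) * u0 c j else 0) - s (cl a) * (1 / ((k (cl a) : ℝ) + 1)) * (if cl j = cl a then u0 c j else 0) := by
      intro j
      by_cases h : a = j
      · subst h; simp [u0]; ring
      · simp only [u0, h, if_false, eq_comm (a := cl a) (b := cl j)]
        split_ifs <;> ring
    rw [h1]
    simp only [h2, Finset.sum_sub_distrib, ← Finset.mul_sum, u0c]
    simp only [Finset.sum_ite_eq, Finset.mem_univ, if_true, mul_zero, sub_zero]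
    have := kp (cl a)
    by_cases h : cl a = cl c
    · have e : s (cl a) * u0 c a = (s (cl a) * s (cl a)) * ((if a = c then 1 else 0) - 1 / ((k (cl a) : ℝ) + 1)) := by
        simp only [u0, ← h, if_true, eq_comm (a := c)]; ring
      rw [e, ss]
      simp only [h, if_true]
      have := kp (cl c)
      split_ifs <;> field_simp <;> ring
    · have h' : a ≠ c := fun h' => h (by rw [h'])
      simp [u0, h, Ne.symm h, h', h'.symm]
  refine ⟨cl, fun a i => inner ℝ (b i) (u a), hclr, hcl, ?_, ?_⟩
  · intro a c
    rw [← huin, ← b.sum_inner_mul_inner]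
    refine Finset.sum_congr rfl fun i _ => ?_
    rw [real_inner_comm]
  · intro t i
    have : (∑ a, if cl a = t then inner ℝ (b i) (u a) else 0) = inner ℝ (b i) (∑ a, if cl a = t then u a else 0) := by
      rw [inner_sum]
      refine Finset.sum_congr rfl fun a _ => ?_
      split_ifs <;> simp
    rw [this]
    have h0 : (∑ a, if cl a = t then u a else 0) = 0 := by
      apply Subtype.ext
      ext j
      have e : ((∑ a, if cl a = t then u a else 0 : LinearMap.ker Φ) : EuclideanSpace ℝ (Fin d ⊕ Fin 3)) j = ∑ a, if cl a = t then u0 j a else 0 := by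
        rw [Submodule.coe_sum, WithLp.ofLp_sum, Finset.sum_apply]
        refine Finset.sum_congr rfl fun a _ => ?_
        split_ifs
        · rw [u0s]
        · simp
      rw [e, u0c]; simp
    rw [h0, inner_zero_right]

end MV

open MeasureTheory Real
namespace MV

theorem detR {d : ℕ} (k : Fin 3 → ℕ) (hk : ∀ t, 0 < k t)
    (cl : (Fin d ⊕ Fin 3) → Fin 3) (p : (Fin d ⊕ Fin 3) → Fin d → ℝ)
    (h1 : ∀ t, (∑ a, if cl a = t then (1:ℝ) else 0) = k t + 1)
    (h2 : ∀ t, (Finset.univ.filter fun a => cl a = t).card = k t + 1)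
    (h3 : ∀ a b, ∑ i, p a i * p b i = (if a = b then 1 + 1 / (k (cl a) : ℝ) else 0) - (if cl a = cl b then 1 / (k (cl a) : ℝ) else 0))
    (h4 : ∀ t i, (∑ a, if cl a = t then p a i else 0) = 0)
    (v : Fin 3 → Fin d ⊕ Fin 3) (hv : ∀ t, cl (v t) = t) :
    (Mt p (fun t => Pi.single (v t) 1)).det ^ 2 * ∏ t, ((k t : ℝ) + 1) ^ 2 =
      ∏ t, (((k t : ℝ) + 1) ^ (k t + 1) / (k t : ℝ) ^ (k t)) := by
  classical
  have kp : ∀ t, (0:ℝ) < k t := fun t => by exact_mod_cast hk t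
  set N := Mt p (fun t a => if cl a = t then 1 / √(k t : ℝ) else 0) with hN
  set R := Mt p (fun t => Pi.single (v t) 1) with hR
  set G : Matrix (Fin d) (Fin d) ℝ := Matrix.of fun i j => ∑ a, p a i * p a j with hG
  have sq : ∀ t, √(k t : ℝ) * √(k t : ℝ) = k t := fun t => Real.mul_self_sqrt (kp t).le
  have iq : ∀ t, 1 / √(k t : ℝ) * (1 / √(k t : ℝ)) = 1 / k t := fun t => by
    rw [div_mul_div_comm, sq, one_mul]
  have sp : ∀ t, 0 < √(k t : ℝ) := fun t => Real.sqrt_pos.2 (kp t)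
  have e1 : N.transpose * N = Matrix.diagonal (fun a => 1 + 1 / (k (cl a) : ℝ)) := by
    ext a b
    rw [Matrix.mul_apply, Fintype.sum_sum_type]
    simp only [hN, Matrix.transpose_apply, Mt, Sum.elim_inl, Sum.elim_inr, h3]
    have : (∑ t, (if cl a = t then 1 / √(k t : ℝ) else 0) * (if cl b = t then 1 / √(k t : ℝ) else 0)) =
        if cl a = cl b then 1 / (k (cl a) : ℝ) else 0 := by
      simp only [ite_mul, zero_mul, Finset.sum_ite_eq, Finset.mem_univ, if_true]
      by_cases h : cl a = cl b
      · simp only [h, if_true]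
        exact iq _
      · rw [if_neg h, if_neg (fun h' => h h'.symm), mul_zero]
    rw [this, Matrix.diagonal_apply]; ring
  have e2 : R * N.transpose = Matrix.fromBlocks G 0 (Matrix.of fun s i => p (v s) i) (Matrix.diagonal fun t => 1 / √(k t : ℝ)) := by
    ext r c
    rw [Matrix.mul_apply]
    rcases r with i | s <;> rcases c with j | t
    · simp [hN, hR, Mt, hG]
    · simp only [hN, hR, Matrix.transpose_apply, Mt, Sum.elim_inl, Sum.elim_inr, Matrix.fromBlocks_apply₁₂, Matrix.zero_apply]
      have := h4 t i
      calc _ = (∑ a, if cl a = t then p a i else 0) * (1 / √(k t : ℝ)) := by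
            rw [Finset.sum_mul]; refine Finset.sum_congr rfl fun a _ => ?_
            split_ifs <;> simp
        _ = 0 := by rw [this, zero_mul]
    · simp [hN, hR, Mt, Pi.single_apply]
    · simp only [hN, hR, Matrix.transpose_apply, Mt, Sum.elim_inr, Matrix.fromBlocks_apply₂₂, Matrix.diagonal_apply, Pi.single_apply,
        ite_mul, one_mul, zero_mul, Finset.sum_ite_eq', Finset.mem_univ, if_true, hv]
      by_cases h : s = t <;> simp [h]
  have e3 : N * N.transpose = Matrix.fromBlocks G 0 0 (Matrix.diagonal fun t => ((k t : ℝ) + 1) / k t) := by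
    ext r c
    rw [Matrix.mul_apply]
    rcases r with i | s <;> rcases c with j | t
    · simp [hN, Mt, hG]
    · simp only [hN, Matrix.transpose_apply, Mt, Sum.elim_inl, Sum.elim_inr, Matrix.fromBlocks_apply₁₂, Matrix.zero_apply]
      have := h4 t i
      calc _ = (∑ a, if cl a = t then p a i else 0) * (1 / √(k t : ℝ)) := by
            rw [Finset.sum_mul]; refine Finset.sum_congr rfl fun a _ => ?_
            split_ifs <;> simp
        _ = 0 := by rw [this, zero_mul]
    · simp only [hN, Matrix.transpose_apply, Mt, Sum.elim_inl, Sum.elim_inr, Matrix.fromBlocks_apply₂₁, Matrix.zero_apply]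
      have := h4 s j
      calc _ = (∑ a, if cl a = s then p a j else 0) * (1 / √(k s : ℝ)) := by
            rw [Finset.sum_mul]; refine Finset.sum_congr rfl fun a _ => ?_
            split_ifs <;> simp [mul_comm]
        _ = 0 := by rw [this, zero_mul]
    · simp only [hN, Matrix.transpose_apply, Mt, Sum.elim_inr, Matrix.fromBlocks_apply₂₂, Matrix.diagonal_apply]
      by_cases h : s = t
      · subst h
        rw [if_pos rfl, ← h1 s, Finset.sum_div]
        refine Finset.sum_congr rfl fun a _ => ?_
        split_ifs
        · exact iq _
        · simp
      · rw [if_neg h]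
        refine Finset.sum_eq_zero fun a _ => ?_
        by_cases h' : cl a = s
        · rw [if_neg (show ¬ cl a = t from fun h'' => h (h' ▸ h'')), mul_zero]
        · rw [if_neg h', zero_mul]
  have d1 : N.det ^ 2 = ∏ t, (1 + 1 / (k t : ℝ)) ^ (k t + 1) := by
    have := congrArg Matrix.det e1
    rw [Matrix.det_mul, Matrix.det_transpose, Matrix.det_diagonal] at this
    rw [pow_two, this, ← Finset.prod_fiberwise Finset.univ cl]
    refine Finset.prod_congr rfl fun t _ => ?_
    rw [← h2 t, ← Finset.prod_const]
    refine Finset.prod_congr rfl fun a ha => ?_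
    rw [(Finset.mem_filter.1 ha).2]
  have d2 := congrArg Matrix.det e2
  have d3 := congrArg Matrix.det e3
  rw [Matrix.det_mul, Matrix.det_transpose, Matrix.det_fromBlocks_zero₁₂, Matrix.det_diagonal] at d2 d3
  have hNp : 0 < N.det ^ 2 := by
    rw [d1]; refine Finset.prod_pos fun t _ => ?_
    have := kp t; positivity
  have hN0 : N.det ≠ 0 := fun h => by rw [h] at hNp; simp at hNp
  have key : R.det ^ 2 * ∏ t, ((k t : ℝ) + 1) ^ 2 = N.det ^ 2 * ∏ t, (k t : ℝ) := by
    simp only [Fin.prod_univ_three] at d2 d3 ⊢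
    have k0 := kp 0
    have k1 := kp 1
    have k2 := kp 2
    have s0 := sp 0
    have s1 := sp 1
    have s2 := sp 2
    have q0 := sq 0
    have q1 := sq 1
    have q2 := sq 2
    have d2' : (R.det * N.det) ^ 2 * ((k 0 : ℝ) * k 1 * k 2) = G.det ^ 2 := by
      rw [d2]
      calc _ = G.det ^ 2 * ((1 / √(k 0 : ℝ) * (1 / √(k 0 : ℝ))) * (1 / √(k 1 : ℝ) * (1 / √(k 1 : ℝ))) * (1 / √(k 2 : ℝ) * (1 / √(k 2 : ℝ)))) * ((k 0 : ℝ) * k 1 * k 2) := by ring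
        _ = G.det ^ 2 := by rw [iq, iq, iq]; field_simp
    have d3' : N.det ^ 2 * ((k 0 : ℝ) * k 1 * k 2) = G.det * (((k 0 : ℝ) + 1) * (k 1 + 1) * (k 2 + 1)) := by
      rw [pow_two, d3]; field_simp
    have hK : (0:ℝ) < (k 0 : ℝ) * k 1 * k 2 := by positivity
    refine mul_left_cancel₀ (mul_ne_zero hNp.ne' hK.ne') ?_
    calc _ = ((R.det * N.det) ^ 2 * ((k 0 : ℝ) * k 1 * k 2)) * (((k 0 : ℝ) + 1) * (k 1 + 1) * (k 2 + 1)) ^ 2 := by ring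
      _ = (G.det * (((k 0 : ℝ) + 1) * (k 1 + 1) * (k 2 + 1))) ^ 2 := by rw [d2']; ring
      _ = _ := by rw [← d3']; ring
  rw [key, d1, ← Finset.prod_mul_distrib]
  refine Finset.prod_congr rfl fun t _ => ?_
  have := kp t
  have e : 1 + 1 / (k t : ℝ) = ((k t : ℝ) + 1) / k t := by field_simp
  rw [e, div_pow, pow_succ (k t : ℝ)]
  field_simp

end MV

open MeasureTheory Real
namespace MV

def Sp (d : ℕ) : Set (Fin d → ℝ) := {z | (∀ i, 0 < z i) ∧ ∑ i, z i ≤ 1}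

theorem Sp_meas (d : ℕ) : MeasurableSet (Sp d) := by
  have : Sp d = (⋂ i, {z | 0 < z i}) ∩ {z | ∑ i, z i ≤ 1} := by ext z; simp [Sp]
  rw [this]
  refine MeasurableSet.inter (MeasurableSet.iInter fun i => ?_) ?_
  · exact measurableSet_lt measurable_const (measurable_pi_apply i)
  · exact measurableSet_le (by fun_prop) measurable_const

theorem Sp_vol (d : ℕ) : volume (Sp d) = ENNReal.ofReal (1 / (d.factorial : ℝ)) := by
  have h := Sx_vol d 1 zero_le_one
  rw [one_pow] at h
  rw [← h]
  refine measure_congr ?_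
  refine Filter.EventuallyLE.antisymm ?_ ?_
  · refine Filter.Eventually.of_forall fun z hz => ?_
    exact ⟨fun i => (hz.1 i).le, hz.2⟩
  · have : ∀ i : Fin d, ∀ᵐ z : Fin d → ℝ, z i ≠ 0 := by
      intro i
      rw [ae_iff]
      have := Measure.pi_hyperplane (fun _ : Fin d => (volume : Measure ℝ)) i 0
      simpa [volume_pi] using this
    rw [← ae_all_iff] at this
    filter_upwards [this] with z hz hzS
    exact ⟨fun i => lt_of_le_of_ne (hzS.1 i) (hz i).symm, hzS.2⟩

theorem region {d : ℕ} (p : (Fin d ⊕ Fin 3) → Fin d → ℝ)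
    (v : Fin 3 → Fin d ⊕ Fin 3) (hv : Function.Injective v)
    (hdet : (Mt p (fun t => Pi.single (v t) 1)).det ≠ 0) :
    ∃ A : Set (Fin d → ℝ), MeasurableSet A ∧
      volume A = ENNReal.ofReal (|(Mt p (fun t => Pi.single (v t) 1)).det| / (d.factorial : ℝ)) ∧
      ∀ z ∈ A, ∃ c : (Fin d ⊕ Fin 3) → ℝ, (∀ t, c (v t) = 0) ∧ (∀ a, a ∉ Set.range v → 0 < c a) ∧
        ∑ a, c a ≤ 1 ∧ ∑ a, c a • p a = z := by
  classical
  obtain ⟨σ, hσ⟩ : ∃ σ : Equiv.Perm (Fin d ⊕ Fin 3), ∀ t, σ (Sum.inr t) = v t := by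
    let e0 : {x : Fin d ⊕ Fin 3 // x ∈ Set.range (Sum.inr : Fin 3 → Fin d ⊕ Fin 3)} ≃ {x : Fin d ⊕ Fin 3 // x ∈ Set.range v} :=
      (Equiv.ofInjective _ Sum.inr_injective).symm.trans (Equiv.ofInjective v hv)
    refine ⟨e0.extendSubtype, fun t => ?_⟩
    rw [Equiv.extendSubtype_apply_of_mem e0 _ ⟨t, rfl⟩]
    have : (⟨Sum.inr t, ⟨t, rfl⟩⟩ : {x : Fin d ⊕ Fin 3 // x ∈ Set.range (Sum.inr : Fin 3 → Fin d ⊕ Fin 3)}) =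
      Equiv.ofInjective _ Sum.inr_injective t := rfl
    rw [this]
    simp [e0]
  set R := Mt p (fun t => Pi.single (v t) 1) with hR
  set L : Matrix (Fin d) (Fin d) ℝ := Matrix.of fun i j => p (σ (Sum.inl j)) i with hL
  have hsub : R.submatrix id σ = Matrix.fromBlocks L (Matrix.of fun i t => p (v t) i) 0 1 := by
    ext r c
    rcases r with i | s <;> rcases c with j | t
    · simp [hR, hL, Mt]
    · simp [hR, hσ, Mt]
    · have : σ (Sum.inl j) ≠ v s := by
        rw [← hσ]; intro h; have := σ.injective h; simp at this
      simp [hR, Mt, Pi.single_apply, this]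
    · simp [hR, Mt, Pi.single_apply, hσ, Matrix.one_apply, hv.eq_iff, eq_comm]
  have habs : |L.det| = |R.det| := by
    have h := congrArg Matrix.det hsub
    rw [Matrix.det_permute', Matrix.det_fromBlocks_zero₂₁, Matrix.det_one, mul_one] at h
    rw [← h, abs_mul]
    rcases Int.units_eq_one_or (Equiv.Perm.sign σ) with h | h <;> simp [h]
  have hL0 : L.det ≠ 0 := by
    intro h; rw [h, abs_zero] at habs; exact hdet (abs_eq_zero.1 habs.symm)
  have hinj : Function.Injective (Matrix.toLin' L) := by
    have : Function.Injective L.mulVec := Matrix.mulVec_injective_iff_isUnit.2 ((Matrix.isUnit_iff_isUnit_det L).2 (isUnit_iff_ne_zero.2 hL0))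
    intro x y h
    exact this (by simpa [Matrix.toLin'_apply] using h)
  have hcont : Continuous (Matrix.toLin' L) := LinearMap.continuous_of_finiteDimensional _
  refine ⟨Matrix.toLin' L '' Sp d, (hcont.measurableEmbedding hinj).measurableSet_image.2 (Sp_meas d), ?_, ?_⟩
  · rw [Measure.addHaar_image_linearMap, LinearMap.det_toLin', Sp_vol, habs, ← ENNReal.ofReal_mul (abs_nonneg _), mul_one_div]
  · rintro _ ⟨z, ⟨hz, hz1⟩, rfl⟩
    refine ⟨fun a => Sum.elim z (fun _ => 0) (σ.symm a), fun t => ?_, fun a ha => ?_, ?_, ?_⟩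
    · have : σ.symm (v t) = Sum.inr t := by rw [← hσ]; simp
      simp [this]
    · obtain ⟨b, rfl⟩ := σ.surjective a
      rcases b with j | t
      · simp [hz j]
      · exact absurd ⟨t, (hσ t).symm⟩ ha
    · rw [Equiv.sum_comp σ.symm (fun b => Sum.elim z (fun _ => (0:ℝ)) b), Fintype.sum_sum_type]
      simpa using hz1
    · rw [← Equiv.sum_comp σ, Fintype.sum_sum_type]
      ext i
      simp [Matrix.toLin'_apply, Matrix.mulVec, dotProduct, hL, mul_comm]

theorem lower (d : ℕ) (k : Fin 3 → ℕ) (hk : ∀ t, 0 < k t)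
    (cl : (Fin d ⊕ Fin 3) → Fin 3) (p : (Fin d ⊕ Fin 3) → Fin d → ℝ)
    (h1 : ∀ t, (∑ a, if cl a = t then (1:ℝ) else 0) = k t + 1)
    (h2 : ∀ t, (Finset.univ.filter fun a => cl a = t).card = k t + 1)
    (h3 : ∀ a b, ∑ i, p a i * p b i = (if a = b then 1 + 1 / (k (cl a) : ℝ) else 0) - (if cl a = cl b then 1 / (k (cl a) : ℝ) else 0))
    (h4 : ∀ t i, (∑ a, if cl a = t then p a i else 0) = 0) :
    ENNReal.ofReal (√(B2 (k 0) (k 1) (k 2)) / (d.factorial : ℝ)) ≤ volume (convexHull ℝ (Set.range p)) := by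
  classical
  have kp : ∀ t, (0:ℝ) < k t := fun t => by exact_mod_cast hk t
  set S : Finset (Fin 3 → Fin d ⊕ Fin 3) := Fintype.piFinset (fun t => Finset.univ.filter fun a => cl a = t) with hS
  have hSm : ∀ v ∈ S, ∀ t, cl (v t) = t := by
    intro v hv t
    have := Fintype.mem_piFinset.1 hv t
    simpa using this
  have hScard : (S.card : ℝ) = ∏ t, ((k t : ℝ) + 1) := by
    rw [hS, Fintype.card_piFinset]; push_cast [h2]; rfl
  have hB0 : ∏ t, (((k t : ℝ) + 1) ^ (k t + 1) / (k t : ℝ) ^ (k t)) = B2 (k 0) (k 1) (k 2) := by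
    rw [Fin.prod_univ_three, B2]
  have hP : 0 < ∏ t, ((k t : ℝ) + 1) := Finset.prod_pos fun t _ => by positivity
  have hBp : 0 < B2 (k 0) (k 1) (k 2) := by
    rw [← hB0]; refine Finset.prod_pos fun t _ => ?_
    have := kp t; positivity
  have hdet : ∀ v ∈ S, |(Mt p (fun t => Pi.single (v t) 1)).det| * ∏ t, ((k t : ℝ) + 1) = √(B2 (k 0) (k 1) (k 2)) := by
    intro v hv
    have := detR k hk cl p h1 h2 h3 h4 v (hSm v hv)
    rw [hB0, Finset.prod_pow, ← mul_pow] at this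
    rw [← this, Real.sqrt_sq_eq_abs, abs_mul, abs_of_pos hP]
  have hreg : ∀ v : S, ∃ A : Set (Fin d → ℝ), MeasurableSet A ∧
      volume A = ENNReal.ofReal (|(Mt p (fun t => Pi.single (v.1 t) 1)).det| / (d.factorial : ℝ)) ∧
      ∀ z ∈ A, ∃ c : (Fin d ⊕ Fin 3) → ℝ, (∀ t, c (v.1 t) = 0) ∧ (∀ a, a ∉ Set.range v.1 → 0 < c a) ∧
        ∑ a, c a ≤ 1 ∧ ∑ a, c a • p a = z := by
    rintro ⟨v, hv⟩
    refine region p v (fun s t h => ?_) ?_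
    · rw [← hSm v hv s, h, hSm v hv t]
    · intro h
      have := hdet v hv
      rw [h, abs_zero, zero_mul] at this
      exact (Real.sqrt_pos.2 hBp).ne this
  choose A hAm hAv hAc using hreg
  have hdisj : Pairwise (Function.onFun Disjoint A) := by
    intro v w hvw
    rw [Function.onFun, Set.disjoint_left]
    intro z hzv hzw
    obtain ⟨c, c0, cp, -, hc⟩ := hAc v z hzv
    obtain ⟨c', c0', cp', -, hc'⟩ := hAc w z hzw
    apply hvw
    have hker : ∀ i, ∑ a, (c a - c' a) * p a i = 0 := by
      intro i
      have := congrFun (hc.trans hc'.symm) i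
      simp only [Finset.sum_apply, Pi.smul_apply, smul_eq_mul] at this
      simp only [sub_mul, Finset.sum_sub_distrib]
      linarith
    have hcon : ∀ b, (c b - c' b) * (1 + 1 / (k (cl b) : ℝ)) = (∑ a, if cl a = cl b then c a - c' a else 0) * (1 / (k (cl b) : ℝ)) := by
      intro b
      have e : ∑ a, (c a - c' a) * ∑ i, p a i * p b i = 0 := by
        simp only [Finset.mul_sum]
        rw [Finset.sum_comm]
        refine Finset.sum_eq_zero fun i _ => ?_
        calc _ = (∑ a, (c a - c' a) * p a i) * p b i := by
              rw [Finset.sum_mul]; exact Finset.sum_congr rfl fun a _ => by ring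
          _ = 0 := by rw [hker, zero_mul]
      simp only [h3, mul_sub, mul_ite, mul_zero, Finset.sum_sub_distrib, Finset.sum_ite_eq', Finset.mem_univ, if_true] at e
      rw [sub_eq_zero.1 e, Finset.sum_mul]
      refine Finset.sum_congr rfl fun a _ => ?_
      split_ifs with h
      · rw [h]
      · simp
    have hcc : ∀ a b, cl a = cl b → c a - c' a = c b - c' b := by
      intro a b h
      have ha := hcon a
      rw [h, ← hcon b] at ha
      have := kp (cl b)
      exact mul_right_cancel₀ (by positivity) ha
    have nn : ∀ a, 0 ≤ c a := by
      intro a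
      by_cases h : a ∈ Set.range v.1
      · obtain ⟨t, rfl⟩ := h; rw [c0]
      · exact (cp a h).le
    have nn' : ∀ a, 0 ≤ c' a := by
      intro a
      by_cases h : a ∈ Set.range w.1
      · obtain ⟨t, rfl⟩ := h; rw [c0']
      · exact (cp' a h).le
    apply Subtype.ext
    funext t
    have ht := hcc (v.1 t) (w.1 t) (by rw [hSm _ v.2, hSm _ w.2])
    rw [c0, c0'] at ht
    have a1 := nn (w.1 t)
    have a2 := nn' (v.1 t)
    have hz : c (w.1 t) = 0 := by linarith
    by_contra hne
    have : w.1 t ∉ Set.range v.1 := by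
      rintro ⟨s, hs⟩
      have h' : s = t := by rw [← hSm _ v.2 s, hs, hSm _ w.2]
      exact hne (h' ▸ hs)
    exact (cp _ this).ne' hz
  have hsum0 : ∑ a, p a = 0 := by
    funext i
    have : ∑ t, (∑ a, if cl a = t then p a i else 0) = 0 := Finset.sum_eq_zero fun t _ => h4 t i
    rw [Finset.sum_comm] at this
    simpa using this
  have hsubset : (⋃ v, A v) ⊆ convexHull ℝ (Set.range p) := by
    refine Set.iUnion_subset fun v z hz => ?_
    obtain ⟨c, c0, cp, cs, hc⟩ := hAc v z hz
    have nn : ∀ a, 0 ≤ c a := by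
      intro a
      by_cases h : a ∈ Set.range v.1
      · obtain ⟨t, rfl⟩ := h; rw [c0]
      · exact (cp a h).le
    set δ : ℝ := (1 - ∑ a, c a) / (Fintype.card (Fin d ⊕ Fin 3) : ℝ) with hδ
    have hδ0 : 0 ≤ δ := div_nonneg (by linarith) (by positivity)
    have hz' : ∑ a, (c a + δ) • p a = z := by
      simp only [add_smul, Finset.sum_add_distrib, ← Finset.smul_sum, hsum0, hc, smul_zero, add_zero]
    rw [← hz']
    refine (convex_convexHull ℝ _).sum_mem (fun a _ => add_nonneg (nn a) hδ0) ?_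
      (fun a _ => subset_convexHull ℝ _ ⟨a, rfl⟩)
    rw [Finset.sum_add_distrib, Finset.sum_const, Finset.card_univ, nsmul_eq_mul, hδ]
    have : (Fintype.card (Fin d ⊕ Fin 3) : ℝ) ≠ 0 := by
      simp; positivity
    field_simp; ring
  refine le_trans (le_of_eq ?_) (measure_mono hsubset)
  rw [measure_iUnion hdisj hAm, tsum_fintype]
  have : ∀ v : S, volume (A v) = ENNReal.ofReal (√(B2 (k 0) (k 1) (k 2)) / (∏ t, ((k t : ℝ) + 1)) / (d.factorial : ℝ)) := by
    intro v
    rw [hAv, ← hdet v.1 v.2, mul_div_assoc, div_self hP.ne', mul_one]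
  rw [Finset.sum_congr rfl fun v _ => this v, Finset.sum_const, Finset.card_univ, Fintype.card_coe, nsmul_eq_mul,
    ← ENNReal.ofReal_natCast, ← ENNReal.ofReal_mul (by positivity), hScard]
  congr 1
  field_simp

end MV

open MeasureTheory Real
namespace MV

theorem vol_transport {d : ℕ} {ι : Type*} (p : ι → Fin d → ℝ) :
    volume (convexHull ℝ (Set.range fun a => (WithLp.toLp 2 (p a) : EuclideanSpace ℝ (Fin d)))) =
      volume (convexHull ℝ (Set.range p)) := by
  have hmp := EuclideanSpace.volume_preserving_symm_measurableEquiv_toLp (Fin d)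
  rw [← hmp.measure_preimage_equiv (convexHull ℝ (Set.range p))]
  congr 1
  have h := LinearMap.image_convexHull (𝕜 := ℝ) (WithLp.linearEquiv 2 ℝ (Fin d → ℝ)).symm.toLinearMap (Set.range p)
  rw [← Set.range_comp] at h
  have e : (Set.range fun a => (WithLp.toLp 2 (p a) : EuclideanSpace ℝ (Fin d))) =
      Set.range ((WithLp.linearEquiv 2 ℝ (Fin d → ℝ)).symm.toLinearMap ∘ p) := rfl
  rw [e, ← h]
  ext z
  constructor
  · rintro ⟨y, hy, rfl⟩
    exact hy
  · intro hz
    exact ⟨_, hz, rfl⟩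

theorem fac_sqrt (k : ℕ) (hk : 0 < k) :
    ((k:ℝ) + 1) ^ (((k:ℝ) + 1) / 2) * (k:ℝ) ^ (-(k:ℝ) / 2) = √(((k:ℝ) + 1) ^ (k + 1) / (k:ℝ) ^ k) := by
  have kp : (0:ℝ) < k := by exact_mod_cast hk
  rw [eq_comm, Real.sqrt_eq_iff_mul_self_eq (by positivity) (by positivity)]
  have a : ((k:ℝ) + 1) ^ (((k:ℝ) + 1) / 2) * ((k:ℝ) + 1) ^ (((k:ℝ) + 1) / 2) = ((k:ℝ) + 1) ^ (k + 1) := by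
    rw [← Real.rpow_add (by positivity), add_halves, ← Real.rpow_natCast]; push_cast; rfl
  have b : (k:ℝ) ^ (-(k:ℝ) / 2) * (k:ℝ) ^ (-(k:ℝ) / 2) = ((k:ℝ) ^ k)⁻¹ := by
    rw [← Real.rpow_add kp, add_halves, Real.rpow_neg kp.le, Real.rpow_natCast]
  rw [mul_mul_mul_comm, a, b, div_eq_mul_inv]

theorem rhs_eq (d k₁ k₂ k₃ : ℕ) (h₁ : 0 < k₁) (h₂ : 0 < k₂) (h₃ : 0 < k₃) :
    (1 / (Nat.factorial d : ℝ)) *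
            ((((k₁ : ℝ) + 1) ^ (((k₁ : ℝ) + 1) / 2) * (k₁ : ℝ) ^ (-(k₁ : ℝ) / 2)) *
             (((k₂ : ℝ) + 1) ^ (((k₂ : ℝ) + 1) / 2) * (k₂ : ℝ) ^ (-(k₂ : ℝ) / 2)) *
             (((k₃ : ℝ) + 1) ^ (((k₃ : ℝ) + 1) / 2) * (k₃ : ℝ) ^ (-(k₃ : ℝ) / 2))) =
    √(B2 k₁ k₂ k₃) / (d.factorial : ℝ) := by
  rw [fac_sqrt k₁ h₁, fac_sqrt k₂ h₂, fac_sqrt k₃ h₃, B2, Real.sqrt_mul (by positivity), Real.sqrt_mul (by positivity)]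
  ring

end MV

theorem max_volume_d_plus_3_odd_value (d : ℕ) (hd : 3 ≤ d) (hodd : Odd d)
    (k₁ k₂ k₃ : ℕ) (h₁ : 0 < k₁) (h₂ : 0 < k₂) (h₃ : 0 < k₃)
    (hsum : k₁ + k₂ + k₃ = d)
    (hk₁ : k₁ = d / 3 ∨ k₁ = (d + 2) / 3) (hk₂ : k₂ = d / 3 ∨ k₂ = (d + 2) / 3)
    (hk₃ : k₃ = d / 3 ∨ k₃ = (d + 2) / 3) :
    (∀ V : Finset (EuclideanSpace ℝ (Fin d)),
        (V : Set (EuclideanSpace ℝ (Fin d))) ⊆ Metric.sphere 0 1 → V.card = d + 3 →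
        (volume (convexHull ℝ (V : Set (EuclideanSpace ℝ (Fin d))))).toReal ≤
          (1 / (Nat.factorial d : ℝ)) *
            ((((k₁ : ℝ) + 1) ^ (((k₁ : ℝ) + 1) / 2) * (k₁ : ℝ) ^ (-(k₁ : ℝ) / 2)) *
             (((k₂ : ℝ) + 1) ^ (((k₂ : ℝ) + 1) / 2) * (k₂ : ℝ) ^ (-(k₂ : ℝ) / 2)) *
             (((k₃ : ℝ) + 1) ^ (((k₃ : ℝ) + 1) / 2) * (k₃ : ℝ) ^ (-(k₃ : ℝ) / 2)))) ∧
    (∃ V : Finset (EuclideanSpace ℝ (Fin d)),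
        (V : Set (EuclideanSpace ℝ (Fin d))) ⊆ Metric.sphere 0 1 ∧ V.card = d + 3 ∧
        (volume (convexHull ℝ (V : Set (EuclideanSpace ℝ (Fin d))))).toReal =
          (1 / (Nat.factorial d : ℝ)) *
            ((((k₁ : ℝ) + 1) ^ (((k₁ : ℝ) + 1) / 2) * (k₁ : ℝ) ^ (-(k₁ : ℝ) / 2)) *
             (((k₂ : ℝ) + 1) ^ (((k₂ : ℝ) + 1) / 2) * (k₂ : ℝ) ^ (-(k₂ : ℝ) / 2)) *
             (((k₃ : ℝ) + 1) ^ (((k₃ : ℝ) + 1) / 2) * (k₃ : ℝ) ^ (-(k₃ : ℝ) / 2)))) := by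
  classical
  rw [MV.rhs_eq d k₁ k₂ k₃ h₁ h₂ h₃]
  have hnn : 0 ≤ √(MV.B2 k₁ k₂ k₃) / (d.factorial : ℝ) := by positivity
  constructor
  · intro V hV hcard
    have hc : Fintype.card (Fin d ⊕ Fin 3) = Fintype.card V := by simp [hcard]
    let e : (Fin d ⊕ Fin 3) ≃ V := Fintype.equivOfCardEq hc
    let p : (Fin d ⊕ Fin 3) → Fin d → ℝ := fun a i => (e a).1 i
    have hp : ∀ a, ∑ i, p a i ^ 2 = 1 := by
      intro a
      have h : ‖(e a).1‖ = 1 := by simpa using hV (e a).2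
      rw [← EuclideanSpace.real_norm_sq_eq, h, one_pow]
    have hr : (V : Set (EuclideanSpace ℝ (Fin d))) = Set.range fun a => (WithLp.toLp 2 (p a) : EuclideanSpace ℝ (Fin d)) := by
      ext z
      constructor
      · intro hz
        exact ⟨e.symm ⟨z, hz⟩, by simp [p]⟩
      · rintro ⟨a, rfl⟩
        exact (e a).2
    rw [hr, MV.vol_transport]
    exact ENNReal.toReal_le_of_le_ofReal hnn (MV.upper hd hodd hsum hk₁ hk₂ hk₃ p hp)
  · obtain ⟨cl, p, h1, h2, h3, h4⟩ := MV.pts_exists d ![k₁, k₂, k₃]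
      (by intro t; fin_cases t <;> simpa) (by simpa [Fin.sum_univ_three] using hsum)
    have hp : ∀ a, ∑ i, p a i ^ 2 = 1 := by
      intro a
      have := h3 a a
      simp only [if_true, add_sub_cancel_right] at this
      simpa [pow_two] using this
    have hinj : Function.Injective p := by
      intro a b hab
      by_contra hne
      have h := h3 a b
      rw [← hab, if_neg hne] at h
      have h' := hp a
      simp only [pow_two] at h'
      rw [h'] at h
      split_ifs at h
      · have : (0:ℝ) ≤ 1 / ((![k₁, k₂, k₃] (cl a) : ℕ) : ℝ) := by positivity
        linarith
      · linarith
    let q : (Fin d ⊕ Fin 3) → EuclideanSpace ℝ (Fin d) := fun a => WithLp.toLp 2 (p a)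
    have hq : Function.Injective q := fun a b h => hinj (WithLp.toLp_injective 2 h)
    refine ⟨Finset.univ.image q, ?_, ?_, ?_⟩
    · intro z hz
      obtain ⟨a, -, rfl⟩ := Finset.mem_image.1 (Finset.mem_coe.1 hz)
      have : ‖q a‖ ^ 2 = 1 := by rw [EuclideanSpace.real_norm_sq_eq]; exact hp a
      rw [mem_sphere_zero_iff_norm]
      exact (pow_eq_one_iff_of_nonneg (norm_nonneg _) two_ne_zero).1 this
    · rw [Finset.card_image_of_injective _ hq]; simp
    · rw [Finset.coe_image, Finset.coe_univ, Set.image_univ, MV.vol_transport]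
      have hlo := MV.lower d ![k₁, k₂, k₃] (by intro t; fin_cases t <;> simpa) cl p h1 h2 h3 h4
      have hup := MV.upper hd hodd hsum hk₁ hk₂ hk₃ p hp
      rw [le_antisymm hup hlo, ENNReal.toReal_ofReal hnn]
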